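/- Let 2 ≤ k < d be integers. Every (d,k) set A ⊆ ℝ^d has Hausdorff dimension at least d − (d−k)/(1+√2)^k. Moreover, if (1+√2)^{k−1} + k > d, then every (d,k) set has positive d-dimensional Lebesgue measure. -/

import Mathlib

open MeasureTheory ENNReal

noncomputable section

/-- `ℝ^d` with the Euclidean structure. -/
abbrev Euc (n : ℕ) := EuclideanSpace ℝ (Fin n)

/-- A `(d,k)` set: a Lebesgue measurable subset of `ℝ^d` containing a translate of
every `k`-plane. -/
def IsDKSet (d k : ℕ) (A : Set (Euc d)) : Prop :=
  NullMeasurableSet A volume ∧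
    ∀ M : Submodule ℝ (Euc d), Module.finrank ℝ M = k →
      ∃ x : Euc d, ∀ y ∈ M, y + x ∈ A

/-! ### Basic counting and pigeonhole tools -/

/-- integer points with controlled coordinate differences -/
theorem kt_count {n : ℕ} (X : Finset (Fin n → ℤ)) (D : Fin n → ℝ) (hD : ∀ i, 0 ≤ D i)
    (h : ∀ a ∈ X, ∀ b ∈ X, ∀ i, ((a i : ℝ) - b i) ≤ D i) :
    (X.card : ℝ) ≤ ∏ i, (D i + 1) := by
  classical
  rcases X.eq_empty_or_nonempty with rfl | hne
  · simp only [Finset.card_empty, Nat.cast_zero]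
    exact Finset.prod_nonneg fun i _ => by linarith [hD i]
  have hmin : ∀ i, ∃ a ∈ X, ∀ b ∈ X, a i ≤ b i := fun i => X.exists_min_image (fun a => a i) hne
  choose m hm hm' using hmin
  have hsub : X ⊆ Fintype.piFinset (fun i => Finset.Icc (m i i) (m i i + ⌊D i⌋)) := by
    intro a ha
    rw [Fintype.mem_piFinset]
    intro i
    rw [Finset.mem_Icc]
    refine ⟨hm' i a ha, ?_⟩
    have := h a ha (m i) (hm i) i
    have h2 : a i - m i i ≤ ⌊D i⌋ := by
      rw [Int.le_floor]; push_cast; exact this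
    linarith
  have h1 := Finset.card_le_card hsub
  rw [Fintype.card_piFinset] at h1
  have h2 : (X.card : ℝ) ≤ ∏ i, (((Finset.Icc (m i i) (m i i + ⌊D i⌋)).card : ℕ) : ℝ) := by
    exact_mod_cast h1
  refine h2.trans (Finset.prod_le_prod (fun i _ => by positivity) fun i _ => ?_)
  rw [Int.card_Icc]
  have h0 : 0 ≤ ⌊D i⌋ := Int.floor_nonneg.mpr (hD i)
  have : ((m i i + ⌊D i⌋ + 1 - m i i).toNat : ℤ) = ⌊D i⌋ + 1 := by
    rw [Int.toNat_of_nonneg (by linarith)]; ring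
  have h3 : (((m i i + ⌊D i⌋ + 1 - m i i).toNat : ℕ) : ℝ) = (⌊D i⌋ : ℝ) + 1 := by
    exact_mod_cast this
  rw [h3]
  linarith [Int.floor_le (D i)]

theorem kt_count_const {n : ℕ} (X : Finset (Fin n → ℤ)) (D : ℝ) (hD : 0 ≤ D)
    (h : ∀ a ∈ X, ∀ b ∈ X, ∀ i, ((a i : ℝ) - b i) ≤ D) :
    (X.card : ℝ) ≤ (D + 1) ^ n := by
  have := kt_count X (fun _ => D) (fun _ => hD) h
  simpa using this

/-- pigeonhole over a real parameter -/
theorem kt_pigeon {ι : Type*} (X : Finset ι) (D : ι → Set ℝ) (a b η : ℝ) (hab : a ≤ b)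
    (hη : 0 ≤ η)
    (hD : ∀ x ∈ X, MeasurableSet (D x)) (hsub : ∀ x ∈ X, D x ⊆ Set.Icc a b)
    (hvol : ∀ x ∈ X, ENNReal.ofReal η ≤ volume (D x)) (hne : X.Nonempty) (hη' : 0 < η)
    (p : ℝ → ι → Prop) [∀ t, DecidablePred (p t)] (hp : ∀ t, ∀ x ∈ X, p t x ↔ t ∈ D x) :
    ∃ t ∈ Set.Icc a b, η * X.card ≤ (b - a) * (X.filter (p t)).card := by
  classical
  by_contra hcon
  push Not at hcon
  have key : ∀ t, ∑ x ∈ X, (D x).indicator (fun _ => (1 : ℝ≥0∞)) t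
      = ((X.filter (p t)).card : ℝ≥0∞) := by
    intro t
    rw [Finset.card_filter]
    push_cast
    refine Finset.sum_congr rfl fun x hx => ?_
    rw [Set.indicator_apply]
    simp only [hp t x hx]
  have h1 : ∑ x ∈ X, volume (D x) = ∫⁻ t in Set.Icc a b, ((X.filter (p t)).card : ℝ≥0∞) := by
    simp_rw [← key]
    rw [lintegral_finsetSum' _ (fun x hx => (measurable_const.indicator (hD x hx)).aemeasurable)]
    refine Finset.sum_congr rfl fun x hx => ?_
    rw [lintegral_indicator (hD x hx)]
    simp only [lintegral_const, MeasurableSet.univ, Measure.restrict_apply, Set.univ_inter, one_mul]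
    rw [Measure.restrict_apply (hD x hx), Set.inter_eq_left.mpr (hsub x hx)]
  have h2 : ENNReal.ofReal (η * X.card) ≤ ∑ x ∈ X, volume (D x) := by
    calc ENNReal.ofReal (η * X.card) = ∑ x ∈ X, ENNReal.ofReal η := by
          rw [Finset.sum_const, nsmul_eq_mul, mul_comm, ENNReal.ofReal_mul (by positivity)]
          simp
      _ ≤ _ := Finset.sum_le_sum hvol
  have hXpos : 0 < η * X.card := by
    have : 0 < (X.card : ℝ) := by exact_mod_cast hne.card_pos
    positivity
  -- the counting function takes integer values, use the maximum
  rcases eq_or_lt_of_le hab with rfl | hlt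
  · have := hcon a (by simp)
    rw [Set.Icc_self] at h1
    simp at h1
    have hz : ∑ x ∈ X, volume (D x) = 0 := by
      simpa using h1
    rw [hz] at h2
    have := ENNReal.ofReal_eq_zero.mp (le_antisymm h2 bot_le)
    linarith
  have hba : 0 < b - a := by linarith
  -- finitely many values
  have hfin : ∃ M : ℝ, M * (b - a) < η * X.card ∧ 0 ≤ M ∧ ∀ t ∈ Set.Icc a b, ((X.filter (p t)).card : ℝ) ≤ M := by
    have hs : ((fun t => ((X.filter (p t)).card : ℝ)) '' Set.Icc a b).Finite := by
      apply Set.Finite.subset ((Finset.range (X.card + 1)).finite_toSet.image (fun k : ℕ => (k : ℝ)))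
      rintro _ ⟨t, _, rfl⟩
      refine ⟨(X.filter (p t)).card, ?_, rfl⟩
      simp only [Finset.coe_range, Set.mem_Iio]
      exact Nat.lt_succ_of_le (Finset.card_filter_le _ _)
    have hne' : ((fun t => ((X.filter (p t)).card : ℝ)) '' Set.Icc a b).Nonempty :=
      (Set.nonempty_Icc.mpr hab).image _
    obtain ⟨_, ⟨t, ht, rfl⟩, hmax⟩ := Set.exists_max_image _ id hs hne'
    refine ⟨_, ?_, Nat.cast_nonneg _, fun t' ht' => hmax _ ⟨t', ht', rfl⟩⟩
    have := hcon t ht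
    linarith
  obtain ⟨M, hM, hM0, hMt⟩ := hfin
  have h3 : ∫⁻ t in Set.Icc a b, ((X.filter (p t)).card : ℝ≥0∞) ≤ ENNReal.ofReal (M * (b - a)) := by
    calc _ ≤ ∫⁻ t in Set.Icc a b, ENNReal.ofReal M := by
          apply setLIntegral_mono measurable_const
          intro t ht
          rw [← ENNReal.ofReal_natCast]
          exact ENNReal.ofReal_le_ofReal (hMt t ht)
      _ = _ := by
          rw [setLIntegral_const, Real.volume_Icc, ENNReal.ofReal_mul hM0]
  rw [← h1] at h3
  have := (ENNReal.ofReal_le_ofReal_iff (by positivity)).mp (h2.trans h3)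
  linarith

/-! ### Discrete lines -/

/-- integer lines -/
abbrev Ln (n : ℕ) := (Fin n → ℤ) × (Fin n → ℤ)

def lpos {n : ℕ} (l : Ln n) (t : ℝ) (i : Fin n) : ℝ := l.1 i + t * l.2 i

def lcel {n : ℕ} (l : Ln n) (t : ℝ) : Fin n → ℤ := fun i => ⌊lpos l t i⌋

open Classical in
def lNt {n : ℕ} (L : Finset (Ln n)) (S : Ln n → Set ℝ) (t : ℝ) : ℕ :=
  ((L.filter (fun l => t ∈ S l)).image (fun l => lcel l t)).card

theorem lNt_measurable {n : ℕ} (L : Finset (Ln n)) (S : Ln n → Set ℝ)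
    (hS : ∀ l ∈ L, MeasurableSet (S l)) : Measurable (lNt L S) := by
  classical
  let φ : ℝ → (L → Bool × (Fin n → ℤ)) := fun t l => (decide (t ∈ S l.1), lcel l.1 t)
  have hφ : Measurable φ := by
    refine measurable_pi_lambda _ fun l => ?_
    refine Measurable.prodMk ?_ ?_
    · apply measurable_to_bool
      have : (fun t => decide (t ∈ S l.1)) ⁻¹' {true} = S l.1 := by
        ext t; simp
      rw [this]; exact hS l.1 l.2
    · refine measurable_pi_lambda _ fun i => ?_
      apply Int.measurable_floor.comp
      unfold lpos
      fun_prop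
  let g : (L → Bool × (Fin n → ℤ)) → ℕ := fun f =>
    ((Finset.univ.filter (fun l : L => (f l).1 = true)).image (fun l => (f l).2)).card
  have hg : Measurable g := measurable_of_countable g
  have : lNt L S = g ∘ φ := by
    funext t
    simp only [lNt, g, φ, Function.comp]
    congr 1
    ext c
    simp only [Finset.mem_image, Finset.mem_filter, Finset.mem_univ, true_and, decide_eq_true_eq]
    constructor
    · rintro ⟨l, ⟨h1, h2⟩, h3⟩; exact ⟨⟨l, h1⟩, h2, h3⟩
    · rintro ⟨⟨l, h1⟩, h2, h3⟩; exact ⟨l, ⟨h1, h2⟩, h3⟩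
  rw [this]
  exact hg.comp hφ

theorem lcel_diff {n : ℕ} {l l' : Ln n} {t : ℝ} (h : lcel l t = lcel l' t) (i : Fin n) :
    |lpos l t i - lpos l' t i| ≤ 1 := by
  have := congrFun h i
  exact (Int.abs_sub_lt_one_of_floor_eq_floor this).le

theorem line_count {n : ℕ} (X : Finset (Ln n)) (D E : ℝ) (hD : 0 ≤ D) (hE : 0 ≤ E)
    (h1 : ∀ a ∈ X, ∀ b ∈ X, ∀ i, ((a.2 i : ℝ) - b.2 i) ≤ D)
    (h2 : ∀ a ∈ X, ∀ b ∈ X, ∀ i, ((a.1 i : ℝ) - b.1 i) ≤ E) :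
    (X.card : ℝ) ≤ (D + 1) ^ n * (E + 1) ^ n := by
  classical
  have hsub : X ⊆ (X.image Prod.fst) ×ˢ (X.image Prod.snd) := by
    intro a ha
    rw [Finset.mem_product]
    exact ⟨Finset.mem_image_of_mem _ ha, Finset.mem_image_of_mem _ ha⟩
  have := Finset.card_le_card hsub
  rw [Finset.card_product] at this
  have h3 : (X.card : ℝ) ≤ ((X.image Prod.fst).card : ℝ) * (X.image Prod.snd).card := by
    exact_mod_cast this
  have h4 : ((X.image Prod.fst).card : ℝ) ≤ (E + 1) ^ n := by
    apply kt_count_const _ _ hE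
    intro a ha b hb i
    obtain ⟨a', ha', rfl⟩ := Finset.mem_image.mp ha
    obtain ⟨b', hb', rfl⟩ := Finset.mem_image.mp hb
    exact h2 _ ha' _ hb' i
  have h5 : ((X.image Prod.snd).card : ℝ) ≤ (D + 1) ^ n := by
    apply kt_count_const _ _ hD
    intro a ha b hb i
    obtain ⟨a', ha', rfl⟩ := Finset.mem_image.mp ha
    obtain ⟨b', hb', rfl⟩ := Finset.mem_image.mp hb
    exact h1 _ ha' _ hb' i
  calc (X.card : ℝ) ≤ _ := h3
    _ ≤ (E + 1) ^ n * (D + 1) ^ n := by gcongr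
    _ = _ := by ring

/-- lines with prescribed cells at two separated times -/
theorem two_cells {n : ℕ} (X : Finset (Ln n)) (t t' η : ℝ) (hη : 0 < η) (ht0 : 0 ≤ t) (ht1 : t ≤ 1)
    (htt : η ≤ |t - t'|)
    (h1 : ∀ a ∈ X, ∀ b ∈ X, lcel a t = lcel b t)
    (h2 : ∀ a ∈ X, ∀ b ∈ X, lcel a t' = lcel b t') :
    (X.card : ℝ) ≤ (2 / η + 1) ^ n * (2 / η + 2) ^ n := by
  have hv : ∀ a ∈ X, ∀ b ∈ X, ∀ i, |(a.2 i : ℝ) - b.2 i| ≤ 2 / η := by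
    intro a ha b hb i
    have e1 := lcel_diff (h1 a ha b hb) i
    have e2 := lcel_diff (h2 a ha b hb) i
    have e3 : (t - t') * ((a.2 i : ℝ) - b.2 i)
        = (lpos a t i - lpos b t i) - (lpos a t' i - lpos b t' i) := by
      unfold lpos; ring
    have e4 : |t - t'| * |(a.2 i : ℝ) - b.2 i| ≤ 2 := by
      rw [← abs_mul, e3]
      calc _ ≤ |lpos a t i - lpos b t i| + |lpos a t' i - lpos b t' i| := abs_sub _ _
        _ ≤ 2 := by linarith
    rw [le_div_iff₀ hη]
    have := mul_le_mul_of_nonneg_right htt (abs_nonneg ((a.2 i : ℝ) - b.2 i))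
    linarith
  have := line_count X (2 / η) (2 / η + 1) (by positivity) (by positivity)
    (fun a ha b hb i => (le_abs_self _).trans (hv a ha b hb i)) ?_
  · calc _ ≤ _ := this
      _ = _ := by ring
  · intro a ha b hb i
    have e1 := lcel_diff (h1 a ha b hb) i
    have e2 := hv a ha b hb i
    have e3 : (a.1 i : ℝ) - b.1 i = (lpos a t i - lpos b t i) - t * ((a.2 i : ℝ) - b.2 i) := by
      unfold lpos; ring
    rw [e3]
    have e4 : -(t * ((a.2 i : ℝ) - b.2 i)) ≤ 2 / η := by
      calc _ ≤ |t * ((a.2 i : ℝ) - b.2 i)| := neg_le_abs _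
        _ = t * |(a.2 i : ℝ) - b.2 i| := by rw [abs_mul, abs_of_nonneg ht0]
        _ ≤ 1 * (2 / η) := by gcongr
        _ = _ := one_mul _
    have e5 := (le_abs_self _).trans e1
    linarith

/-- the auxiliary point `w` -/
def lom {n : ℕ} (t0 κ : ℝ) (x : Ln n × Ln n) : Fin n → ℤ :=
  fun i => ⌊lpos x.1 t0 i + κ * x.2.2 i⌋

theorem lom_diff {n : ℕ} {t0 κ : ℝ} {x x' : Ln n × Ln n} (h : lom t0 κ x = lom t0 κ x') (i : Fin n) :
    |(lpos x.1 t0 i + κ * x.2.2 i) - (lpos x'.1 t0 i + κ * x'.2.2 i)| ≤ 1 := by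
  have := congrFun h i
  exact (Int.abs_sub_lt_one_of_floor_eq_floor this).le

/-- C2 -/
theorem count_C2 {n : ℕ} (X : Finset (Ln n × Ln n)) (t1 t0 κ ζ : ℝ) (hζ : 0 < ζ) (hκ : ζ ≤ |κ|)
    (ht0 : 0 ≤ t1) (ht1 : t1 ≤ 1)
    (hX : ∀ x ∈ X, lcel x.1 t1 = lcel x.2 t1)
    (hw : ∀ x ∈ X, ∀ x' ∈ X, lom t0 κ x = lom t0 κ x')
    (hf : ∀ x ∈ X, ∀ x' ∈ X, x.1 = x'.1) :
    (X.card : ℝ) ≤ (1 / ζ + 1) ^ n * (1 / ζ + 2) ^ n := by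
  classical
  have hinj : (X.image Prod.snd).card = X.card := by
    apply Finset.card_image_of_injOn
    intro x hx x' hx' h
    exact Prod.ext (hf x hx x' hx') h
  rw [← hinj]
  have hv : ∀ a ∈ X, ∀ b ∈ X, ∀ i, |(a.2.2 i : ℝ) - b.2.2 i| ≤ 1 / ζ := by
    intro a ha b hb i
    have e1 := lom_diff (hw a ha b hb) i
    rw [hf a ha b hb] at e1
    have e2 : |κ| * |(a.2.2 i : ℝ) - b.2.2 i| ≤ 1 := by
      rw [← abs_mul]
      have e3 : κ * ((a.2.2 i : ℝ) - b.2.2 i) = (lpos b.1 t0 i + κ * a.2.2 i) - (lpos b.1 t0 i + κ * b.2.2 i) := by ring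
      rw [e3]; exact e1
    rw [le_div_iff₀ hζ]
    have := mul_le_mul_of_nonneg_right hκ (abs_nonneg ((a.2.2 i : ℝ) - b.2.2 i))
    linarith
  have := line_count (X.image Prod.snd) (1 / ζ) (1 / ζ + 1) (by positivity) (by positivity) ?_ ?_
  · calc _ ≤ _ := this
      _ = _ := by ring
  · intro a ha b hb i
    obtain ⟨a, ha', rfl⟩ := Finset.mem_image.mp ha
    obtain ⟨b, hb', rfl⟩ := Finset.mem_image.mp hb
    exact (le_abs_self _).trans (hv a ha' b hb' i)
  · intro a ha b hb i
    obtain ⟨a, ha', rfl⟩ := Finset.mem_image.mp ha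
    obtain ⟨b, hb', rfl⟩ := Finset.mem_image.mp hb
    have hc : lcel a.2 t1 = lcel b.2 t1 := by
      rw [← hX a ha', ← hX b hb', hf a ha' b hb']
    have e1 := lcel_diff hc i
    have e2 := hv a ha' b hb' i
    have e3 : (a.2.1 i : ℝ) - b.2.1 i
        = (lpos a.2 t1 i - lpos b.2 t1 i) - t1 * ((a.2.2 i : ℝ) - b.2.2 i) := by
      unfold lpos; ring
    rw [e3]
    have e4 : -(t1 * ((a.2.2 i : ℝ) - b.2.2 i)) ≤ 1 / ζ := by
      calc _ ≤ |t1 * ((a.2.2 i : ℝ) - b.2.2 i)| := neg_le_abs _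
        _ = t1 * |(a.2.2 i : ℝ) - b.2.2 i| := by rw [abs_mul, abs_of_nonneg ht0]
        _ ≤ 1 * (1 / ζ) := by gcongr
        _ = _ := one_mul _
    have e5 := (le_abs_self _).trans e1
    linarith

/-- C3 -/
theorem count_C3 {n : ℕ} (X : Finset (Ln n × Ln n)) (t1 t0 κ η t s : ℝ) (hη : 0 < η)
    (hη1 : η ≤ 1)
    (ht1 : t1 ∈ Set.Icc (0 : ℝ) 1) (ht0 : t0 ∈ Set.Icc (0 : ℝ) 1)
    (h1 : η ≤ |t - t1|) (h2 : η ≤ |t - t0|)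
    (hs : s = t1 + κ * (t - t1) / (t - t0))
    (hX : ∀ x ∈ X, lcel x.1 t1 = lcel x.2 t1)
    (hw : ∀ x ∈ X, ∀ x' ∈ X, lcel x.1 t = lcel x'.1 t)
    (hf : ∀ x ∈ X, ∀ x' ∈ X, lcel x.2 s = lcel x'.2 s) :
    (((X.image (lom t0 κ)).card : ℕ) : ℝ) ≤ (8 / η + 1) ^ n := by
  have hτ : t - t1 ≠ 0 := by intro h; rw [h, abs_zero] at h1; linarith
  have hτ0 : t - t0 ≠ 0 := by intro h; rw [h, abs_zero] at h2; linarith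
  set θ : ℝ := (t0 - t1) / (t - t1) with hθ
  have hθabs : |θ| ≤ 1 / η := by
    rw [hθ, abs_div]
    have : |t0 - t1| ≤ 1 := by
      rw [abs_le]; constructor <;> linarith [ht1.1, ht1.2, ht0.1, ht0.2]
    exact div_le_div₀ (by norm_num) this hη h1
  have hη2 : 1 ≤ 1 / η := by rw [le_div_iff₀ hη]; linarith
  have hθabs' : |1 - θ| ≤ 2 / η := by
    calc |1 - θ| ≤ |1| + |θ| := abs_sub _ _
      _ ≤ 1 / η + 1 / η := by rw [abs_one]; linarith
      _ = _ := by ring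
  have hid : ∀ x : Ln n × Ln n, ∀ i, lpos x.1 t0 i + κ * x.2.2 i =
      θ * lpos x.1 t i + (1 - θ) * lpos x.2 s i - (1 - θ) * (lpos x.2 t1 i - lpos x.1 t1 i) := by
    intro x i
    have hk : (1 - θ) * (s - t1) = κ := by
      rw [hs, hθ]; field_simp; ring
    have hk2 : θ * (t - t1) = t0 - t1 := by rw [hθ]; field_simp
    unfold lpos
    have : κ * (x.2.2 i : ℝ) = (1 - θ) * (s - t1) * x.2.2 i := by rw [hk]
    rw [this]
    have h3 : t0 * (x.1.2 i : ℝ) = (t1 + θ * (t - t1)) * x.1.2 i := by rw [hk2]; ring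
    rw [h3]; ring
  apply kt_count_const _ _ (by positivity)
  classical
  intro a ha b hb i
  obtain ⟨x, hx, rfl⟩ := Finset.mem_image.mp ha
  obtain ⟨x', hx', rfl⟩ := Finset.mem_image.mp hb
  have e1 := lcel_diff (hw x hx x' hx') i
  have e2 := lcel_diff (hf x hx x' hx') i
  have e3 := lcel_diff (hX x hx) i
  have e4 := lcel_diff (hX x' hx') i
  have f1 : (lom t0 κ x i : ℝ) - lom t0 κ x' i ≤
      (lpos x.1 t0 i + κ * x.2.2 i) - (lpos x'.1 t0 i + κ * x'.2.2 i) + 1 := by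
    unfold lom
    have := Int.floor_le (lpos x.1 t0 i + κ * x.2.2 i)
    have := Int.lt_floor_add_one (lpos x'.1 t0 i + κ * x'.2.2 i)
    linarith
  rw [hid x i, hid x' i] at f1
  have g1 : θ * (lpos x.1 t i - lpos x'.1 t i) ≤ 1 / η * 1 := by
    calc _ ≤ |θ * (lpos x.1 t i - lpos x'.1 t i)| := le_abs_self _
      _ = |θ| * |lpos x.1 t i - lpos x'.1 t i| := abs_mul _ _
      _ ≤ _ := by gcongr
  have g2 : (1 - θ) * ((lpos x.2 s i - lpos x'.2 s i)) ≤ 2 / η * 1 := by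
    calc _ ≤ |(1 - θ) * ((lpos x.2 s i - lpos x'.2 s i))| := le_abs_self _
      _ = |1 - θ| * |lpos x.2 s i - lpos x'.2 s i| := abs_mul _ _
      _ ≤ _ := by gcongr
  have g3 : (1 - θ) * (lpos x.1 t1 i - lpos x.2 t1 i) ≤ 2 / η * 1 := by
    calc _ ≤ |(1 - θ) * (lpos x.1 t1 i - lpos x.2 t1 i)| := le_abs_self _
      _ = |1 - θ| * |lpos x.1 t1 i - lpos x.2 t1 i| := abs_mul _ _
      _ ≤ _ := by gcongr
  have g4 : -((1 - θ) * (lpos x'.1 t1 i - lpos x'.2 t1 i)) ≤ 2 / η * 1 := by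
    calc _ ≤ |(1 - θ) * (lpos x'.1 t1 i - lpos x'.2 t1 i)| := neg_le_abs _
      _ = |1 - θ| * |lpos x'.1 t1 i - lpos x'.2 t1 i| := abs_mul _ _
      _ ≤ _ := by gcongr
  have : (8 : ℝ) / η = 1 / η * 1 + 2 / η * 1 + 2 / η * 1 + 2 / η * 1 + 1 / η := by ring
  rw [this]; linarith [g1, g2, g3, g4, f1, hη2]

/-! ### Slicing -/

def kTset (S1 S2 : Set ℝ) (t1 t0 η κ : ℝ) : Set ℝ :=
  {t | t ∈ S1 ∧ η ≤ |t - t1| ∧ η ≤ |t - t0| ∧ t1 + κ * ((t - t1) / (t - t0)) ∈ S2 ∧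
    η ≤ |κ * ((t - t1) / (t - t0))|}

theorem kRset_meas (S1 S2 : Set ℝ) (hS1 : MeasurableSet S1) (hS2 : MeasurableSet S2) (t1 t0 η : ℝ) :
    MeasurableSet {p : ℝ × ℝ | p.2 ∈ kTset S1 S2 t1 t0 η p.1} := by
  have hm : Measurable (fun p : ℝ × ℝ => p.1 * ((p.2 - t1) / (p.2 - t0))) := by fun_prop
  have h1 : MeasurableSet {p : ℝ × ℝ | p.2 ∈ S1} := measurable_snd hS1
  have h2 : MeasurableSet {p : ℝ × ℝ | η ≤ |p.2 - t1|} :=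
    measurableSet_le measurable_const (by fun_prop)
  have h3 : MeasurableSet {p : ℝ × ℝ | η ≤ |p.2 - t0|} :=
    measurableSet_le measurable_const (by fun_prop)
  have h4 : MeasurableSet {p : ℝ × ℝ | t1 + p.1 * ((p.2 - t1) / (p.2 - t0)) ∈ S2} :=
    (hm.const_add t1) hS2
  have h5 : MeasurableSet {p : ℝ × ℝ | η ≤ |p.1 * ((p.2 - t1) / (p.2 - t0))|} :=
    measurableSet_le measurable_const (by fun_prop)
  exact h1.inter (h2.inter (h3.inter (h4.inter h5)))

theorem kTset_meas (S1 S2 : Set ℝ) (hS1 : MeasurableSet S1) (hS2 : MeasurableSet S2)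
    (t1 t0 η κ : ℝ) : MeasurableSet (kTset S1 S2 t1 t0 η κ) :=
  measurable_prodMk_left (kRset_meas S1 S2 hS1 hS2 t1 t0 η) (x := κ)

/-- removing a small interval -/
theorem vol_remove (S : Set ℝ) (t1 η a : ℝ) (ha : ENNReal.ofReal a ≤ volume S) (hη : 0 ≤ η) :
    ENNReal.ofReal (a - 2 * η) ≤ volume {t | t ∈ S ∧ η ≤ |t - t1|} := by
  have hsub : S ⊆ {t | t ∈ S ∧ η ≤ |t - t1|} ∪ Metric.ball t1 η := by
    intro t ht
    by_cases h : η ≤ |t - t1|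
    · exact Or.inl ⟨ht, h⟩
    · right; rw [Metric.mem_ball, Real.dist_eq]; exact not_le.mp h
  have h1 := (measure_mono hsub).trans (measure_union_le (μ := volume) _ _)
  rw [Real.volume_ball] at h1
  rw [ENNReal.ofReal_sub _ (by positivity)]
  exact tsub_le_iff_right.mpr (ha.trans h1)

theorem vol_affine (S : Set ℝ) (t1 ρ : ℝ) (hρ : ρ ≠ 0) :
    volume {κ : ℝ | t1 + κ * ρ ∈ S} = ENNReal.ofReal |ρ⁻¹| * volume S := by
  have : {κ : ℝ | t1 + κ * ρ ∈ S} = (fun x => x * ρ) ⁻¹' ((fun x => t1 + x) ⁻¹' S) := rfl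
  rw [this, Real.volume_preimage_mul_right hρ, measure_preimage_add]

theorem kt_slice (S1 S2 : Set ℝ) (hS1 : MeasurableSet S1) (hS2 : MeasurableSet S2)
    (h1 : S1 ⊆ Set.Icc 0 1) (h2 : S2 ⊆ Set.Icc 0 1) (lam : ℝ) (hl : 0 < lam) (hl1 : lam ≤ 1)
    (hv1 : ENNReal.ofReal lam ≤ volume S1) (hv2 : ENNReal.ofReal lam ≤ volume S2)
    (t1 t0 : ℝ) (ht1 : t1 ∈ Set.Icc (0 : ℝ) 1) (ht0 : t0 ∈ Set.Icc (0 : ℝ) 1) :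
    MeasurableSet {κ | κ ∈ Set.Icc (-(8 / lam)) (8 / lam) ∧
      ENNReal.ofReal (lam ^ 4 / 1024) ≤ volume (kTset S1 S2 t1 t0 (lam / 8) κ)} ∧
    ENNReal.ofReal (lam ^ 3 / 64) ≤ volume {κ | κ ∈ Set.Icc (-(8 / lam)) (8 / lam) ∧
      ENNReal.ofReal (lam ^ 4 / 1024) ≤ volume (kTset S1 S2 t1 t0 (lam / 8) κ)} := by
  set η := lam / 8 with hη
  have hη0 : 0 < η := by positivity
  set R : Set (ℝ × ℝ) := {p : ℝ × ℝ | p.2 ∈ kTset S1 S2 t1 t0 η p.1} with hR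
  have hRm : MeasurableSet R := kRset_meas S1 S2 hS1 hS2 t1 t0 η
  have hφ : Measurable (fun κ => volume (kTset S1 S2 t1 t0 η κ)) :=
    measurable_measure_prodMk_left (ν := (volume : Measure ℝ)) hRm
  set D : Set ℝ := {κ | κ ∈ Set.Icc (-(8 / lam)) (8 / lam) ∧
      ENNReal.ofReal (lam ^ 4 / 1024) ≤ volume (kTset S1 S2 t1 t0 η κ)} with hD
  have hDm : MeasurableSet D := measurableSet_Icc.inter (measurableSet_le measurable_const hφ)
  refine ⟨hDm, ?_⟩
  -- slices bounded by one
  have hT1 : ∀ κ, volume (kTset S1 S2 t1 t0 η κ) ≤ 1 := by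
    intro κ
    calc _ ≤ volume (Set.Icc (0 : ℝ) 1) := measure_mono fun t ht => h1 ht.1
      _ = 1 := by simp
  -- slices vanish outside the range
  have hT0 : ∀ κ, κ ∉ Set.Icc (-(8 / lam)) (8 / lam) → volume (kTset S1 S2 t1 t0 η κ) = 0 := by
    intro κ hκ
    have : kTset S1 S2 t1 t0 η κ = ∅ := by
      by_contra hne
      obtain ⟨t, ht⟩ := Set.nonempty_iff_ne_empty.mpr hne
      apply hκ
      rw [Set.mem_Icc, ← abs_le]
      obtain ⟨a1, a2, a3, a4, a5⟩ := ht
      have ht01 := h1 a1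
      have hs := h2 a4
      have b1 : |κ * ((t - t1) / (t - t0))| ≤ 1 := by
        rw [abs_le]; constructor <;> linarith [hs.1, hs.2, ht1.1, ht1.2]
      have b2 : |t - t0| ≤ 1 := by
        rw [abs_le]; constructor <;> linarith [ht01.1, ht01.2, ht0.1, ht0.2]
      have b3 : 0 < |t - t0| := lt_of_lt_of_le hη0 a3
      rw [abs_mul, abs_div, ← mul_div_assoc, div_le_one b3] at b1
      rw [le_div_iff₀ hl]
      have : |κ| * η ≤ |κ| * |t - t1| := by gcongr
      have : |κ| * η = |κ| * lam / 8 := by rw [hη]; ring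
      linarith
    rw [this, measure_empty]
  -- lower bound of the measure of R
  have hRlow : ENNReal.ofReal (lam ^ 3 / 32) ≤ ∫⁻ κ, volume (kTset S1 S2 t1 t0 η κ) := by
    have e1 : ∫⁻ κ, volume (kTset S1 S2 t1 t0 η κ) = (volume.prod volume) R :=
      (Measure.prod_apply hRm).symm
    rw [e1, Measure.prod_apply_symm hRm]
    set S1' : Set ℝ := {t | (t ∈ S1 ∧ η ≤ |t - t1|) ∧ η ≤ |t - t0|} with hS1'
    have hM : ∀ a : ℝ, MeasurableSet {t : ℝ | η ≤ |t - a|} := fun a =>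
      measurableSet_le measurable_const (by fun_prop)
    have hS1m : MeasurableSet S1' := (hS1.inter (hM t1)).inter (hM t0)
    have hS1v : ENNReal.ofReal (lam / 2) ≤ volume S1' := by
      have := vol_remove _ t0 η _ (vol_remove S1 t1 η lam hv1 hη0.le) hη0.le
      have e : lam - 2 * η - 2 * η = lam / 2 := by rw [hη]; ring
      rw [e] at this
      exact this
    calc ENNReal.ofReal (lam ^ 3 / 32)
        ≤ ENNReal.ofReal (lam * (3 * lam) / 32) * ENNReal.ofReal (lam / 2) := by
          rw [← ENNReal.ofReal_mul (by positivity)]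
          apply ENNReal.ofReal_le_ofReal
          nlinarith [pow_pos hl 3]
      _ ≤ ENNReal.ofReal (lam * (3 * lam) / 32) * volume S1' := by gcongr
      _ = ∫⁻ t in S1', ENNReal.ofReal (lam * (3 * lam) / 32) := by
          rw [setLIntegral_const]
      _ ≤ ∫⁻ t in S1', volume ((fun κ => (κ, t)) ⁻¹' R) := by
          apply setLIntegral_mono' hS1m
          intro t ht
          obtain ⟨⟨a1, a2⟩, a3⟩ := ht
          have ht01 := h1 a1
          have c1 : 0 < |t - t1| := lt_of_lt_of_le hη0 a2
          have c0 : 0 < |t - t0| := lt_of_lt_of_le hη0 a3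
          have c1' : t - t1 ≠ 0 := abs_pos.mp c1
          have c0' : t - t0 ≠ 0 := abs_pos.mp c0
          have hρ : (t - t1) / (t - t0) ≠ 0 := div_ne_zero c1' c0'
          have hset : (fun κ => (κ, t)) ⁻¹' R
              = {κ : ℝ | t1 + κ * ((t - t1) / (t - t0)) ∈ {s | s ∈ S2 ∧ η ≤ |s - t1|}} := by
            ext κ
            simp only [hR, kTset, Set.mem_preimage, Set.mem_ofPred_eq, a1, a2, a3, true_and,
              add_sub_cancel_left]
          rw [hset, vol_affine _ _ _ hρ]
          have hv := vol_remove S2 t1 η lam hv2 hη0.le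
          calc ENNReal.ofReal (lam * (3 * lam) / 32)
              ≤ ENNReal.ofReal |((t - t1) / (t - t0))⁻¹| * ENNReal.ofReal (lam - 2 * η) := by
                rw [← ENNReal.ofReal_mul (by positivity)]
                apply ENNReal.ofReal_le_ofReal
                have d1 : η ≤ |((t - t1) / (t - t0))⁻¹| := by
                  rw [inv_div, abs_div, le_div_iff₀ c1]
                  have : |t - t1| ≤ 1 := by
                    rw [abs_le]; constructor <;> linarith [ht01.1, ht01.2, ht1.1, ht1.2]
                  nlinarith
                have d2 : lam - 2 * η = 3 * lam / 4 := by rw [hη]; ring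
                rw [d2]
                calc lam * (3 * lam) / 32 = η * (3 * lam / 4) := by rw [hη]; ring
                  _ ≤ _ := by gcongr
            _ ≤ _ := by gcongr
      _ ≤ _ := setLIntegral_le_lintegral _ _
  -- upper bound
  have hRup : ∫⁻ κ, volume (kTset S1 S2 t1 t0 η κ) ≤ volume D + ENNReal.ofReal (lam ^ 3 / 64) := by
    have hpt : ∀ κ, volume (kTset S1 S2 t1 t0 η κ) ≤ D.indicator (fun _ => (1 : ℝ≥0∞)) κ
        + (Set.Icc (-(8 / lam)) (8 / lam)).indicator (fun _ => ENNReal.ofReal (lam ^ 4 / 1024)) κ := by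
      intro κ
      by_cases h : κ ∈ Set.Icc (-(8 / lam)) (8 / lam)
      · by_cases h' : κ ∈ D
        · rw [Set.indicator_of_mem h']
          exact (hT1 κ).trans le_self_add
        · rw [Set.indicator_of_mem h]
          have : ¬ ENNReal.ofReal (lam ^ 4 / 1024) ≤ volume (kTset S1 S2 t1 t0 η κ) :=
            fun h2 => h' ⟨h, h2⟩
          exact (not_le.mp this).le.trans le_add_self
      · rw [hT0 κ h]; exact bot_le
    calc _ ≤ _ := lintegral_mono hpt
      _ = _ := by
        rw [lintegral_add_left (measurable_const.indicator hDm), lintegral_indicator hDm,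
          lintegral_indicator measurableSet_Icc, setLIntegral_const, setLIntegral_const, one_mul,
          Real.volume_Icc, ← ENNReal.ofReal_mul (by positivity)]
        congr 2
        field_simp; ring
  have h3 := hRlow.trans hRup
  have h4 : ENNReal.ofReal (lam ^ 3 / 32) = ENNReal.ofReal (lam ^ 3 / 64) + ENNReal.ofReal (lam ^ 3 / 64) := by
    rw [← ENNReal.ofReal_add (by positivity) (by positivity)]; congr 1; ring
  rw [h4] at h3
  exact (ENNReal.add_le_add_iff_right ENNReal.ofReal_ne_top).mp h3

/-! ### Polynomial bounds -/

def PB (f : ℝ → ℝ) : Prop := ∃ K : ℕ, ∀ x, 1 ≤ x → 0 ≤ f x ∧ f x ≤ K * x ^ K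

theorem PB.const {c : ℝ} (hc : 0 ≤ c) : PB (fun _ => c) := by
  obtain ⟨K, hK⟩ := exists_nat_ge c
  refine ⟨K, fun x hx => ⟨hc, ?_⟩⟩
  have : 1 ≤ x ^ K := one_le_pow₀ hx
  calc c ≤ K * 1 := by simpa using hK
    _ ≤ _ := by gcongr

theorem PB.id : PB (fun x => x) := ⟨1, fun x hx => ⟨by linarith, by simp⟩⟩

theorem PB.mono_exp {f : ℝ → ℝ} {K K' : ℕ} (h : ∀ x, 1 ≤ x → 0 ≤ f x ∧ f x ≤ K * x ^ K) (hK : K ≤ K') :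
    ∀ x, 1 ≤ x → f x ≤ K' * x ^ K' := fun x hx => (h x hx).2.trans (by
      have h1 : x ^ K ≤ x ^ K' := pow_le_pow_right₀ hx hK
      have h2 : (K : ℝ) ≤ K' := by exact_mod_cast hK
      have : 0 ≤ x ^ K := by positivity
      gcongr)

theorem PB.mul {f g : ℝ → ℝ} (hf : PB f) (hg : PB g) : PB (fun x => f x * g x) := by
  obtain ⟨K, hK⟩ := hf
  obtain ⟨M, hM⟩ := hg
  have key : ∀ x, 1 ≤ x → 0 ≤ f x * g x ∧ f x * g x ≤ ((K * M + K + M : ℕ) : ℝ) * x ^ (K * M + K + M) := by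
    intro x hx
    obtain ⟨a1, a2⟩ := hK x hx
    obtain ⟨b1, b2⟩ := hM x hx
    refine ⟨mul_nonneg a1 b1, ?_⟩
    calc f x * g x ≤ (K * x ^ K) * (M * x ^ M) := mul_le_mul a2 b2 b1 (a1.trans a2)
      _ = (K * M : ℝ) * x ^ (K + M) := by rw [pow_add]; ring
      _ ≤ _ := by
        have : x ^ (K + M) ≤ x ^ (K * M + K + M) := pow_le_pow_right₀ hx (by lia)
        have h2 : (K * M : ℝ) ≤ ((K * M + K + M : ℕ) : ℝ) := by
          push_cast; have : (0:ℝ) ≤ K := by positivity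
          have : (0:ℝ) ≤ M := by positivity
          linarith
        have : 0 ≤ x ^ (K + M) := by positivity
        gcongr
  exact ⟨_, key⟩

theorem PB.add {f g : ℝ → ℝ} (hf : PB f) (hg : PB g) : PB (fun x => f x + g x) := by
  obtain ⟨K, hK⟩ := hf
  obtain ⟨M, hM⟩ := hg
  refine ⟨K + M, fun x hx => ?_⟩
  obtain ⟨a1, a2⟩ := hK x hx
  obtain ⟨b1, b2⟩ := hM x hx
  refine ⟨add_nonneg a1 b1, ?_⟩
  have h1 : x ^ K ≤ x ^ (K + M) := pow_le_pow_right₀ hx (by lia)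
  have h2 : x ^ M ≤ x ^ (K + M) := pow_le_pow_right₀ hx (by lia)
  calc f x + g x ≤ K * x ^ K + M * x ^ M := add_le_add a2 b2
    _ ≤ K * x ^ (K + M) + M * x ^ (K + M) := by gcongr
    _ = _ := by push_cast; ring

theorem PB.pow {f : ℝ → ℝ} (hf : PB f) (m : ℕ) : PB (fun x => f x ^ m) := by
  induction m with
  | zero => simpa using PB.const zero_le_one
  | succ k ih => simp only [pow_succ]; exact ih.mul hf

theorem PB.of_le {f g : ℝ → ℝ} (hg : PB g) (h : ∀ x, 1 ≤ x → 0 ≤ f x ∧ f x ≤ g x) : PB f := by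
  obtain ⟨M, hM⟩ := hg
  exact ⟨M, fun x hx => ⟨(h x hx).1, (h x hx).2.trans (hM x hx).2⟩⟩

theorem PB.nonneg {f : ℝ → ℝ} (hf : PB f) {x : ℝ} (hx : 1 ≤ x) : 0 ≤ f x := by
  obtain ⟨K, hK⟩ := hf
  exact (hK x hx).1

theorem PB.rpow {f : ℝ → ℝ} (hf : PB f) (c : ℝ) (hc : 0 ≤ c) : PB (fun x => f x ^ c) := by
  obtain ⟨m, hm⟩ := exists_nat_ge c
  refine ((hf.add (PB.const zero_le_one)).pow m).of_le fun x hx => ?_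
  have h0 := hf.nonneg hx
  refine ⟨by positivity, ?_⟩
  calc f x ^ c ≤ (f x + 1) ^ c := by gcongr; linarith
    _ ≤ (f x + 1) ^ (m : ℝ) := Real.rpow_le_rpow_of_exponent_le (by linarith) hm
    _ = _ := Real.rpow_natCast _ _

theorem PB.comp {f g : ℝ → ℝ} (hf : PB f) (hg : PB g) (h1 : ∀ x, 1 ≤ x → 1 ≤ g x) :
    PB (fun x => f (g x)) := by
  obtain ⟨K, hK⟩ := hf
  refine ((PB.const (Nat.cast_nonneg K)).mul (hg.pow K)).of_le fun x hx => ?_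
  exact hK (g x) (h1 x hx)

/-! ### Maximal estimates -/

def KPW (n : ℕ) (α β : ℝ) : Prop := ∃ F : ℝ → ℝ, PB F ∧
  ∀ (lam N Y : ℝ) (L : Finset (Ln n)) (S : Ln n → Set ℝ), 0 < lam → lam ≤ 1 → 0 ≤ N → 0 ≤ Y →
    (∀ l ∈ L, MeasurableSet (S l)) → (∀ l ∈ L, S l ⊆ Set.Icc 0 1) →
    (∀ l ∈ L, ENNReal.ofReal lam ≤ volume (S l)) →
    (∀ v, ((L.filter (fun l => l.2 = v)).card : ℝ) ≤ Y) →
    (∀ t ∈ Set.Icc (0 : ℝ) 1, (lNt L S t : ℝ) ≤ N) →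
    (L.card : ℝ) ≤ F lam⁻¹ * N ^ α * Y ^ β

def KTE (n : ℕ) (α β : ℝ) : Prop := ∃ F : ℝ → ℝ, PB F ∧
  ∀ (lam I Y : ℝ) (L : Finset (Ln n)) (S : Ln n → Set ℝ), 0 < lam → lam ≤ 1 → 0 ≤ I → 0 ≤ Y →
    (∀ l ∈ L, MeasurableSet (S l)) → (∀ l ∈ L, S l ⊆ Set.Icc 0 1) →
    (∀ l ∈ L, ENNReal.ofReal lam ≤ volume (S l)) →
    (∀ v, ((L.filter (fun l => l.2 = v)).card : ℝ) ≤ Y) →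
    (∫⁻ t in Set.Icc (0 : ℝ) 1, (lNt L S t : ℝ≥0∞) ≤ ENNReal.ofReal I) →
    (L.card : ℝ) ≤ F lam⁻¹ * I ^ α * Y ^ β

theorem lNt_mono {n : ℕ} (L : Finset (Ln n)) (S S' : Ln n → Set ℝ) (t : ℝ)
    (h : ∀ l ∈ L, t ∈ S l → t ∈ S' l) : lNt L S t ≤ lNt L S' t := by
  classical
  unfold lNt
  apply Finset.card_le_card
  apply Finset.image_subset_image
  intro l hl
  rw [Finset.mem_filter] at hl ⊢
  exact ⟨hl.1, h l hl.1 hl.2⟩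

theorem lNt_pos {n : ℕ} (L : Finset (Ln n)) (S : Ln n → Set ℝ) (t : ℝ) (l : Ln n) (hl : l ∈ L)
    (h : t ∈ S l) : 1 ≤ lNt L S t := by
  classical
  unfold lNt
  apply Finset.card_pos.mpr
  exact ⟨_, Finset.mem_image_of_mem _ (Finset.mem_filter.mpr ⟨hl, h⟩)⟩

theorem lNt_zero {n : ℕ} (L : Finset (Ln n)) (S : Ln n → Set ℝ) (t : ℝ)
    (h : ∀ l ∈ L, t ∉ S l) : lNt L S t = 0 := by
  classical
  unfold lNt
  rw [Finset.card_eq_zero, Finset.image_eq_empty, Finset.filter_eq_empty_iff]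
  exact fun l hl => h l hl

theorem KPW.toKTE {n : ℕ} {α β : ℝ} (hα : 0 ≤ α) (h : KPW n α β) : KTE n α β := by
  classical
  obtain ⟨F, hF, hL⟩ := h
  have h2 : PB (fun x => 2 * x) := (PB.const zero_le_two).mul PB.id
  refine ⟨fun x => F (2 * x) * (2 * x) ^ α,
    (hF.comp h2 (fun x hx => by linarith)).mul (h2.rpow α hα), ?_⟩
  intro lam I Y L S hl hl1 hI0 hY0 hSm hSs hSv hY hInt
  have hx1 : 1 ≤ lam⁻¹ := (one_le_inv₀ hl).mpr hl1
  rcases L.eq_empty_or_nonempty with rfl | ⟨l0, hl0⟩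
  · simp only [Finset.card_empty, Nat.cast_zero]
    have := hF.nonneg (x := 2 * lam⁻¹) (by linarith)
    positivity
  have hlI : lam ≤ I := by
    have : ENNReal.ofReal lam ≤ ENNReal.ofReal I := by
      refine (hSv l0 hl0).trans (le_trans ?_ hInt)
      calc volume (S l0) = ∫⁻ t in Set.Icc (0 : ℝ) 1, (S l0).indicator (fun _ => (1 : ℝ≥0∞)) t := by
            rw [lintegral_indicator (hSm l0 hl0), setLIntegral_one,
              Measure.restrict_apply (hSm l0 hl0), Set.inter_eq_left.mpr (hSs l0 hl0)]
        _ ≤ _ := by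
            apply lintegral_mono
            intro t
            by_cases ht : t ∈ S l0
            · rw [Set.indicator_of_mem ht]
              have := lNt_pos L S t l0 hl0 ht
              change (1 : ℝ≥0∞) ≤ (lNt L S t : ℝ≥0∞)
              exact_mod_cast this
            · rw [Set.indicator_of_notMem ht]; exact bot_le
    exact (ENNReal.ofReal_le_ofReal_iff hI0).mp this
  have hI : 0 < I := lt_of_lt_of_le hl hlI
  set N : ℝ := 2 * I / lam with hN
  have hN0 : 0 < N := by positivity
  have hmeas := lNt_measurable L S hSm
  set B : Set ℝ := {t | (lNt L S t : ℝ) ≤ N} with hB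
  have hBm : MeasurableSet B := by
    apply measurableSet_le _ measurable_const
    exact (measurable_from_top (f := fun k : ℕ => (k : ℝ))).comp hmeas
  have hmark : (volume.restrict (Set.Icc (0 : ℝ) 1)) Bᶜ ≤ ENNReal.ofReal (lam / 2) := by
    have hm2 : Measurable (fun t => (lNt L S t : ℝ≥0∞)) :=
      (measurable_from_top (f := fun k : ℕ => (k : ℝ≥0∞))).comp hmeas
    have := meas_ge_le_lintegral_div (μ := volume.restrict (Set.Icc (0 : ℝ) 1)) hm2.aemeasurable
      (ε := ENNReal.ofReal N) (by simpa using hN0) ENNReal.ofReal_ne_top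
    refine (measure_mono ?_).trans (this.trans ?_)
    · intro t ht
      have ht' : N < lNt L S t := not_le.mp ht
      change ENNReal.ofReal N ≤ _
      rw [← ENNReal.ofReal_natCast]
      exact ENNReal.ofReal_le_ofReal ht'.le
    · calc _ ≤ ENNReal.ofReal I / ENNReal.ofReal N := by gcongr
        _ = ENNReal.ofReal (lam / 2) := by
          rw [← ENNReal.ofReal_div_of_pos hN0]
          congr 1; rw [hN]; field_simp
  have key := hL (lam / 2) N Y L (fun l => S l ∩ B) (by positivity) (by linarith) hN0.le hY0
    (fun l hl => (hSm l hl).inter hBm) (fun l hl => Set.inter_subset_left.trans (hSs l hl)) ?_ hY ?_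
  · have e1 : (lam / 2)⁻¹ = 2 * lam⁻¹ := by field_simp
    have e2 : N = (2 * lam⁻¹) * I := by rw [hN]; field_simp
    rw [e1, e2, Real.mul_rpow (by positivity) hI0] at key
    calc _ ≤ _ := key
      _ = _ := by ring
  · intro l hl
    have h1 : volume (S l) ≤ volume (S l ∩ B) + ENNReal.ofReal (lam / 2) := by
      have : S l ⊆ (S l ∩ B) ∪ (Bᶜ ∩ Set.Icc 0 1) := by
        intro t ht
        by_cases hb : t ∈ B
        · exact Or.inl ⟨ht, hb⟩
        · exact Or.inr ⟨hb, hSs l hl ht⟩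
      refine (measure_mono this).trans ((measure_union_le _ _).trans ?_)
      gcongr
      rwa [Measure.restrict_apply hBm.compl] at hmark
    have h2 := (hSv l hl).trans h1
    have h4 : ENNReal.ofReal lam = ENNReal.ofReal (lam / 2) + ENNReal.ofReal (lam / 2) := by
      rw [← ENNReal.ofReal_add (by positivity) (by positivity)]; congr 1; ring
    rw [h4] at h2
    exact (ENNReal.add_le_add_iff_right ENNReal.ofReal_ne_top).mp h2
  · intro t _
    by_cases hb : t ∈ B
    · refine le_trans ?_ hb
      exact_mod_cast lNt_mono L (fun l => S l ∩ B) S t (fun l _ h => h.1)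
    · have : lNt L (fun l => S l ∩ B) t = 0 := by
        exact lNt_zero _ _ _ (fun l _ h => hb h.2)
      rw [this]; simpa using hN0.le

theorem fib_count {ι γ : Type*} [DecidableEq γ] (X : Finset ι) (g : ι → γ) (C : ℝ)
    (h : ∀ c ∈ X.image g, ((X.filter (fun x => g x = c)).card : ℝ) ≤ C) :
    (X.card : ℝ) ≤ C * (X.image g).card := by
  have h1 := Finset.card_eq_sum_card_image g X
  rw [h1]; push_cast
  calc _ ≤ ∑ c ∈ X.image g, C := Finset.sum_le_sum h
    _ = _ := by rw [Finset.sum_const, nsmul_eq_mul, mul_comm]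

theorem KPW.base (n : ℕ) : KPW n 2 0 := by
  classical
  have hx : PB (fun x => 8 * x) := (PB.const (by norm_num)).mul PB.id
  refine ⟨fun x => 2 * x ^ 2 * ((8 * x + 1) ^ n * (8 * x + 2) ^ n),
    ((PB.const (by norm_num)).mul (PB.id.pow 2)).mul
      (((hx.add (PB.const zero_le_one)).pow n).mul ((hx.add (PB.const zero_le_two)).pow n)), ?_⟩
  intro lam N Y L S hl hl1 hN0 hY0 hSm hSs hSv hY hN
  have hx1 : 1 ≤ lam⁻¹ := (one_le_inv₀ hl).mpr hl1
  rcases L.eq_empty_or_nonempty with rfl | hne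
  · simp only [Finset.card_empty, Nat.cast_zero]
    positivity
  obtain ⟨t, ht, h1⟩ := kt_pigeon L S 0 1 lam zero_le_one hl.le hSm hSs hSv hne hl
    (fun t l => t ∈ S l) (fun t l _ => Iff.rfl)
  set L1 := L.filter (fun l => t ∈ S l) with hL1
  have hne1 : L1.Nonempty := by
    rw [← Finset.card_pos]
    have : 0 < (L.card : ℝ) := by exact_mod_cast hne.card_pos
    have h2 : (0 : ℝ) < (1 - 0) * (L1.card : ℝ) := lt_of_lt_of_le (by positivity) h1
    simpa using h2
  have hM : ∀ a : ℝ, MeasurableSet {t : ℝ | lam / 4 ≤ |t - a|} := fun a =>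
      measurableSet_le measurable_const (by fun_prop)
  obtain ⟨t', ht', h2⟩ := kt_pigeon L1 (fun l => {s | s ∈ S l ∧ lam / 4 ≤ |s - t|}) 0 1 (lam / 2)
    zero_le_one (by positivity)
    (fun l hl => (hSm l (Finset.mem_filter.mp hl).1).inter (hM t))
    (fun l hl s hs => hSs l (Finset.mem_filter.mp hl).1 hs.1)
    (fun l hl => by
      have := vol_remove (S l) t (lam / 4) lam (hSv l (Finset.mem_filter.mp hl).1) (by positivity)
      have e : lam - 2 * (lam / 4) = lam / 2 := by ring
      rwa [e] at this) hne1 (by positivity)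
    (fun s l => s ∈ S l ∧ lam / 4 ≤ |s - t|) (fun t l _ => Iff.rfl)
  set L2 := L1.filter (fun l => t' ∈ S l ∧ lam / 4 ≤ |t' - t|) with hL2
  have h3 : (L2.card : ℝ) ≤ ((8 * lam⁻¹ + 1) ^ n * (8 * lam⁻¹ + 2) ^ n) *
      ((L2.image (fun l => (lcel l t, lcel l t'))).card : ℝ) := by
    apply fib_count
    intro c hc
    obtain ⟨l0, hl0, _⟩ := Finset.mem_image.mp hc
    have htt : lam / 4 ≤ |t - t'| := by
      rw [abs_sub_comm]; exact (Finset.mem_filter.mp hl0).2.2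
    have := two_cells (L2.filter (fun l => (lcel l t, lcel l t') = c)) t t' (lam / 4) (by positivity)
      ht.1 ht.2 htt ?_ ?_
    · have e : 2 / (lam / 4) = 8 * lam⁻¹ := by field_simp; norm_num
      rwa [e] at this
    · intro a ha b hb
      have e1 := (Finset.mem_filter.mp ha).2
      have e2 := (Finset.mem_filter.mp hb).2
      exact congrArg Prod.fst (e1.trans e2.symm)
    · intro a ha b hb
      have e1 := (Finset.mem_filter.mp ha).2
      have e2 := (Finset.mem_filter.mp hb).2
      exact congrArg Prod.snd (e1.trans e2.symm)
  have h4 : ((L2.image (fun l => (lcel l t, lcel l t'))).card : ℝ) ≤ N * N := by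
    have hs : L2.image (fun l => (lcel l t, lcel l t')) ⊆
        ((L.filter (fun l => t ∈ S l)).image (fun l => lcel l t)) ×ˢ
        ((L.filter (fun l => t' ∈ S l)).image (fun l => lcel l t')) := by
      intro c hc
      obtain ⟨l, hl, rfl⟩ := Finset.mem_image.mp hc
      obtain ⟨hl1, hl2⟩ := Finset.mem_filter.mp hl
      rw [Finset.mem_product]
      exact ⟨Finset.mem_image_of_mem _ hl1,
        Finset.mem_image_of_mem _ (Finset.mem_filter.mpr ⟨(Finset.mem_filter.mp hl1).1, hl2.1⟩)⟩
    have h5 := Finset.card_le_card hs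
    rw [Finset.card_product] at h5
    have h6 : ((L2.image (fun l => (lcel l t, lcel l t'))).card : ℝ) ≤ (lNt L S t : ℝ) * lNt L S t' := by
      refine le_trans (Nat.cast_le.mpr h5) ?_
      rw [Nat.cast_mul]
      unfold lNt
      apply le_of_eq
      congr!
    exact h6.trans (mul_le_mul (hN t ht) (hN t' ht') (by positivity) hN0)
  rw [Real.rpow_zero, mul_one, Real.rpow_two]
  set G := (8 * lam⁻¹ + 1) ^ n * (8 * lam⁻¹ + 2) ^ n with hG
  have hG0 : 0 ≤ G := by positivity
  have h5 : lam * (lam / 2 * L.card) ≤ G * (N * N) := by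
    calc lam * (lam / 2 * L.card) = lam / 2 * (lam * L.card) := by ring
      _ ≤ lam / 2 * L1.card := by
        have : lam * (L.card : ℝ) ≤ L1.card := by linarith
        gcongr
      _ ≤ L2.card := by linarith
      _ ≤ _ := h3
      _ ≤ _ := by gcongr
  calc (L.card : ℝ) = 2 * lam⁻¹ ^ 2 * (lam * (lam / 2 * L.card)) := by field_simp
    _ ≤ 2 * lam⁻¹ ^ 2 * (G * (N * N)) := by gcongr
    _ = _ := by ring

theorem pair_count {ι γ : Type*} [DecidableEq γ] (L : Finset ι) (g : ι → γ) (N : ℝ)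
    (hN : ((L.image g).card : ℝ) ≤ N) :
    (L.card : ℝ) ^ 2 ≤ N * ((L ×ˢ L).filter (fun x => g x.1 = g x.2)).card := by
  classical
  have h1 : (L.card : ℝ) = ∑ c ∈ L.image g, ((L.filter (fun x => g x = c)).card : ℝ) := by
    rw [Finset.card_eq_sum_card_image g L]; push_cast; rfl
  have h2 : (((L ×ˢ L).filter (fun x => g x.1 = g x.2)).card : ℝ)
      = ∑ c ∈ L.image g, ((L.filter (fun x => g x = c)).card : ℝ) ^ 2 := by
    rw [Finset.card_eq_sum_card_fiberwise (f := fun x => g x.1) (t := L.image g)]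
    · push_cast
      refine Finset.sum_congr rfl fun c _ => ?_
      have : ((L ×ˢ L).filter (fun x => g x.1 = g x.2)).filter (fun x => g x.1 = c)
          = (L.filter (fun x => g x = c)) ×ˢ (L.filter (fun x => g x = c)) := by
        ext x
        simp only [Finset.mem_filter, Finset.mem_product]
        constructor
        · rintro ⟨⟨⟨a, b⟩, c'⟩, d⟩; exact ⟨⟨a, d⟩, b, c'.symm.trans d⟩
        · rintro ⟨⟨a, b⟩, c', d⟩; exact ⟨⟨⟨a, c'⟩, b.trans d.symm⟩, b⟩
      rw [this, Finset.card_product]; push_cast; ring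
    · intro x hx
      have hx' := (Finset.mem_filter.mp (Finset.mem_coe.mp hx)).1
      exact Finset.mem_coe.mpr (Finset.mem_image_of_mem _ (Finset.mem_product.mp hx').1)
  rw [h1, h2]
  refine (sq_sum_le_card_mul_sum_sq).trans ?_
  gcongr

theorem st_arith (lam N a b c d e : ℝ) (hl : 0 < lam) (hN0 : 0 ≤ N) (ha : 0 < a)
    (h1 : lam * a ≤ b) (h2 : b ^ 2 ≤ N * c) (h3 : lam / 2 * c ≤ d) (h4 : lam ^ 4 / 1024 * d ≤ e) :
    lam ^ 7 / 2048 * a ^ 2 ≤ N * e := by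
  calc lam ^ 7 / 2048 * a ^ 2 = lam ^ 5 / 2048 * (lam * a) ^ 2 := by ring
      _ ≤ lam ^ 5 / 2048 * b ^ 2 := by gcongr
      _ ≤ lam ^ 5 / 2048 * (N * c) := by gcongr
      _ = N * (lam ^ 4 / 1024 * (lam / 2 * c)) := by ring
      _ ≤ N * (lam ^ 4 / 1024 * d) := by gcongr
      _ ≤ N * e := by gcongr

set_option maxHeartbeats 1000000 in
theorem st_core {n : ℕ} (lam N : ℝ) (L : Finset (Ln n)) (S : Ln n → Set ℝ) (hl : 0 < lam) (hl1 : lam ≤ 1)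
    (hN0 : 0 ≤ N) (hSm : ∀ l ∈ L, MeasurableSet (S l)) (hSs : ∀ l ∈ L, S l ⊆ Set.Icc 0 1)
    (hSv : ∀ l ∈ L, ENNReal.ofReal lam ≤ volume (S l))
    (hN : ∀ t ∈ Set.Icc (0 : ℝ) 1, (lNt L S t : ℝ) ≤ N) (hne : L.Nonempty) :
    ∃ (t1 t0 κ : ℝ) (X : Finset (Ln n × Ln n)), t1 ∈ Set.Icc (0 : ℝ) 1 ∧ t0 ∈ Set.Icc (0 : ℝ) 1 ∧
      lam / 8 ≤ |t0 - t1| ∧ (lam / 8) ^ 2 ≤ |κ| ∧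
      (∀ x ∈ X, x.1 ∈ L ∧ x.2 ∈ L ∧ lcel x.1 t1 = lcel x.2 t1 ∧ t0 ∈ S x.1 ∧
        ENNReal.ofReal (lam ^ 4 / 1024) ≤ volume (kTset (S x.1) (S x.2) t1 t0 (lam / 8) κ)) ∧
      lam ^ 7 / 2048 * (L.card : ℝ) ^ 2 ≤ N * X.card := by
  classical
  have hLpos : 0 < (L.card : ℝ) := by exact_mod_cast hne.card_pos
  obtain ⟨t1, ht1, h1⟩ := kt_pigeon L S 0 1 lam zero_le_one hl.le hSm hSs hSv hne hl
    (fun t l => t ∈ S l) (fun t l _ => Iff.rfl)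
  set L1 := L.filter (fun l => t1 ∈ S l) with hL1
  have h1' : lam * (L.card : ℝ) ≤ L1.card := by linarith
  have hL1pos : 0 < (L1.card : ℝ) := lt_of_lt_of_le (by positivity) h1'
  set X1 := (L1 ×ˢ L1).filter (fun x => lcel x.1 t1 = lcel x.2 t1) with hX1
  have h2 : (L1.card : ℝ) ^ 2 ≤ N * X1.card := by
    apply pair_count L1 (fun l => lcel l t1) N
    refine le_trans (le_of_eq ?_) (hN t1 ht1)
    unfold lNt
    rw [hL1]
  have hX1pos : 0 < (X1.card : ℝ) := by
    rcases Nat.eq_zero_or_pos X1.card with h | h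
    · rw [h, Nat.cast_zero, mul_zero] at h2
      have : 0 < (L1.card : ℝ) ^ 2 := by positivity
      linarith
    · exact_mod_cast h
  have hmem1 : ∀ x ∈ X1, x.1 ∈ L ∧ x.2 ∈ L ∧ lcel x.1 t1 = lcel x.2 t1 := by
    intro x hx
    obtain ⟨a, b⟩ := Finset.mem_filter.mp hx
    obtain ⟨a1, a2⟩ := Finset.mem_product.mp a
    exact ⟨(Finset.mem_filter.mp a1).1, (Finset.mem_filter.mp a2).1, b⟩
  have hM : ∀ a : ℝ, MeasurableSet {t : ℝ | lam / 8 ≤ |t - a|} := fun a =>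
      measurableSet_le measurable_const (by fun_prop)
  obtain ⟨t0, ht0, h3⟩ := kt_pigeon X1 (fun x => {s | s ∈ S x.1 ∧ lam / 8 ≤ |s - t1|}) 0 1 (lam / 2)
    zero_le_one (by positivity)
    (fun x hx => (hSm x.1 (hmem1 x hx).1).inter (hM t1))
    (fun x hx s hs => hSs x.1 (hmem1 x hx).1 hs.1)
    (fun x hx => by
      have := vol_remove (S x.1) t1 (lam / 8) lam (hSv x.1 (hmem1 x hx).1) (by positivity)
      refine le_trans (ENNReal.ofReal_le_ofReal ?_) this
      linarith) (Finset.card_pos.mp (by exact_mod_cast hX1pos)) (by positivity)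
    (fun s x => s ∈ S x.1 ∧ lam / 8 ≤ |s - t1|) (fun t l _ => Iff.rfl)
  set X2 := X1.filter (fun x => t0 ∈ S x.1 ∧ lam / 8 ≤ |t0 - t1|) with hX2
  have h3' : lam / 2 * (X1.card : ℝ) ≤ X2.card := by linarith
  have hX2pos : 0 < (X2.card : ℝ) := lt_of_lt_of_le (by positivity) h3'
  have hX2ne : X2.Nonempty := Finset.card_pos.mp (by exact_mod_cast hX2pos)
  have hmem2 : ∀ x ∈ X2, x.1 ∈ L ∧ x.2 ∈ L ∧ lcel x.1 t1 = lcel x.2 t1 ∧ t0 ∈ S x.1 := by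
    intro x hx
    obtain ⟨a, b⟩ := Finset.mem_filter.mp hx
    obtain ⟨a1, a2, a3⟩ := hmem1 x a
    exact ⟨a1, a2, a3, b.1⟩
  have hsep : lam / 8 ≤ |t0 - t1| := by
    obtain ⟨x, hx⟩ := hX2ne
    exact (Finset.mem_filter.mp hx).2.2
  have hsl : ∀ x ∈ X2, _ := fun x hx => kt_slice (S x.1) (S x.2) (hSm _ (hmem2 x hx).1)
    (hSm _ (hmem2 x hx).2.1) (hSs _ (hmem2 x hx).1) (hSs _ (hmem2 x hx).2.1) lam hl hl1
    (hSv _ (hmem2 x hx).1) (hSv _ (hmem2 x hx).2.1) t1 t0 ht1 ht0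
  obtain ⟨κ, hκ, h4⟩ := kt_pigeon X2 (fun x => {κ | κ ∈ Set.Icc (-(8 / lam)) (8 / lam) ∧
      ENNReal.ofReal (lam ^ 4 / 1024) ≤ volume (kTset (S x.1) (S x.2) t1 t0 (lam / 8) κ)})
      (-(8 / lam)) (8 / lam) (lam ^ 3 / 64) (by have : 0 < 8 / lam := by positivity
                                                linarith) (by positivity)
      (fun x hx => (hsl x hx).1) (fun x _ y hy => hy.1) (fun x hx => (hsl x hx).2) hX2ne
      (by positivity)
      (fun κ x => κ ∈ Set.Icc (-(8 / lam)) (8 / lam) ∧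
        ENNReal.ofReal (lam ^ 4 / 1024) ≤ volume (kTset (S x.1) (S x.2) t1 t0 (lam / 8) κ))
      (fun t l _ => Iff.rfl)
  set X3 := X2.filter (fun x => κ ∈ Set.Icc (-(8 / lam)) (8 / lam) ∧
        ENNReal.ofReal (lam ^ 4 / 1024) ≤ volume (kTset (S x.1) (S x.2) t1 t0 (lam / 8) κ)) with hX3
  have h4' : lam ^ 4 / 1024 * (X2.card : ℝ) ≤ X3.card := by
    have e : 8 / lam - -(8 / lam) = 16 / lam := by ring
    rw [e] at h4
    calc lam ^ 4 / 1024 * (X2.card : ℝ) = lam / 16 * (lam ^ 3 / 64 * X2.card) := by ring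
      _ ≤ lam / 16 * (16 / lam * X3.card) := by gcongr
      _ = _ := by field_simp
  have hX3pos : 0 < (X3.card : ℝ) := lt_of_lt_of_le (by positivity) h4'
  refine ⟨t1, t0, κ, X3, ht1, ht0, hsep, ?_, ?_, ?_⟩
  · obtain ⟨x, hx⟩ : X3.Nonempty := Finset.card_pos.mp (by exact_mod_cast hX3pos)
    obtain ⟨a, _, c⟩ := Finset.mem_filter.mp hx
    have hpos : 0 < volume (kTset (S x.1) (S x.2) t1 t0 (lam / 8) κ) :=
      lt_of_lt_of_le (by rw [ENNReal.ofReal_pos]; positivity) c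
    obtain ⟨t, ht⟩ := nonempty_of_measure_ne_zero hpos.ne'
    obtain ⟨a1, a2, a3, a4, a5⟩ := ht
    have ht01 := hSs x.1 (hmem2 x a).1 a1
    have b3 : 0 < |t - t0| := lt_of_lt_of_le (by positivity) a3
    rw [abs_mul, abs_div, ← mul_div_assoc, le_div_iff₀ b3] at a5
    have b2 : |t - t1| ≤ 1 := by
      rw [abs_le]; constructor <;> linarith [ht01.1, ht01.2, ht1.1, ht1.2]
    calc (lam / 8) ^ 2 = lam / 8 * (lam / 8) := by ring
      _ ≤ lam / 8 * |t - t0| := by gcongr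
      _ ≤ |κ| * |t - t1| := a5
      _ ≤ |κ| * 1 := by gcongr
      _ = _ := mul_one _
  · intro x hx
    obtain ⟨a, _, c⟩ := Finset.mem_filter.mp hx
    obtain ⟨a1, a2, a3, a4⟩ := hmem2 x a
    exact ⟨a1, a2, a3, a4, c⟩
  · exact st_arith lam N _ _ _ _ _ hl hN0 hLpos h1' h2 h3' h4'

theorem count_C1 {n : ℕ} (X : Finset (Ln n × Ln n)) (L : Finset (Ln n)) (S : Ln n → Set ℝ)
    (t1 t0 κ η ζ N Y : ℝ) (hη : 0 < η) (hζ : 0 < ζ) (hκ : ζ ≤ |κ|) (hY0 : 0 ≤ Y)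
    (ht1 : t1 ∈ Set.Icc (0 : ℝ) 1) (hsep : η ≤ |t0 - t1|) 
    (ht0 : t0 ∈ Set.Icc (0 : ℝ) 1)
    (hN : (lNt L S t0 : ℝ) ≤ N)
    (hY : ∀ v, ((L.filter (fun l => l.2 = v)).card : ℝ) ≤ Y)
    (hX : ∀ x ∈ X, x.1 ∈ L ∧ x.2 ∈ L ∧ lcel x.1 t1 = lcel x.2 t1 ∧ t0 ∈ S x.1)
    (hw : ∀ x ∈ X, ∀ x' ∈ X, lom t0 κ x = lom t0 κ x') :
    (X.card : ℝ) ≤ ((2 / ζ + 1) ^ n * ((2 / η + 1) ^ n * (2 / η + 2) ^ n)) * N * Y := by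
  classical
  set G2 : ℝ := (2 / η + 1) ^ n * (2 / η + 2) ^ n with hG2
  have hG20 : 0 ≤ G2 := by positivity
  have hz : 0 ≤ 2 / ζ := by positivity
  have h1 : (X.card : ℝ) ≤ ((2 / ζ + 1) ^ n * G2 * Y) * (X.image (fun x => lcel x.1 t0)).card := by
    apply fib_count
    intro c _
    set Xc := X.filter (fun x => lcel x.1 t0 = c) with hXc
    have hXcX : ∀ x ∈ Xc, x ∈ X := fun x hx => (Finset.mem_filter.mp hx).1
    have hXcc : ∀ x ∈ Xc, lcel x.1 t0 = c := fun x hx => (Finset.mem_filter.mp hx).2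
    have h2 : (Xc.card : ℝ) ≤ G2 * (Xc.image Prod.snd).card := by
      apply fib_count
      intro l2 _
      have hinj : ((Xc.filter (fun x => x.2 = l2)).image Prod.fst).card
          = (Xc.filter (fun x => x.2 = l2)).card := by
        apply Finset.card_image_of_injOn
        intro x hx x' hx' h
        have e1 := (Finset.mem_filter.mp (Finset.mem_coe.mp hx)).2
        have e2 := (Finset.mem_filter.mp (Finset.mem_coe.mp hx')).2
        exact Prod.ext h (e1.trans e2.symm)
      rw [← hinj]
      apply two_cells _ t0 t1 η hη ht0.1 ht0.2 hsep
      · intro a ha b hb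
        obtain ⟨x, hx, rfl⟩ := Finset.mem_image.mp ha
        obtain ⟨x', hx', rfl⟩ := Finset.mem_image.mp hb
        rw [hXcc x (Finset.mem_filter.mp hx).1, hXcc x' (Finset.mem_filter.mp hx').1]
      · intro a ha b hb
        obtain ⟨x, hx, rfl⟩ := Finset.mem_image.mp ha
        obtain ⟨x', hx', rfl⟩ := Finset.mem_image.mp hb
        rw [(hX x (hXcX x (Finset.mem_filter.mp hx).1)).2.2.1,
          (hX x' (hXcX x' (Finset.mem_filter.mp hx').1)).2.2.1,
          (Finset.mem_filter.mp hx).2, (Finset.mem_filter.mp hx').2]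
    have h3 : ((Xc.image Prod.snd).card : ℝ) ≤ Y * ((Xc.image Prod.snd).image Prod.snd).card := by
      apply fib_count
      intro v _
      refine le_trans (Nat.cast_le.mpr (Finset.card_le_card ?_)) (hY v)
      intro l hl
      obtain ⟨a, b⟩ := Finset.mem_filter.mp hl
      obtain ⟨x, hx, rfl⟩ := Finset.mem_image.mp a
      exact Finset.mem_filter.mpr ⟨(hX x (hXcX x hx)).2.1, b⟩
    have h4 : (((Xc.image Prod.snd).image Prod.snd).card : ℝ) ≤ (2 / ζ + 1) ^ n := by
      apply kt_count_const _ _ hz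
      intro a ha b hb i
      obtain ⟨a', ha', rfl⟩ := Finset.mem_image.mp ha
      obtain ⟨b', hb', rfl⟩ := Finset.mem_image.mp hb
      obtain ⟨x, hx, rfl⟩ := Finset.mem_image.mp ha'
      obtain ⟨x', hx', rfl⟩ := Finset.mem_image.mp hb'
      have e1 := lom_diff (hw x (hXcX x hx) x' (hXcX x' hx')) i
      have e2 := lcel_diff ((hXcc x hx).trans (hXcc x' hx').symm) i
      have e3 : κ * ((x.2.2 i : ℝ) - x'.2.2 i) = ((lpos x.1 t0 i + κ * x.2.2 i)
        - (lpos x'.1 t0 i + κ * x'.2.2 i)) - (lpos x.1 t0 i - lpos x'.1 t0 i) := by ring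
      have e4 : |κ| * |(x.2.2 i : ℝ) - x'.2.2 i| ≤ 2 := by
        rw [← abs_mul, e3]
        refine (abs_sub _ _).trans ?_
        linarith
      refine (le_abs_self _).trans ?_
      rw [le_div_iff₀ hζ]
      have := mul_le_mul_of_nonneg_right hκ (abs_nonneg ((x.2.2 i : ℝ) - x'.2.2 i))
      linarith
    calc (Xc.card : ℝ) ≤ G2 * (Xc.image Prod.snd).card := h2
      _ ≤ G2 * (Y * (2 / ζ + 1) ^ n) := by
        gcongr
        exact h3.trans (by gcongr)
      _ = _ := by ring
  have h5 : ((X.image (fun x => lcel x.1 t0)).card : ℝ) ≤ N := by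
    refine le_trans (Nat.cast_le.mpr ?_) hN
    unfold lNt
    apply Finset.card_le_card
    intro c hc
    obtain ⟨x, hx, rfl⟩ := Finset.mem_image.mp hc
    obtain ⟨a1, a2, a3, a4⟩ := hX x hx
    exact Finset.mem_image_of_mem (fun l => lcel l t0) (Finset.mem_filter.mpr ⟨a1, a4⟩)
  calc (X.card : ℝ) ≤ _ := h1
    _ ≤ ((2 / ζ + 1) ^ n * G2 * Y) * N := by gcongr
    _ = _ := by ring

theorem sum_C3 {n : ℕ} (X : Finset (Ln n × Ln n)) (L : Finset (Ln n)) (S : Ln n → Set ℝ)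
    (t1 t0 κ η N : ℝ) (hη : 0 < η) (hη1 : η ≤ 1) (hN0 : 0 ≤ N)
    (ht1 : t1 ∈ Set.Icc (0 : ℝ) 1) (ht0 : t0 ∈ Set.Icc (0 : ℝ) 1)
    (hSs : ∀ l ∈ L, S l ⊆ Set.Icc 0 1)
    (hN : ∀ t ∈ Set.Icc (0 : ℝ) 1, (lNt L S t : ℝ) ≤ N)
    (hX : ∀ x ∈ X, x.1 ∈ L ∧ x.2 ∈ L ∧ lcel x.1 t1 = lcel x.2 t1)
    (Ω : Finset (Fin n → ℤ)) (Lω : (Fin n → ℤ) → Finset (Ln n))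
    (f : (Fin n → ℤ) → Ln n → Ln n × Ln n)
    (hf : ∀ ω ∈ Ω, ∀ l ∈ Lω ω, f ω l ∈ X ∧ lom t0 κ (f ω l) = ω ∧ (f ω l).1 = l) (t : ℝ)
    (ht : t ∈ Set.Icc (0 : ℝ) 1) :
    (∑ ω ∈ Ω, (lNt (Lω ω) (fun l => kTset (S l) (S (f ω l).2) t1 t0 η κ) t : ℝ))
      ≤ (8 / η + 1) ^ n * N ^ 2 := by
  classical
  set s : ℝ := t1 + κ * ((t - t1) / (t - t0)) with hs
  set Xt := X.filter (fun x => t ∈ kTset (S x.1) (S x.2) t1 t0 η κ) with hXt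
  set Z := Xt.image (fun x => (lom t0 κ x, lcel x.1 t)) with hZ
  set W := Xt.image (fun x => (lcel x.1 t, lcel x.2 s)) with hW
  have h1 : ∑ ω ∈ Ω, lNt (Lω ω) (fun l => kTset (S l) (S (f ω l).2) t1 t0 η κ) t ≤ Z.card := by
    calc _ ≤ ∑ ω ∈ Ω, (Z.filter (fun z => z.1 = ω)).card := by
          refine Finset.sum_le_sum fun ω hω => ?_
          unfold lNt
          rw [← Finset.card_image_of_injective _ (Prod.mk_right_injective ω)]
          apply Finset.card_le_card
          intro z hz
          obtain ⟨c, hc, rfl⟩ := Finset.mem_image.mp hz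
          obtain ⟨l, hl, rfl⟩ := Finset.mem_image.mp hc
          obtain ⟨hl1, hl2⟩ := Finset.mem_filter.mp hl
          obtain ⟨b1, b2, b3⟩ := hf ω hω l hl1
          refine Finset.mem_filter.mpr ⟨Finset.mem_image.mpr ⟨f ω l, ?_, ?_⟩, rfl⟩
          · refine Finset.mem_filter.mpr ⟨b1, ?_⟩
            rw [b3]; exact hl2
          · rw [b2, b3]
      _ ≤ Z.card := by
          rw [Finset.sum_card_fiberwise_eq_card_filter]
          exact Finset.card_filter_le _ _
  have h2 : (Z.card : ℝ) ≤ W.card * (8 / η + 1) ^ n := by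
    have hsub : Z ⊆ W.biUnion (fun c => (Xt.filter (fun x => (lcel x.1 t, lcel x.2 s) = c)).image
        (fun x => (lom t0 κ x, lcel x.1 t))) := by
      intro z hz
      obtain ⟨x, hx, rfl⟩ := Finset.mem_image.mp hz
      refine Finset.mem_biUnion.mpr ⟨(lcel x.1 t, lcel x.2 s), Finset.mem_image_of_mem _ hx, ?_⟩
      exact Finset.mem_image_of_mem _ (Finset.mem_filter.mpr ⟨hx, rfl⟩)
    have h3 := (Finset.card_le_card hsub).trans Finset.card_biUnion_le
    have h4 : (Z.card : ℝ) ≤ ∑ c ∈ W, (((Xt.filter (fun x => (lcel x.1 t, lcel x.2 s) = c)).image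
        (fun x => (lom t0 κ x, lcel x.1 t))).card : ℝ) := by exact_mod_cast h3
    refine h4.trans ?_
    rw [← nsmul_eq_mul, ← Finset.sum_const]
    refine Finset.sum_le_sum fun c hc => ?_
    obtain ⟨x0, hx0, _⟩ := Finset.mem_image.mp hc
    have hT := (Finset.mem_filter.mp hx0).2
    refine le_trans ?_ (count_C3 (Xt.filter (fun x => (lcel x.1 t, lcel x.2 s) = c)) t1 t0 κ η t s hη hη1
      ht1 ht0 hT.2.1 hT.2.2.1 (by rw [hs, mul_div_assoc]) ?_ ?_ ?_)
    · apply Nat.cast_le.mpr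
      have hsub2 : (Xt.filter (fun x => (lcel x.1 t, lcel x.2 s) = c)).image
          (fun x => (lom t0 κ x, lcel x.1 t)) ⊆
          ((Xt.filter (fun x => (lcel x.1 t, lcel x.2 s) = c)).image (lom t0 κ)).image (fun w => (w, c.1)) := by
        intro z hz
        obtain ⟨x, hx, rfl⟩ := Finset.mem_image.mp hz
        refine Finset.mem_image.mpr ⟨_, Finset.mem_image_of_mem _ hx, ?_⟩
        rw [← (Finset.mem_filter.mp hx).2]
      refine (Finset.card_le_card hsub2).trans (Finset.card_image_le.trans (le_of_eq ?_))
      congr!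
    · intro x hx
      exact (hX x (Finset.mem_filter.mp (Finset.mem_filter.mp hx).1).1).2.2
    · intro x hx x' hx'
      exact congrArg Prod.fst ((Finset.mem_filter.mp hx).2.trans (Finset.mem_filter.mp hx').2.symm)
    · intro x hx x' hx'
      exact congrArg Prod.snd ((Finset.mem_filter.mp hx).2.trans (Finset.mem_filter.mp hx').2.symm)
  have h5 : (W.card : ℝ) ≤ N * N := by
    rcases Xt.eq_empty_or_nonempty with h | ⟨x0, hx0⟩
    · rw [hW, h]; simp; positivity
    obtain ⟨c1, c2⟩ := Finset.mem_filter.mp hx0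
    have hs01 : s ∈ Set.Icc (0 : ℝ) 1 := hSs _ (hX x0 c1).2.1 c2.2.2.2.1
    have hsub : W ⊆ ((L.filter (fun l => t ∈ S l)).image (fun l => lcel l t)) ×ˢ
        ((L.filter (fun l => s ∈ S l)).image (fun l => lcel l s)) := by
      intro c hc
      obtain ⟨x, hx, rfl⟩ := Finset.mem_image.mp hc
      obtain ⟨d1, d2⟩ := Finset.mem_filter.mp hx
      rw [Finset.mem_product]
      exact ⟨Finset.mem_image_of_mem (fun l => lcel l t) (Finset.mem_filter.mpr ⟨(hX x d1).1, d2.1⟩),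
        Finset.mem_image_of_mem (fun l => lcel l s) (Finset.mem_filter.mpr ⟨(hX x d1).2.1, d2.2.2.2.1⟩)⟩
    have h5 := Finset.card_le_card hsub
    rw [Finset.card_product] at h5
    have h6 : (W.card : ℝ) ≤ (lNt L S t : ℝ) * lNt L S s := by
      refine le_trans (Nat.cast_le.mpr h5) ?_
      rw [Nat.cast_mul]
      unfold lNt
      apply le_of_eq
      congr!
    exact h6.trans (mul_le_mul (hN t ht) (hN s hs01) (by positivity) hN0)
  calc _ ≤ (Z.card : ℝ) := by exact_mod_cast h1
    _ ≤ _ := h2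
    _ ≤ (N * N) * (8 / η + 1) ^ n := by gcongr
    _ = _ := by ring

theorem interp {a P Q I α : ℝ} (hα : 1 ≤ α) (ha : 0 ≤ a) (hP : a ≤ P) (hI : 0 ≤ I) (hQ0 : 0 ≤ Q)
    (hQ : a ≤ Q * I ^ α) : a ≤ P ^ (1 - 1 / α) * Q ^ (1 / α) * I := by
  have hα0 : 0 < α := by linarith
  have h1 : 0 ≤ 1 - 1 / α := by
    rw [sub_nonneg, div_le_one hα0]; exact hα
  rcases eq_or_lt_of_le ha with h | h
  · rw [← h]
    have : 0 ≤ P := ha.trans hP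
    positivity
  have hP0 : 0 ≤ P := ha.trans hP
  calc a = a ^ (1 - 1 / α) * a ^ (1 / α) := by
        rw [← Real.rpow_add h]; norm_num
    _ ≤ P ^ (1 - 1 / α) * (Q * I ^ α) ^ (1 / α) := by gcongr
    _ = _ := by
      rw [Real.mul_rpow hQ0 (by positivity), ← Real.rpow_mul hI]
      have : α * (1 / α) = 1 := by field_simp
      rw [this, Real.rpow_one]; ring

theorem step_arith {α β N Y Z C0 B2 Q : ℝ} (hα : 1 ≤ α) (hN : 0 < N) (hY : 0 < Y)
    (hZ : 0 ≤ Z) (hC : 0 ≤ C0) (hB2 : 0 ≤ B2) (hQ : 0 ≤ Q)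
    (h : Z ^ 2 ≤ C0 * N ^ 3 * ((B2 * N * Y) ^ (1 - 1 / α) * (Q * Y ^ β) ^ (1 / α))) :
    Z ≤ (C0 * B2 ^ (1 - 1 / α) * Q ^ (1 / α)) ^ (1 / 2 : ℝ) * N ^ (2 - 1 / (2 * α)) *
      Y ^ ((α - 1 + β) / (2 * α)) := by
  have hα0 : 0 < α := by linarith
  have e : C0 * N ^ 3 * ((B2 * N * Y) ^ (1 - 1 / α) * (Q * Y ^ β) ^ (1 / α))
      = (C0 * B2 ^ (1 - 1 / α) * Q ^ (1 / α)) * N ^ (4 - 1 / α) * Y ^ ((α - 1 + β) / α) := by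
    rw [Real.mul_rpow (by positivity) hY.le, Real.mul_rpow hB2 hN.le, Real.mul_rpow hQ (by positivity),
      ← Real.rpow_mul hY.le]
    have e1 : N ^ (4 - 1 / α) = N ^ 3 * N ^ (1 - 1 / α) := by
      rw [← Real.rpow_natCast N 3, ← Real.rpow_add hN]; congr 1; push_cast; ring
    have e2 : Y ^ ((α - 1 + β) / α) = Y ^ (1 - 1 / α) * Y ^ (β * (1 / α)) := by
      rw [← Real.rpow_add hY]; congr 1; field_simp
    rw [e1, e2]; ring
  rw [e] at h
  set C := C0 * B2 ^ (1 - 1 / α) * Q ^ (1 / α) with hCdef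
  have hC' : 0 ≤ C := by positivity
  have h2 : (Z ^ 2) ^ (1 / 2 : ℝ) ≤ (C * N ^ (4 - 1 / α) * Y ^ ((α - 1 + β) / α)) ^ (1 / 2 : ℝ) := by
    gcongr
  rw [← Real.rpow_natCast Z 2, ← Real.rpow_mul hZ] at h2
  rw [Real.mul_rpow (by positivity) (by positivity), Real.mul_rpow hC' (by positivity),
    ← Real.rpow_mul hN.le, ← Real.rpow_mul hY.le] at h2
  have e3 : ((2 : ℕ) : ℝ) * (1 / 2) = 1 := by norm_num
  have e4 : (4 - 1 / α) * (1 / 2) = 2 - 1 / (2 * α) := by field_simp; ring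
  have e5 : (α - 1 + β) / α * (1 / 2) = (α - 1 + β) / (2 * α) := by field_simp
  rw [e3, e4, e5, Real.rpow_one] at h2
  exact h2

theorem KPW.step {n : ℕ} {α β : ℝ} (hα : 1 ≤ α) (h : KTE n α β) :
    KPW n (2 - 1 / (2 * α)) ((α - 1 + β) / (2 * α)) := by
  classical
  obtain ⟨F, hF, hK⟩ := h
  have hα0 : 0 < α := by linarith
  have hα1 : 0 ≤ 1 - 1 / α := by
    rw [sub_nonneg, div_le_one hα0]; exact hα
  have pb1 : ∀ a b : ℝ, 0 ≤ a → 0 ≤ b → PB (fun x => (a * x + b) ^ n) := fun a b ha hb =>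
    (((PB.const ha).mul PB.id).add (PB.const hb)).pow n
  have pb2 : ∀ a b : ℝ, 0 ≤ a → 0 ≤ b → PB (fun x => (a * x ^ 2 + b) ^ n) := fun a b ha hb =>
    (((PB.const ha).mul (PB.id.pow 2)).add (PB.const hb)).pow n
  set B1 : ℝ → ℝ := fun x => (64 * x ^ 2 + 1) ^ n * (64 * x ^ 2 + 2) ^ n with hB1
  set B2 : ℝ → ℝ := fun x => (128 * x ^ 2 + 1) ^ n * ((16 * x + 1) ^ n * (16 * x + 2) ^ n) with hB2
  set B3 : ℝ → ℝ := fun x => (64 * x + 1) ^ n with hB3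
  set G : ℝ → ℝ := fun x => F (1024 * x ^ 4) with hG
  have pB1 : PB B1 := (pb2 _ _ (by norm_num) (by norm_num)).mul (pb2 _ _ (by norm_num) (by norm_num))
  have pB2 : PB B2 := (pb2 _ _ (by norm_num) (by norm_num)).mul
    ((pb1 _ _ (by norm_num) (by norm_num)).mul (pb1 _ _ (by norm_num) (by norm_num)))
  have pB3 : PB B3 := pb1 _ _ (by norm_num) (by norm_num)
  have pG : PB G := hF.comp ((PB.const (by norm_num)).mul (PB.id.pow 4)) (fun x hx => by
    have : 1 ≤ x ^ 4 := one_le_pow₀ hx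
    linarith)
  have pC0 : PB (fun x => 2048 * x ^ 7 * B3 x) :=
    ((PB.const (by norm_num)).mul (PB.id.pow 7)).mul pB3
  refine ⟨fun x => ((2048 * x ^ 7 * B3 x) * B2 x ^ (1 - 1 / α) * (B1 x * G x) ^ (1 / α)) ^ (1 / 2 : ℝ),
    ((pC0.mul (pB2.rpow _ hα1)).mul ((pB1.mul pG).rpow _ (by positivity))).rpow _ (by norm_num), ?_⟩
  intro lam N Y L S hl hl1 hN0 hY0 hSm hSs hSv hY hN
  have hx1 : 1 ≤ lam⁻¹ := (one_le_inv₀ hl).mpr hl1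
  set x := lam⁻¹ with hx
  have hx0 : 0 < x := by positivity
  have hlx : lam = x⁻¹ := by rw [hx, inv_inv]
  clear_value x
  have nB1 := pB1.nonneg hx1
  have nB2 := pB2.nonneg hx1
  have nB3 := pB3.nonneg hx1
  have nG := pG.nonneg hx1
  have nC0 := pC0.nonneg hx1
  rcases L.eq_empty_or_nonempty with rfl | hne
  · simp only [Finset.card_empty, Nat.cast_zero]
    positivity
  have hYpos : 0 < Y := by
    obtain ⟨l, hl⟩ := hne
    refine lt_of_lt_of_le ?_ (hY l.2)
    rw [Nat.cast_pos, Finset.card_pos]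
    exact ⟨l, Finset.mem_filter.mpr ⟨hl, rfl⟩⟩
  have hNpos : 0 < N := by
    obtain ⟨l, hlL⟩ := hne
    have hpos : 0 < volume (S l) := lt_of_lt_of_le (ENNReal.ofReal_pos.mpr hl) (hSv l hlL)
    obtain ⟨t, ht⟩ := nonempty_of_measure_ne_zero hpos.ne'
    refine lt_of_lt_of_le ?_ (hN t (hSs l hlL ht))
    exact_mod_cast lNt_pos L S t l hlL ht
  obtain ⟨t1, t0, κ, X, ht1, ht0, hsep, hκ, hX, hcard⟩ :=
    st_core lam N L S hl hl1 hN0 hSm hSs hSv hN hne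
  have hη : 0 < lam / 8 := by positivity
  set Ω := X.image (lom t0 κ) with hΩ
  set Xω : (Fin n → ℤ) → Finset (Ln n × Ln n) := fun ω => X.filter (fun x => lom t0 κ x = ω) with hXω
  set Lω : (Fin n → ℤ) → Finset (Ln n) := fun ω => (Xω ω).image Prod.fst with hLω
  have hex : ∀ ω l, ∃ y : Ln n × Ln n, l ∈ Lω ω → y ∈ X ∧ lom t0 κ y = ω ∧ y.1 = l := by
    intro ω l
    by_cases hl : l ∈ Lω ω
    · obtain ⟨y, hy, hy2⟩ := Finset.mem_image.mp hl
      exact ⟨y, fun _ => ⟨(Finset.mem_filter.mp hy).1, (Finset.mem_filter.mp hy).2, hy2⟩⟩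
    · exact ⟨default, fun h => absurd h hl⟩
  choose f hf using hex
  set T : (Fin n → ℤ) → Ln n → Set ℝ := fun ω l => kTset (S l) (S (f ω l).2) t1 t0 (lam / 8) κ with hT
  have hLL : ∀ ω, Lω ω ⊆ L := by
    intro ω l hl
    obtain ⟨y1, _, y3⟩ := hf ω l hl
    rw [← y3]; exact (hX _ y1).1
  have hTm : ∀ ω, ∀ l ∈ Lω ω, MeasurableSet (T ω l) := by
    intro ω l hl
    obtain ⟨y1, _, y3⟩ := hf ω l hl
    exact kTset_meas _ _ (hSm l (hLL ω hl)) (hSm _ (hX _ y1).2.1) _ _ _ _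
  set J : (Fin n → ℤ) → ℝ≥0∞ := fun ω => ∫⁻ t in Set.Icc (0 : ℝ) 1, (lNt (Lω ω) (T ω) t : ℝ≥0∞) with hJ
  have hJsum : ∑ ω ∈ Ω, J ω ≤ ENNReal.ofReal (B3 x * N ^ 2) := by
    have hmeas : ∀ ω, Measurable (fun t => (lNt (Lω ω) (T ω) t : ℝ≥0∞)) := fun ω =>
      (measurable_from_top (f := fun k : ℕ => (k : ℝ≥0∞))).comp (lNt_measurable _ _ (hTm ω))
    rw [hJ, ← lintegral_finsetSum _ (fun ω _ => hmeas ω)]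
    calc _ ≤ ∫⁻ t in Set.Icc (0 : ℝ) 1, ENNReal.ofReal (B3 x * N ^ 2) := by
          apply setLIntegral_mono' measurableSet_Icc
          intro t ht
          have := sum_C3 X L S t1 t0 κ (lam / 8) N hη (by linarith) hN0 ht1 ht0 hSs hN
            (fun y hy => ⟨(hX y hy).1, (hX y hy).2.1, (hX y hy).2.2.1⟩) Ω Lω f
            (fun ω _ l hl => hf ω l hl) t ht
          have e : (8 / (lam / 8) + 1) ^ n = B3 x := by
            rw [hB3, hlx]; simp only; congr 2; field_simp; norm_num
          rw [e] at this
          have h2 := ENNReal.ofReal_le_ofReal this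
          refine le_trans (le_of_eq ?_) h2
          rw [ENNReal.ofReal_sum_of_nonneg (fun _ _ => Nat.cast_nonneg _)]
          simp only [ENNReal.ofReal_natCast]
          rfl
      _ = _ := by rw [setLIntegral_const]; simp
  have hJfin : ∀ ω ∈ Ω, J ω ≠ ∞ := fun ω hω => ne_top_of_le_ne_top ENNReal.ofReal_ne_top
    ((Finset.single_le_sum (f := J) (fun _ _ => bot_le) hω).trans hJsum)
  have hIsum : ∑ ω ∈ Ω, (J ω).toReal ≤ B3 x * N ^ 2 := by
    rw [← ENNReal.toReal_sum hJfin]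
    exact ENNReal.toReal_le_of_le_ofReal (mul_nonneg nB3 (pow_nonneg hN0 2)) hJsum
  have hXw : ∀ ω ∈ Ω, ((Xω ω).card : ℝ) ≤
      (B2 x * N * Y) ^ (1 - 1 / α) * (B1 x * G x * Y ^ β) ^ (1 / α) * (J ω).toReal := by
    intro ω hω
    have hin : ∀ y ∈ Xω ω, y ∈ X ∧ lom t0 κ y = ω := fun y hy =>
      ⟨(Finset.mem_filter.mp hy).1, (Finset.mem_filter.mp hy).2⟩
    apply interp hα (Nat.cast_nonneg _) _ ENNReal.toReal_nonneg
      (mul_nonneg (mul_nonneg nB1 nG) (Real.rpow_nonneg hY0 _))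
    · -- C2
      have c2 : ((Xω ω).card : ℝ) ≤ B1 x * ((Xω ω).image Prod.fst).card := by
        apply fib_count
        intro l _
        have := count_C2 ((Xω ω).filter (fun y => y.1 = l)) t1 t0 κ ((lam / 8) ^ 2) (by positivity) hκ
          ht1.1 ht1.2 (fun y hy => (hX y (hin y (Finset.mem_filter.mp hy).1).1).2.2.1)
          (fun y hy y' hy' => (hin y (Finset.mem_filter.mp hy).1).2.trans
            (hin y' (Finset.mem_filter.mp hy').1).2.symm)
          (fun y hy y' hy' => (Finset.mem_filter.mp hy).2.trans (Finset.mem_filter.mp hy').2.symm)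
        have e : 1 / (lam / 8) ^ 2 = 64 * x ^ 2 := by rw [hlx]; field_simp; norm_num
        rw [e] at this
        exact this
      have kt := hK (lam ^ 4 / 1024) (J ω).toReal Y (Lω ω) (T ω) (by positivity)
        (by have : lam ^ 4 ≤ 1 := pow_le_one₀ hl.le hl1
            linarith) ENNReal.toReal_nonneg hY0 (hTm ω)
        (fun l hl t ht => hSs l (hLL ω hl) ht.1)
        (fun l hl => by
          obtain ⟨y1, _, y3⟩ := hf ω l hl
          have := (hX _ y1).2.2.2.2
          rw [y3] at this
          exact this)
        (fun v => le_trans (Nat.cast_le.mpr (Finset.card_le_card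
          (Finset.filter_subset_filter _ (hLL ω)))) (hY v))
        (by rw [ENNReal.ofReal_toReal (hJfin ω hω)])
      have e : (lam ^ 4 / 1024)⁻¹ = 1024 * x ^ 4 := by rw [hlx]; field_simp
      rw [e] at kt
      calc ((Xω ω).card : ℝ) ≤ _ := c2
        _ ≤ B1 x * (G x * (J ω).toReal ^ α * Y ^ β) := by gcongr
        _ = _ := by ring
    · have := count_C1 (Xω ω) L S t1 t0 κ (lam / 8) ((lam / 8) ^ 2) N Y hη (by positivity) hκ hY0 ht1 hsep
        ht0 (hN t0 ht0) hY (fun y hy => by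
          obtain ⟨a1, a2, a3, a4, _⟩ := hX y (hin y hy).1
          exact ⟨a1, a2, a3, a4⟩)
        (fun y hy y' hy' => (hin y hy).2.trans (hin y' hy').2.symm)
      have e : 2 / (lam / 8) ^ 2 = 128 * x ^ 2 := by rw [hlx]; field_simp; norm_num
      have e2 : 2 / (lam / 8) = 16 * x := by rw [hlx]; field_simp; norm_num
      rw [e, e2] at this
      exact this
  have hXc : (X.card : ℝ) ≤
      (B2 x * N * Y) ^ (1 - 1 / α) * (B1 x * G x * Y ^ β) ^ (1 / α) * (B3 x * N ^ 2) := by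
    have h1 := Finset.card_eq_sum_card_image (lom t0 κ) X
    have h2 : (X.card : ℝ) = ∑ ω ∈ Ω, ((Xω ω).card : ℝ) := by
      rw [h1]; push_cast; rfl
    rw [h2]
    refine (Finset.sum_le_sum hXw).trans ?_
    rw [← Finset.mul_sum]
    have q1 : 0 ≤ B1 x * G x * Y ^ β :=
      mul_nonneg (mul_nonneg nB1 nG) (Real.rpow_nonneg hY0 _)
    have q2 : 0 ≤ B2 x * N * Y := mul_nonneg (mul_nonneg nB2 hN0) hY0
    exact mul_le_mul_of_nonneg_left hIsum
      (mul_nonneg (Real.rpow_nonneg q2 _) (Real.rpow_nonneg q1 _))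
  apply step_arith hα hNpos hYpos (Nat.cast_nonneg _) nC0 nB2 (mul_nonneg nB1 nG)
  set E := (B2 x * N * Y) ^ (1 - 1 / α) * (B1 x * G x * Y ^ β) ^ (1 / α) with hE
  have hcc : (2048 * x ^ 7) * (lam ^ 7 / 2048) = 1 := by rw [hlx]; field_simp
  have hc0 : 0 ≤ 2048 * x ^ 7 := by positivity
  calc (L.card : ℝ) ^ 2 = (2048 * x ^ 7) * (lam ^ 7 / 2048) * (L.card : ℝ) ^ 2 := by
        rw [hcc, one_mul]
    _ = 2048 * x ^ 7 * (lam ^ 7 / 2048 * (L.card : ℝ) ^ 2) := mul_assoc _ _ _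
    _ ≤ 2048 * x ^ 7 * (N * X.card) := mul_le_mul_of_nonneg_left hcard hc0
    _ ≤ 2048 * x ^ 7 * (N * (E * (B3 x * N ^ 2))) :=
        mul_le_mul_of_nonneg_left (mul_le_mul_of_nonneg_left hXc hN0) hc0
    _ = _ := by ring

theorem KTE_iter (n m : ℕ) : ∃ α β : ℝ, 1 ≤ α ∧ 0 ≤ β ∧ KPW n α β ∧
    |α - (1 + Real.sqrt 2 / 2)| + |β - (1 - Real.sqrt 2 / 2)| ≤ 2 * (3 / 4) ^ m := by
  set a := Real.sqrt 2 / 2 with ha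
  have h2 : Real.sqrt 2 * Real.sqrt 2 = 2 := Real.mul_self_sqrt (by norm_num)
  have ha2 : a * a = 1 / 2 := by rw [ha]; linarith
  have ha0 : 0 ≤ a := by positivity
  have ha1 : 7 / 10 ≤ a := by nlinarith
  have ha3 : a ≤ 71 / 100 := by nlinarith
  induction m with
  | zero =>
    refine ⟨2, 0, by norm_num, le_rfl, KPW.base n, ?_⟩
    have e1 : |2 - (1 + a)| = 1 - a := by rw [abs_of_nonneg] <;> linarith
    have e2 : |0 - (1 - a)| = 1 - a := by rw [abs_of_nonpos] <;> linarith
    rw [e1, e2]; norm_num; linarith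
  | succ m ih =>
    obtain ⟨α, β, h1, h0, hK, he⟩ := ih
    have hα0 : 0 < α := by linarith
    refine ⟨2 - 1 / (2 * α), (α - 1 + β) / (2 * α), ?_, ?_, KPW.step h1 (hK.toKTE (by linarith)), ?_⟩
    · have : 1 / (2 * α) ≤ 1 := by rw [div_le_one (by positivity)]; linarith
      linarith
    · apply div_nonneg <;> linarith
    have hp : 0 < 2 * α * (1 + a) := by positivity
    have hp' : 17 / 5 ≤ 2 * α * (1 + a) := by nlinarith
    have e1 : 2 - 1 / (2 * α) - (1 + a) = (α - (1 + a)) / (2 * α * (1 + a)) := by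
      field_simp; nlinarith
    have e2 : (α - 1 + β) / (2 * α) - (1 - a)
        = (a * (α - (1 + a)) + (1 + a) * (β - (1 - a))) / (2 * α * (1 + a)) := by
      field_simp; nlinarith
    have e3 : |2 - 1 / (2 * α) - (1 + a)| ≤ 3 / 10 * |α - (1 + a)| := by
      rw [e1, abs_div, abs_of_pos hp, div_le_iff₀ hp]
      nlinarith [abs_nonneg (α - (1 + a))]
    have e4 : |(α - 1 + β) / (2 * α) - (1 - a)| ≤ 3 / 10 * |α - (1 + a)| + 1 / 2 * |β - (1 - a)| := by
      rw [e2, abs_div, abs_of_pos hp, div_le_iff₀ hp]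
      refine (abs_add_le _ _).trans ?_
      rw [abs_mul, abs_mul, abs_of_nonneg ha0, abs_of_pos (by linarith : 0 < 1 + a)]
      have q1 : a * |α - (1 + a)| ≤ 3 / 10 * |α - (1 + a)| * (2 * α * (1 + a)) := by
        nlinarith [abs_nonneg (α - (1 + a))]
      have q2 : (1 + a) * |β - (1 - a)| ≤ 1 / 2 * |β - (1 - a)| * (2 * α * (1 + a)) := by
        have : 0 ≤ (1 + a) * |β - (1 - a)| := by positivity
        nlinarith
      linarith
    rw [pow_succ]
    have := abs_nonneg (α - (1 + a))
    have := abs_nonneg (β - (1 - a))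
    linarith

theorem KTE_lim (n : ℕ) (ε : ℝ) (hε : 0 < ε) : ∃ α β : ℝ, 1 ≤ α ∧ 0 ≤ β ∧ KTE n α β ∧
    |α - (1 + Real.sqrt 2 / 2)| ≤ ε ∧ |β - (1 - Real.sqrt 2 / 2)| ≤ ε := by
  obtain ⟨m, hm⟩ := exists_pow_lt_of_lt_one (show 0 < ε / 2 by positivity) (show (3 / 4 : ℝ) < 1 by norm_num)
  obtain ⟨α, β, h1, h0, hK, he⟩ := KTE_iter n m
  refine ⟨α, β, h1, h0, hK.toKTE (by linarith), ?_, ?_⟩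
  · have := abs_nonneg (β - (1 - Real.sqrt 2 / 2)); linarith
  · have := abs_nonneg (α - (1 + Real.sqrt 2 / 2)); linarith

/-! ### Dyadic content -/

def cub {n : ℕ} (p : ℕ × (Fin n → ℤ)) : Set (Fin n → ℝ) := {x | ∀ i, ⌊(2 : ℝ) ^ p.1 * x i⌋ = p.2 i}

def ccost {n : ℕ} (s : ℝ) (p : ℕ × (Fin n → ℤ)) : ℝ≥0∞ := ENNReal.ofReal ((2 : ℝ) ^ (-(p.1 : ℝ) * s))

def cont {n : ℕ} (s : ℝ) : OuterMeasure (Fin n → ℝ) where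
  measureOf A := ⨅ (P : Set (ℕ × (Fin n → ℤ))) (_ : A ⊆ ⋃ p ∈ P, cub p), ∑' p : P, ccost s p.1
  empty := by
    apply le_antisymm _ bot_le
    refine (iInf₂_le ∅ (by simp)).trans ?_
    simp
  mono := by
    intro A B h
    refine le_iInf₂ fun P hP => ?_
    exact iInf₂_le P (h.trans hP)
  iUnion_nat := by
    intro A _
    apply ENNReal.le_of_forall_pos_le_add
    intro ε hε hfin
    obtain ⟨ε', hε'0, hε'⟩ := ENNReal.exists_pos_sum_of_countable (ENNReal.coe_ne_zero.mpr hε.ne') ℕ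
    have hi : ∀ i, ∃ P : Set (ℕ × (Fin n → ℤ)), A i ⊆ (⋃ p ∈ P, cub p) ∧ ∑' p : P, ccost s p.1 ≤
        (⨅ (P : Set (ℕ × (Fin n → ℤ))) (_ : A i ⊆ ⋃ p ∈ P, cub p), ∑' p : P, ccost s p.1) + ε' i := by
      intro i
      have hne : (⨅ (P : Set (ℕ × (Fin n → ℤ))) (_ : A i ⊆ ⋃ p ∈ P, cub p), ∑' p : P, ccost s p.1) ≠ ∞ :=
        ne_top_of_le_ne_top hfin.ne (ENNReal.le_tsum i)
      have := ENNReal.lt_add_right hne (ENNReal.coe_ne_zero.mpr (hε'0 i).ne')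
      simp only [iInf_lt_iff] at this
      obtain ⟨P, hP, h⟩ := this
      exact ⟨P, hP, h.le⟩
    choose P hP hPs using hi
    refine (iInf₂_le (⋃ i, P i) ?_).trans ?_
    · intro x hx
      obtain ⟨i, hi⟩ := Set.mem_iUnion.mp hx
      obtain ⟨p, hp, hxp⟩ := Set.mem_iUnion₂.mp (hP i hi)
      exact Set.mem_iUnion₂.mpr ⟨p, Set.mem_iUnion.mpr ⟨i, hp⟩, hxp⟩
    · calc _ ≤ ∑' i, ∑' p : P i, ccost s p.1 := ENNReal.tsum_iUnion_le_tsum (ccost s) P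
        _ ≤ _ := ENNReal.tsum_le_tsum hPs
        _ = _ := ENNReal.tsum_add
        _ ≤ _ := by gcongr

theorem cont_apply {n : ℕ} (s : ℝ) (A : Set (Fin n → ℝ)) : cont s A =
    ⨅ (P : Set (ℕ × (Fin n → ℤ))) (_ : A ⊆ ⋃ p ∈ P, cub p), ∑' p : P, ccost s p.1 := rfl

theorem cont_exists {n : ℕ} {s : ℝ} {A : Set (Fin n → ℝ)} {ε : ℝ≥0∞} (h : cont s A < ε) :
    ∃ P : Set (ℕ × (Fin n → ℤ)), A ⊆ (⋃ p ∈ P, cub p) ∧ ∑' p : P, ccost s p.1 < ε := by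
  rw [cont_apply] at h
  simp only [iInf_lt_iff] at h
  obtain ⟨P, hP, h⟩ := h
  exact ⟨P, hP, h⟩

theorem cont_cub {n : ℕ} (s : ℝ) (p : ℕ × (Fin n → ℤ)) : cont s (cub p) ≤ ccost s p := by
  rw [cont_apply]
  refine (iInf₂_le {p} (by simp)).trans ?_
  simp

theorem cub_meas {n : ℕ} (p : ℕ × (Fin n → ℤ)) : MeasurableSet (cub p) := by
  have : cub p = ⋂ i, (fun x : Fin n → ℝ => ⌊(2 : ℝ) ^ p.1 * x i⌋) ⁻¹' {p.2 i} := by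
    ext x; simp [cub]
  rw [this]
  refine MeasurableSet.iInter fun i => ?_
  have : Measurable (fun x : Fin n → ℝ => ⌊(2 : ℝ) ^ p.1 * x i⌋) :=
    Int.measurable_floor.comp (by fun_prop)
  exact this (measurableSet_singleton _)

theorem cont_nonneg_exp {n : ℕ} {s : ℝ} (hs : s ≤ 0) {A : Set (Fin n → ℝ)} (hA : A.Nonempty) :
    cont s A ≠ 0 := by
  intro h
  obtain ⟨P, hP, hs'⟩ := cont_exists (h.trans_lt (zero_lt_one' ℝ≥0∞))
  obtain ⟨x, hx⟩ := hA
  obtain ⟨p, hp, _⟩ := Set.mem_iUnion₂.mp (hP hx)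
  have h1 := ENNReal.le_tsum (f := fun p : P => ccost s p.1) ⟨p, hp⟩
  have h2 : 1 ≤ ccost s p := by
    unfold ccost
    rw [ENNReal.one_le_ofReal]
    apply Real.one_le_rpow (by norm_num)
    have : (0 : ℝ) ≤ p.1 := Nat.cast_nonneg _
    nlinarith
  exact absurd (h2.trans h1) (not_le.mpr hs')

/-- the cell of a point -/
def cell {n : ℕ} (j : ℕ) (x : Fin n → ℝ) : Fin n → ℤ := fun i => ⌊(2 : ℝ) ^ j * x i⌋

theorem mem_cub_cell {n : ℕ} (j : ℕ) (x : Fin n → ℝ) : x ∈ cub (j, cell j x) := fun _ => rfl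

theorem mem_cub_iff {n : ℕ} (j : ℕ) (c : Fin n → ℤ) (x : Fin n → ℝ) : x ∈ cub (j, c) ↔ cell j x = c :=
  ⟨fun h => funext h, fun h i => congrFun h i⟩

/-- covering by finitely many cells of the same level -/
theorem cont_le_cells {n : ℕ} (s : ℝ) (A : Set (Fin n → ℝ)) (j : ℕ) (X : Finset (Fin n → ℤ))
    (h : ∀ x ∈ A, cell j x ∈ X) : cont s A ≤ X.card * ENNReal.ofReal ((2 : ℝ) ^ (-(j : ℝ) * s)) := by
  have hsub : A ⊆ ⋃ c ∈ X, cub (j, c) := fun x hx =>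
    Set.mem_iUnion₂.mpr ⟨cell j x, h x hx, mem_cub_cell j x⟩
  calc cont s A ≤ cont s (⋃ c ∈ X, cub (j, c)) := (cont s).mono hsub
    _ ≤ ∑ c ∈ X, cont s (cub (j, c)) := measure_biUnion_finset_le _ _
    _ ≤ ∑ c ∈ X, ENNReal.ofReal ((2 : ℝ) ^ (-(j : ℝ) * s)) :=
        Finset.sum_le_sum fun c _ => cont_cub s (j, c)
    _ = _ := by rw [Finset.sum_const, nsmul_eq_mul]

/-- neighbouring cells -/
def nbr {n : ℕ} (c : Fin n → ℤ) : Finset (Fin n → ℤ) :=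
  Fintype.piFinset (fun i => Finset.Icc (c i - 1) (c i + 1))

theorem nbr_card {n : ℕ} (c : Fin n → ℤ) : (nbr c).card = 3 ^ n := by
  unfold nbr
  rw [Fintype.card_piFinset]
  have : ∀ i, (Finset.Icc (c i - 1) (c i + 1)).card = 3 := by
    intro i; rw [Int.card_Icc]; ring_nf; rfl
  simp [this]

theorem floor_near {a b : ℝ} (h : |a - b| ≤ 1) : ⌊a⌋ - 1 ≤ ⌊b⌋ ∧ ⌊b⌋ ≤ ⌊a⌋ + 1 := by
  rw [abs_le] at h
  constructor
  · rw [Int.le_floor]; push_cast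
    linarith [Int.floor_le a]
  · have : ⌊b⌋ < ⌊a⌋ + 2 := by
      rw [Int.floor_lt]; push_cast
      linarith [Int.lt_floor_add_one a]
    lia

theorem mem_nbr {n : ℕ} (c c' : Fin n → ℤ) : c' ∈ nbr c ↔ ∀ i, c i - 1 ≤ c' i ∧ c' i ≤ c i + 1 := by
  unfold nbr; simp [Fintype.mem_piFinset]

theorem cell_nbr {n : ℕ} (j : ℕ) (x y : Fin n → ℝ) (h : ∀ i, |x i - y i| ≤ ((2 : ℝ) ^ j)⁻¹) :
    cell j y ∈ nbr (cell j x) := by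
  rw [mem_nbr]
  intro i
  apply floor_near
  rw [← mul_sub, abs_mul, abs_of_pos (by positivity)]
  calc (2 : ℝ) ^ j * |x i - y i| ≤ 2 ^ j * ((2 : ℝ) ^ j)⁻¹ := by gcongr; exact h i
    _ = 1 := by field_simp

theorem cont_le_diam {n : ℕ} {s : ℝ} (hs : 0 < s) (t : Set (Fin n → ℝ)) (hne : t.Nonempty)
    (hd : Metric.ediam t ≤ 1) :
    cont s t ≤ ENNReal.ofReal (3 ^ n * 2 ^ s) * Metric.ediam t ^ s := by
  obtain ⟨x0, hx0⟩ := hne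
  have hdfin : Metric.ediam t ≠ ∞ := ne_top_of_le_ne_top one_ne_top hd
  set ρ := (Metric.ediam t).toReal with hρ
  have hρe : Metric.ediam t = ENNReal.ofReal ρ := (ENNReal.ofReal_toReal hdfin).symm
  have hρ1 : ρ ≤ 1 := ENNReal.toReal_le_of_le_ofReal zero_le_one (by simpa using hd)
  have hρ0 : 0 ≤ ρ := ENNReal.toReal_nonneg
  have hdist : ∀ y ∈ t, ∀ i, |x0 i - y i| ≤ ρ := by
    intro y hy i
    have h1 : edist x0 y ≤ Metric.ediam t := Metric.edist_le_ediam_of_mem hx0 hy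
    rw [hρe, edist_dist] at h1
    have h2 := (ENNReal.ofReal_le_ofReal_iff hρ0).mp h1
    exact (dist_le_pi_dist x0 y i).trans h2
  have key : ∀ j : ℕ, ρ ≤ ((2 : ℝ) ^ j)⁻¹ → cont s t ≤ ENNReal.ofReal (3 ^ n * (2 : ℝ) ^ (-(j : ℝ) * s)) := by
    intro j hj
    have := cont_le_cells s t j (nbr (cell j x0)) (fun y hy =>
      cell_nbr j x0 y (fun i => (hdist y hy i).trans hj))
    rw [nbr_card] at this
    refine this.trans (le_of_eq ?_)
    rw [ENNReal.ofReal_mul (by positivity), ENNReal.ofReal_pow (by norm_num)]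
    simp
  rcases eq_or_lt_of_le hρ0 with h0 | h0
  · have hz : cont s t = 0 := by
      have hlim : Filter.Tendsto (fun j : ℕ => ENNReal.ofReal (3 ^ n * (2 : ℝ) ^ (-(j : ℝ) * s)))
          Filter.atTop (nhds 0) := by
        rw [← ENNReal.ofReal_zero]
        apply ENNReal.tendsto_ofReal
        have : Filter.Tendsto (fun j : ℕ => ((2 : ℝ) ^ (-s)) ^ j) Filter.atTop (nhds 0) :=
          tendsto_pow_atTop_nhds_zero_of_lt_one (by positivity)
            (Real.rpow_lt_one_of_one_lt_of_neg (by norm_num) (by linarith))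
        have h2 := this.const_mul ((3 : ℝ) ^ n)
        rw [mul_zero] at h2
        refine h2.congr fun j => ?_
        rw [← Real.rpow_natCast ((2 : ℝ) ^ (-s)) j, ← Real.rpow_mul (by norm_num)]
        congr 2; ring
      apply le_antisymm _ bot_le
      exact ge_of_tendsto' hlim fun j => key j (by rw [← h0]; positivity)
    rw [hz]; exact bot_le
  · obtain ⟨j, hj1, hj2⟩ := exists_nat_pow_near_of_lt_one h0 hρ1 (show (0 : ℝ) < 1 / 2 by norm_num) (by norm_num)
    refine (key j (by rwa [one_div, inv_pow] at hj2)).trans ?_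
    rw [hρe, ENNReal.ofReal_rpow_of_pos h0, ← ENNReal.ofReal_mul (by positivity)]
    apply ENNReal.ofReal_le_ofReal
    rw [mul_assoc]
    gcongr
    rw [← Real.mul_rpow (by norm_num) hρ0, Real.rpow_mul (by norm_num)]
    gcongr
    rw [Real.rpow_neg (by norm_num), Real.rpow_natCast]
    rw [pow_succ, one_div, inv_pow] at hj1
    linarith

theorem cont_zero_of_hausdorff {n : ℕ} {s : ℝ} (hs : 0 < s) (A : Set (Fin n → ℝ))
    (h : Measure.hausdorffMeasure s A = 0) : cont s A = 0 := by
  rw [Measure.hausdorffMeasure_apply] at h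
  have h1 := le_antisymm_iff.mp h |>.1
  simp only [iSup_le_iff] at h1
  have h2 := h1 1 one_pos
  apply le_antisymm _ bot_le
  apply ENNReal.le_of_forall_pos_le_add
  intro ε hε _
  rw [bot_eq_zero, zero_add]
  set C := ENNReal.ofReal (3 ^ n * 2 ^ s) with hC
  have hCpos : C ≠ 0 := by rw [hC]; simp; positivity
  have hlt : (⨅ (t : ℕ → Set (Fin n → ℝ)) (_ : A ⊆ ⋃ n, t n) (_ : ∀ n, Metric.ediam (t n) ≤ 1),
      ∑' n, ⨆ _ : (t n).Nonempty, Metric.ediam (t n) ^ s) < (ε : ℝ≥0∞) / C := by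
    refine lt_of_le_of_lt h2 ?_
    apply ENNReal.div_pos (ENNReal.coe_ne_zero.mpr hε.ne') ENNReal.ofReal_ne_top
  simp only [iInf_lt_iff] at hlt
  obtain ⟨t, ht, hd, hsum⟩ := hlt
  calc cont s A ≤ cont s (⋃ n, t n) := (cont s).mono ht
    _ ≤ ∑' i, cont s (t i) := measure_iUnion_le _
    _ ≤ ∑' i, C * ⨆ _ : (t i).Nonempty, Metric.ediam (t i) ^ s := by
      apply ENNReal.tsum_le_tsum
      intro i
      rcases (t i).eq_empty_or_nonempty with he | hne
      · rw [he, measure_empty]; exact bot_le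
      · rw [ciSup_pos hne]
        exact cont_le_diam hs (t i) hne (hd i)
    _ = C * ∑' i, ⨆ _ : (t i).Nonempty, Metric.ediam (t i) ^ s := ENNReal.tsum_mul_left
    _ ≤ C * (ε / C) := by gcongr
    _ = ε := ENNReal.mul_div_cancel hCpos ENNReal.ofReal_ne_top

theorem cont_zero_of_volume {n : ℕ} (hn : 0 < n) (A : Set (Fin n → ℝ))
    (h : volume A = 0) : cont (n : ℝ) A = 0 := by
  apply cont_zero_of_hausdorff (by exact_mod_cast hn)
  have := @hausdorffMeasure_pi_real (Fin n) _
  rw [Fintype.card_fin] at this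
  rw [this]; exact h

/-! ### Pigeonholing over a cover -/

def Yf {n : ℕ} (A : Set (Fin (n + 1) → ℝ)) (v : Fin n → ℝ) : Set (Fin n → ℝ) :=
  {y | ∀ t ∈ Set.Icc (0 : ℝ) 1, (Fin.cons t (y + t • v) : Fin (n + 1) → ℝ) ∈ A}

theorem om_pigeon {X : Type*} (μ : OuterMeasure X) (S : Set X) (T : ℕ → Set X) (hS : S ⊆ ⋃ j, T j)
    (w : ℕ → ℝ) (hw : ∑' j, ENNReal.ofReal (w j) < 1) (c : ℝ) (hc : 0 < c)
    (h : ENNReal.ofReal c ≤ μ S) : ∃ j, ENNReal.ofReal (c * w j) ≤ μ (T j) := by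
  by_contra! hcon
  have h1 : ENNReal.ofReal c ≤ ENNReal.ofReal c * ∑' j, ENNReal.ofReal (w j) :=
    calc ENNReal.ofReal c ≤ μ S := h
      _ ≤ μ (⋃ j, T j) := μ.mono hS
      _ ≤ ∑' j, μ (T j) := measure_iUnion_le _
      _ ≤ ∑' j, ENNReal.ofReal c * ENNReal.ofReal (w j) := by
        refine ENNReal.tsum_le_tsum fun j => (hcon j).le.trans (le_of_eq ?_)
        rw [ENNReal.ofReal_mul hc.le]
      _ = _ := ENNReal.tsum_mul_left
  have hc0 : ENNReal.ofReal c ≠ 0 := by simpa using hc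
  have h2 : ENNReal.ofReal c * ∑' j, ENNReal.ofReal (w j) < ENNReal.ofReal c * 1 :=
    ENNReal.mul_lt_mul_right hc0 ENNReal.ofReal_ne_top hw
  rw [mul_one] at h2
  exact absurd h1 (not_le.mpr h2)

theorem exists_small {a : ℝ≥0∞} (h : a ≠ 0) : ∃ c : ℝ, 0 < c ∧ ENNReal.ofReal c ≤ a := by
  obtain ⟨r, hr0, hr⟩ := ENNReal.lt_iff_exists_nnreal_btwn.mp (pos_iff_ne_zero.mpr h)
  refine ⟨r, by exact_mod_cast hr0, ?_⟩
  rw [ENNReal.ofReal_coe_nnreal]; exact hr.le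

theorem PG {n : ℕ} (A : Set (Fin (n + 1) → ℝ)) (σ : ℝ) (hf : ∀ v, cont σ (Yf A v) ≠ 0) :
    ∃ (b : Fin n → ℤ) (c : ℝ), 0 < c ∧ c ≤ 1 ∧ ∀ (E : ℕ → Set (Fin (n + 1) → ℝ)) (w : ℕ → ℝ),
      A ⊆ ⋃ j, E j → ∑' j, ENNReal.ofReal (w j) < 1 →
      ∃ j, ∃ Θ : Set (Fin n → ℝ), Θ ⊆ {v | ∀ i, v i ∈ Set.Ico (0 : ℝ) 1} ∧
        ENNReal.ofReal (c * w j) ≤ volume Θ ∧ ∀ v ∈ Θ, ∃ Y' ⊆ cub (0, b),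
          ENNReal.ofReal (c * w j) ≤ cont σ Y' ∧ ∀ y ∈ Y', ENNReal.ofReal (w j) ≤
            volume {t : ℝ | t ∈ Set.Icc (0 : ℝ) 1 ∧ (Fin.cons t (y + t • v) : Fin (n + 1) → ℝ) ∈ E j} := by
  set U : Set (Fin n → ℝ) := {v | ∀ i, v i ∈ Set.Ico (0 : ℝ) 1} with hU
  have hUv : volume U = 1 := by
    have : U = Set.univ.pi (fun _ : Fin n => Set.Ico (0 : ℝ) 1) := by ext; simp [hU]
    rw [this, Real.volume_pi_Ico]; simp
  let Th : (Fin n → ℤ) × ℕ → Set (Fin n → ℝ) := fun q =>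
    {v | v ∈ U ∧ ((q.2 : ℝ≥0∞))⁻¹ ≤ cont σ (Yf A v ∩ cub (0, q.1))}
  have hcov : U ⊆ ⋃ q, Th q := by
    intro v hv
    have h1 : ∃ b : Fin n → ℤ, cont σ (Yf A v ∩ cub (0, b)) ≠ 0 := by
      by_contra! hcon
      apply hf v
      have : Yf A v ⊆ ⋃ b, Yf A v ∩ cub (0, b) := fun y hy =>
        Set.mem_iUnion.mpr ⟨cell 0 y, hy, mem_cub_cell 0 y⟩
      exact measure_mono_null this (measure_iUnion_null hcon)
    obtain ⟨b, hb⟩ := h1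
    obtain ⟨m, hm⟩ := ENNReal.exists_inv_nat_lt hb
    exact Set.mem_iUnion.mpr ⟨(b, m), hv, hm.le⟩
  have h2 : ∃ q, volume (Th q) ≠ 0 := by
    by_contra! hcon
    have := measure_mono_null hcov (measure_iUnion_null hcon)
    rw [hUv] at this
    exact one_ne_zero this
  obtain ⟨⟨b, m⟩, hq⟩ := h2
  obtain ⟨c1, hc1, hc1'⟩ := exists_small hq
  obtain ⟨c2, hc2, hc2'⟩ := exists_small (a := (m : ℝ≥0∞)⁻¹) (by simp)
  set c := min (min c1 c2) 1 with hc
  have hcpos : 0 < c := by simp [hc, hc1, hc2]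
  have hcc1 : c ≤ c1 := (min_le_left _ _).trans (min_le_left _ _)
  have hcc2 : c ≤ c2 := (min_le_left _ _).trans (min_le_right _ _)
  refine ⟨b, c, hcpos, min_le_right _ _, ?_⟩
  intro E w hE hw
  let W : ℕ → (Fin n → ℝ) → (Fin n → ℝ) → Set ℝ := fun j v y =>
    {t : ℝ | t ∈ Set.Icc (0 : ℝ) 1 ∧ (Fin.cons t (y + t • v) : Fin (n + 1) → ℝ) ∈ E j}
  let YY : ℕ → (Fin n → ℝ) → Set (Fin n → ℝ) := fun j v =>
    {y | y ∈ cub (0, b) ∧ ENNReal.ofReal (w j) ≤ volume (W j v y)}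
  have hY : ∀ v, Yf A v ∩ cub (0, b) ⊆ ⋃ j, YY j v := by
    rintro v y ⟨hy, hyb⟩
    obtain ⟨j, hj⟩ := om_pigeon (volume : Measure ℝ).toOuterMeasure (Set.Icc (0 : ℝ) 1) (fun j => W j v y)
      (fun t ht => by
        obtain ⟨j, hj⟩ := Set.mem_iUnion.mp (hE (hy t ht))
        exact Set.mem_iUnion.mpr ⟨j, ht, hj⟩) w hw 1 one_pos (by simp)
    rw [one_mul] at hj
    exact Set.mem_iUnion.mpr ⟨j, hyb, hj⟩
  have hT : Th (b, m) ⊆ ⋃ j, {v | v ∈ U ∧ ENNReal.ofReal (c * w j) ≤ cont σ (YY j v)} := by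
    rintro v ⟨hvU, hv⟩
    obtain ⟨j, hj⟩ := om_pigeon (cont σ) _ _ (hY v) w hw c hcpos
      (((ENNReal.ofReal_le_ofReal hcc2).trans hc2').trans hv)
    exact Set.mem_iUnion.mpr ⟨j, hvU, hj⟩
  obtain ⟨j, hj⟩ := om_pigeon (volume : Measure (Fin n → ℝ)).toOuterMeasure _ _ hT w hw c hcpos
      ((ENNReal.ofReal_le_ofReal hcc1).trans hc1')
  refine ⟨j, _, fun v hv => hv.1, hj, ?_⟩
  intro v hv
  exact ⟨YY j v, fun y hy => hy.1, hv.2, fun y hy => hy.2⟩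

/-! ### Cells of bounded sets -/

theorem vol_cub {n : ℕ} (j : ℕ) (c : Fin n → ℤ) :
    volume (cub (j, c)) = ENNReal.ofReal (((2 : ℝ) ^ j) ^ n)⁻¹ := by
  have hQ : (0 : ℝ) < 2 ^ j := by positivity
  have : cub (j, c) = Set.univ.pi (fun i : Fin n => Set.Ico ((c i : ℝ) / 2 ^ j) ((c i + 1 : ℝ) / 2 ^ j)) := by
    ext x
    simp only [cub, Set.mem_ofPred_eq, Set.mem_pi, Set.mem_univ, true_implies, Set.mem_Ico]
    refine forall_congr' fun i => ?_
    rw [Int.floor_eq_iff, div_le_iff₀ hQ, lt_div_iff₀ hQ, mul_comm]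
  rw [this, Real.volume_pi_Ico]
  have h2 : ∀ i : Fin n, (c i + 1 : ℝ) / 2 ^ j - (c i : ℝ) / 2 ^ j = (2 ^ j)⁻¹ := by
    intro i; field_simp; ring
  simp only [h2, Finset.prod_const, Finset.card_univ, Fintype.card_fin]
  rw [← ENNReal.ofReal_pow (by positivity), inv_pow]

def box {n : ℕ} (j : ℕ) (b : Fin n → ℤ) : Finset (Fin n → ℤ) :=
  Fintype.piFinset (fun i => Finset.Ico (b i * 2 ^ j) ((b i + 1) * 2 ^ j))

theorem mem_box {n : ℕ} (k j : ℕ) (b : Fin n → ℤ) (x : Fin n → ℝ) :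
    cell (k + j) x ∈ box j b ↔ x ∈ cub (k, b) := by
  unfold box cell cub
  simp only [Fintype.mem_piFinset, Finset.mem_Ico, Set.mem_ofPred_eq]
  refine forall_congr' fun i => ?_
  rw [Int.floor_eq_iff, Int.le_floor, Int.floor_lt]
  push_cast
  have hQ : (0 : ℝ) < 2 ^ j := by positivity
  rw [pow_add, mul_right_comm, mul_le_mul_iff_left₀ hQ, mul_lt_mul_iff_left₀ hQ]

theorem box_card {n : ℕ} (j : ℕ) (b : Fin n → ℤ) : (box j b).card = (2 ^ j) ^ n := by
  unfold box
  rw [Fintype.card_piFinset]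
  have : ∀ i, (Finset.Ico (b i * 2 ^ j) ((b i + 1) * 2 ^ j)).card = 2 ^ j := by
    intro i; rw [Int.card_Ico]
    have : (b i + 1) * 2 ^ j - b i * 2 ^ j = ((2 ^ j : ℕ) : ℤ) := by push_cast; ring
    rw [this, Int.toNat_natCast]
  simp [this]

theorem cells_sel {n : ℕ} (j : ℕ) (b : Fin n → ℤ) (S : Set (Fin n → ℝ)) (hS : S ⊆ cub (0, b)) :
    ∃ X : Finset (Fin n → ℤ), (∀ x ∈ S, cell j x ∈ X) ∧ ∀ c ∈ X, ∃ x ∈ S, cell j x = c := by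
  have hfin : (cell j '' S).Finite := by
    refine (box j b).finite_toSet.subset ?_
    rintro _ ⟨x, hx, rfl⟩
    have := (mem_box 0 j b x).mpr (hS hx)
    rwa [zero_add] at this
  refine ⟨hfin.toFinset, fun x hx => by simpa using ⟨x, hx, rfl⟩, fun c hc => ?_⟩
  simpa using hc

theorem vol_le_cells {n : ℕ} (A : Set (Fin n → ℝ)) (j : ℕ) (X : Finset (Fin n → ℤ))
    (h : ∀ x ∈ A, cell j x ∈ X) : volume A ≤ X.card * ENNReal.ofReal (((2 : ℝ) ^ j) ^ n)⁻¹ := by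
  have hsub : A ⊆ ⋃ c ∈ X, cub (j, c) := fun x hx =>
    Set.mem_iUnion₂.mpr ⟨cell j x, h x hx, mem_cub_cell j x⟩
  calc volume A ≤ volume (⋃ c ∈ X, cub (j, c)) := measure_mono hsub
    _ ≤ ∑ c ∈ X, volume (cub (j, c)) := measure_biUnion_finset_le _ _
    _ = _ := by simp only [vol_cub, Finset.sum_const, nsmul_eq_mul]

theorem unit_cub {n : ℕ} : {v : Fin n → ℝ | ∀ i, v i ∈ Set.Ico (0 : ℝ) 1} ⊆ cub (0, 0) := by
  intro v hv i
  have := hv i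
  simp only [pow_zero, one_mul, Pi.zero_apply]
  rw [Int.floor_eq_iff]; simpa using this

/-- number of cells from lower bounds in `ENNReal` -/
theorem card_of_le {m : ℕ} {a q : ℝ} (hq : 0 < q) (h : ENNReal.ofReal a ≤ m * ENNReal.ofReal q⁻¹) :
    a * q ≤ m := by
  rw [← ENNReal.ofReal_natCast, ← ENNReal.ofReal_mul (Nat.cast_nonneg _),
    ENNReal.ofReal_le_ofReal_iff (by positivity)] at h
  calc a * q ≤ m * q⁻¹ * q := by gcongr
    _ = m := by field_simp

theorem shading_meas {n : ℕ} (E : Set (Fin (n + 1) → ℝ)) (hE : MeasurableSet E) (y v : Fin n → ℝ) :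
    MeasurableSet {t : ℝ | t ∈ Set.Icc (0 : ℝ) 1 ∧ (Fin.cons t (y + t • v) : Fin (n + 1) → ℝ) ∈ E} := by
  refine measurableSet_Icc.inter ?_
  have : Measurable (fun t : ℝ => (Fin.cons t (y + t • v) : Fin (n + 1) → ℝ)) := by
    refine measurable_pi_lambda _ fun i => ?_
    refine Fin.cases ?_ (fun i => ?_) i
    · simp only [Fin.cons_zero]; fun_prop
    · simp only [Fin.cons_succ, Pi.add_apply, Pi.smul_apply, smul_eq_mul]; fun_prop
  exact this hE

theorem floor_vol (j : ℕ) (a : ℤ) : volume {t : ℝ | ⌊(2 : ℝ) ^ j * t⌋ = a} = ENNReal.ofReal ((2 : ℝ) ^ j)⁻¹ := by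
  have hQ : (0 : ℝ) < 2 ^ j := by positivity
  have : {t : ℝ | ⌊(2 : ℝ) ^ j * t⌋ = a} = Set.Ico ((a : ℝ) / 2 ^ j) ((a + 1 : ℝ) / 2 ^ j) := by
    ext t
    simp only [Set.mem_ofPred_eq, Set.mem_Ico]
    rw [Int.floor_eq_iff, div_le_iff₀ hQ, lt_div_iff₀ hQ, mul_comm]
  rw [this, Real.volume_Ico]
  congr 1; field_simp; ring

/-- integral of the layer counts -/
theorem layer_int {n : ℕ} (j : ℕ) (F : Finset (Fin (n + 1) → ℤ)) :
    ∫⁻ t in Set.Icc (0 : ℝ) 1, ((F.filter (fun p => p 0 = ⌊(2 : ℝ) ^ j * t⌋)).card : ℝ≥0∞) ≤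
      F.card * ENNReal.ofReal ((2 : ℝ) ^ j)⁻¹ := by
  have h1 : ∀ t : ℝ, ((F.filter (fun p => p 0 = ⌊(2 : ℝ) ^ j * t⌋)).card : ℝ≥0∞) =
      ∑ p ∈ F, Set.indicator {t : ℝ | ⌊(2 : ℝ) ^ j * t⌋ = p 0} 1 t := by
    intro t
    rw [Finset.card_filter]
    push_cast
    refine Finset.sum_congr rfl fun p _ => ?_
    simp only [Set.indicator, Set.mem_ofPred_eq, Pi.one_apply, eq_comm]
  have hm : ∀ p : Fin (n + 1) → ℤ, MeasurableSet {t : ℝ | ⌊(2 : ℝ) ^ j * t⌋ = p 0} := by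
    intro p
    have : Measurable (fun t : ℝ => ⌊(2 : ℝ) ^ j * t⌋) := Int.measurable_floor.comp (by fun_prop)
    exact this (measurableSet_singleton _)
  calc _ ≤ ∫⁻ t : ℝ, ((F.filter (fun p => p 0 = ⌊(2 : ℝ) ^ j * t⌋)).card : ℝ≥0∞) := setLIntegral_le_lintegral _ _
    _ = ∑ p ∈ F, ∫⁻ t : ℝ, Set.indicator {t : ℝ | ⌊(2 : ℝ) ^ j * t⌋ = p 0} 1 t := by
      simp only [h1]
      exact lintegral_finsetSum _ fun p _ => measurable_one.indicator (hm p)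
    _ = ∑ p ∈ F, ENNReal.ofReal ((2 : ℝ) ^ j)⁻¹ := by
      refine Finset.sum_congr rfl fun p _ => ?_
      rw [lintegral_indicator_one (hm p), floor_vol]
    _ = _ := by rw [Finset.sum_const, nsmul_eq_mul]

theorem stepA_core {n : ℕ} (α β : ℝ) (G : ℝ → ℝ)
    (hG : ∀ (lam I Y : ℝ) (L : Finset (Ln n)) (S : Ln n → Set ℝ), 0 < lam → lam ≤ 1 → 0 ≤ I → 0 ≤ Y →
      (∀ l ∈ L, MeasurableSet (S l)) → (∀ l ∈ L, S l ⊆ Set.Icc 0 1) →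
      (∀ l ∈ L, ENNReal.ofReal lam ≤ volume (S l)) →
      (∀ v, ((L.filter (fun l => l.2 = v)).card : ℝ) ≤ Y) →
      (∫⁻ t in Set.Icc (0 : ℝ) 1, (lNt L S t : ℝ≥0∞) ≤ ENNReal.ofReal I) →
      (L.card : ℝ) ≤ G lam⁻¹ * I ^ α * Y ^ β)
    (j : ℕ) (F : Finset (Fin (n + 1) → ℤ)) (lam σ : ℝ) (h0 : 0 < lam) (h1 : lam ≤ 1) (b : Fin n → ℤ)
    (Θ : Set (Fin n → ℝ)) (hΘ : Θ ⊆ {v | ∀ i, v i ∈ Set.Ico (0 : ℝ) 1})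
    (hΘv : ENNReal.ofReal lam ≤ volume Θ)
    (hY : ∀ v ∈ Θ, ∃ Y' ⊆ cub (0, b), ENNReal.ofReal lam ≤ cont σ Y' ∧ ∀ y ∈ Y', ENNReal.ofReal lam ≤
      volume {t : ℝ | t ∈ Set.Icc (0 : ℝ) 1 ∧ (Fin.cons t (y + t • v) : Fin (n + 1) → ℝ) ∈ ⋃ p ∈ F, cub (j, p)}) :
    ∃ Y : ℝ, lam * ((2 : ℝ) ^ j) ^ σ ≤ Y ∧ 0 < Y ∧
      lam * ((2 : ℝ) ^ j) ^ n * Y ≤ G lam⁻¹ * (3 ^ n * F.card * ((2 : ℝ) ^ j)⁻¹) ^ α * Y ^ β := by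
  classical
  set Q : ℝ := 2 ^ j with hQ
  have hQ0 : 0 < Q := by positivity
  set E : Set (Fin (n + 1) → ℝ) := ⋃ p ∈ F, cub (j, p) with hE
  have hEm : MeasurableSet E := Finset.measurableSet_biUnion _ fun p _ => cub_meas _
  obtain ⟨V, hV1, hV2⟩ := cells_sel j 0 Θ (hΘ.trans unit_cub)
  have hVc : lam * Q ^ n ≤ V.card := card_of_le (by positivity) (hΘv.trans (vol_le_cells Θ j V hV1))
  set N : ℕ := ⌈lam * Q ^ σ⌉₊ with hN
  have hNpos : 0 < N := Nat.ceil_pos.mpr (by positivity)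
  -- choose representatives
  have hsel : ∀ d : Fin n → ℤ, ∃ v : Fin n → ℝ, ∃ X : Finset (Fin n → ℤ), ∃ y : (Fin n → ℤ) → (Fin n → ℝ),
      d ∈ V → (cell j v = d ∧ X.card = N ∧ ∀ e ∈ X, cell j (y e) = e ∧ ENNReal.ofReal lam ≤
        volume {t : ℝ | t ∈ Set.Icc (0 : ℝ) 1 ∧ (Fin.cons t (y e + t • v) : Fin (n + 1) → ℝ) ∈ E}) := by
    intro d
    by_cases hd : d ∈ V
    · obtain ⟨v, hv, hvd⟩ := hV2 d hd
      obtain ⟨Y', hY'b, hY'c, hY's⟩ := hY v hv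
      obtain ⟨X, hX1, hX2⟩ := cells_sel j b Y' hY'b
      have hXc : lam * Q ^ σ ≤ X.card := by
        apply card_of_le (by positivity)
        refine (hY'c.trans (cont_le_cells σ Y' j X hX1)).trans (le_of_eq ?_)
        congr 2
        rw [hQ, ← Real.rpow_natCast 2 j, ← Real.rpow_mul (by norm_num), ← Real.rpow_neg (by norm_num), neg_mul]
      obtain ⟨X', hX'X, hX'c⟩ := Finset.exists_subset_card_eq (Nat.ceil_le.mpr hXc)
      choose! y hy1 hy2 using hX2
      exact ⟨v, X', y, fun _ => ⟨hvd, hX'c, fun e he =>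
        ⟨hy2 e (hX'X he), hY's _ (hy1 e (hX'X he))⟩⟩⟩
    · exact ⟨0, ∅, 0, fun h => absurd h hd⟩
  choose v X y hsel using hsel
  set L : Finset (Ln n) := V.biUnion fun d => (X d).image fun e => (e, d) with hL
  have hmem : ∀ l ∈ L, l.2 ∈ V ∧ l.1 ∈ X l.2 := by
    intro l hl
    simp only [hL, Finset.mem_biUnion, Finset.mem_image] at hl
    obtain ⟨d, hd, e, he, rfl⟩ := hl
    exact ⟨hd, he⟩
  have hLc : L.card = V.card * N := by
    rw [hL, Finset.card_biUnion]
    · rw [Finset.sum_const_nat (m := N)]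
      intro d hd
      rw [Finset.card_image_of_injective _ (fun a b h => congrArg Prod.fst h)]
      exact (hsel d hd).2.1
    · intro d _ d' _ hdd
      rw [Function.onFun, Finset.disjoint_left]
      intro l hl hl'
      simp only [Finset.mem_image] at hl hl'
      obtain ⟨e, _, rfl⟩ := hl
      obtain ⟨e', _, h⟩ := hl'
      exact hdd (congrArg Prod.snd h).symm
  set S : Ln n → Set ℝ := fun l =>
    {t : ℝ | t ∈ Set.Icc (0 : ℝ) 1 ∧ (Fin.cons t (y l.2 l.1 + t • v l.2) : Fin (n + 1) → ℝ) ∈ E} with hS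
  have hNt : ∀ t, lNt L S t ≤ 3 ^ n * (F.filter (fun p => p 0 = ⌊Q * t⌋)).card := by
    intro t
    have hsub : (L.filter (fun l => t ∈ S l)).image (fun l => lcel l t) ⊆
        (F.filter (fun p => p 0 = ⌊Q * t⌋)).biUnion fun p => nbr (fun i => p (Fin.succ i) - 1) := by
      intro c hc
      simp only [Finset.mem_image, Finset.mem_filter] at hc
      obtain ⟨l, ⟨hl, ht, hlE⟩, rfl⟩ := hc
      simp only [hE, Set.mem_iUnion] at hlE
      obtain ⟨p, hp, hpc⟩ := hlE
      have hl' := hmem l hl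
      obtain ⟨hv, _, hy⟩ := hsel l.2 hl'.1
      obtain ⟨hy, _⟩ := hy l.1 hl'.2
      simp only [Finset.mem_biUnion, Finset.mem_filter]
      refine ⟨p, ⟨hp, ?_⟩, ?_⟩
      · have := hpc 0
        simpa [hQ] using this.symm
      · rw [mem_nbr]
        intro i
        have h3 := hpc (Fin.succ i)
        simp only [Fin.cons_succ, Pi.add_apply, Pi.smul_apply, smul_eq_mul, ← hQ] at h3
        have h4 := congrFun hv i
        have h5 := congrFun hy i
        simp only [cell, ← hQ] at h4 h5
        rw [Int.floor_eq_iff] at h3 h4 h5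
        unfold lcel lpos
        obtain ⟨ht0, ht1⟩ := ht
        have h6 : 0 ≤ t * (Q * v l.2 i - l.2 i) := mul_nonneg ht0 (by linarith)
        have h7 : t * (Q * v l.2 i - l.2 i) ≤ 1 := by nlinarith
        constructor
        · rw [Int.le_floor]; push_cast; nlinarith
        · have : ⌊(l.1 i : ℝ) + t * l.2 i⌋ < p i.succ + 1 := by
            rw [Int.floor_lt]; push_cast; nlinarith
          lia
    have hc := (Finset.card_le_card hsub).trans Finset.card_biUnion_le
    simp only [nbr_card, Finset.sum_const, smul_eq_mul] at hc
    rw [mul_comm]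
    refine le_trans (le_of_eq ?_) hc
    unfold lNt
    congr!
  have hmain := hG lam (3 ^ n * F.card * Q⁻¹) N L S h0 h1 (by positivity) (Nat.cast_nonneg _)
    (fun l _ => shading_meas E hEm _ _) (fun l _ t ht => ht.1)
    (fun l hl => (((hsel l.2 (hmem l hl).1).2.2) l.1 (hmem l hl).2).2) ?_ ?_
  · refine ⟨N, Nat.le_ceil _, by exact_mod_cast hNpos, ?_⟩
    refine le_trans ?_ hmain
    rw [hLc]; push_cast
    gcongr
  · intro d
    have : (L.filter (fun l => l.2 = d)) ⊆ if d ∈ V then (X d).image fun e => (e, d) else ∅ := by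
      intro l hl
      rw [Finset.mem_filter] at hl
      obtain ⟨hl, rfl⟩ := hl
      have := hmem l hl
      rw [if_pos this.1, Finset.mem_image]
      exact ⟨l.1, this.2, rfl⟩
    have h2 := Finset.card_le_card this
    have h3 : (L.filter (fun l => l.2 = d)).card ≤ N := by
      refine h2.trans ?_
      split_ifs with hd
      · exact Finset.card_image_le.trans (hsel d hd).2.1.le
      · simp
    exact_mod_cast h3
  · calc ∫⁻ t in Set.Icc (0 : ℝ) 1, (lNt L S t : ℝ≥0∞)
        ≤ ∫⁻ t in Set.Icc (0 : ℝ) 1, (3 ^ n : ℝ≥0∞) * ((F.filter (fun p => p 0 = ⌊Q * t⌋)).card : ℝ≥0∞) := by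
          apply lintegral_mono
          intro t
          have := hNt t
          show (lNt L S t : ℝ≥0∞) ≤ (3 ^ n : ℝ≥0∞) * ((F.filter (fun p => p 0 = ⌊Q * t⌋)).card : ℝ≥0∞)
          exact_mod_cast this
      _ = 3 ^ n * ∫⁻ t in Set.Icc (0 : ℝ) 1, ((F.filter (fun p => p 0 = ⌊Q * t⌋)).card : ℝ≥0∞) :=
          lintegral_const_mul' _ _ (by simp)
      _ ≤ 3 ^ n * (F.card * ENNReal.ofReal Q⁻¹) := by gcongr; exact layer_int j F
      _ = _ := by
          rw [ENNReal.ofReal_mul (by positivity), ENNReal.ofReal_mul (by positivity),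
            ENNReal.ofReal_pow (by norm_num), ENNReal.ofReal_natCast]
          simp [mul_assoc]

/-! ### Step A: dimension increment -/

theorem level_fin {n : ℕ} (s : ℝ) (P : Set (ℕ × (Fin n → ℤ))) (ε : ℝ) (hε : 0 ≤ ε)
    (h : ∑' p : P, ccost s p.1 ≤ ENNReal.ofReal ε) (j : ℕ) : ∃ F : Finset (Fin n → ℤ),
      (∀ c, c ∈ F ↔ (j, c) ∈ P) ∧ (F.card : ℝ) ≤ ε * ((2 : ℝ) ^ j) ^ s := by
  classical
  rw [tsum_subtype P (ccost s)] at h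
  have hcost : ∀ c : Fin n → ℤ, ccost s (j, c) = ENNReal.ofReal (((2 : ℝ) ^ j) ^ s)⁻¹ := by
    intro c
    unfold ccost
    congr 1
    rw [← Real.rpow_natCast 2 j, ← Real.rpow_mul (by norm_num), ← Real.rpow_neg (by norm_num), neg_mul]
  have hpos : (0 : ℝ) < ((2 : ℝ) ^ j) ^ s := by positivity
  have hfin : {c : Fin n → ℤ | (j, c) ∈ P}.Finite := by
    have h1 := ENNReal.finite_const_le_of_tsum_ne_top (ne_top_of_le_ne_top ENNReal.ofReal_ne_top h)
      (ε := ENNReal.ofReal (((2 : ℝ) ^ j) ^ s)⁻¹) (by simpa using hpos)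
    have h2 := h1.preimage (f := fun c : Fin n → ℤ => (j, c)) (fun a _ b _ h => congrArg Prod.snd h)
    refine h2.subset ?_
    intro c hc
    show ENNReal.ofReal (((2 : ℝ) ^ j) ^ s)⁻¹ ≤ P.indicator (ccost s) (j, c)
    rw [Set.indicator_of_mem (show (j, c) ∈ P from hc), hcost]
  refine ⟨hfin.toFinset, fun c => by simp, ?_⟩
  have h3 := ENNReal.sum_le_tsum (f := P.indicator (ccost s)) (hfin.toFinset.image fun c => (j, c))
  rw [Finset.sum_image (fun a _ b _ h => congrArg Prod.snd h)] at h3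
  have h4 : ∑ c ∈ hfin.toFinset, P.indicator (ccost s) (j, c) =
      hfin.toFinset.card * ENNReal.ofReal (((2 : ℝ) ^ j) ^ s)⁻¹ := by
    rw [← nsmul_eq_mul, ← Finset.sum_const]
    refine Finset.sum_congr rfl fun c hc => ?_
    rw [Set.indicator_of_mem (by simpa using hc), hcost]
  rw [h4] at h3
  have h5 := h3.trans h
  rw [← ENNReal.ofReal_natCast, ← ENNReal.ofReal_mul (Nat.cast_nonneg _), ENNReal.ofReal_le_ofReal_iff hε] at h5
  calc ((hfin.toFinset).card : ℝ) = (hfin.toFinset).card * (((2 : ℝ) ^ j) ^ s)⁻¹ * ((2 : ℝ) ^ j) ^ s := by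
        field_simp
    _ ≤ _ := by gcongr

theorem growth {G : ℝ → ℝ} (hG : PB G) {δ c : ℝ} (hδ : 0 < δ) (hc : 0 < c) (hc1 : c ≤ 1) :
    ∃ j0 : ℕ, ∀ j ≥ j0, G (((j : ℝ) + 1) ^ 2 / c) < ((2 : ℝ) ^ j) ^ δ := by
  obtain ⟨K, hK⟩ := hG
  have h1 : Filter.Tendsto (fun j : ℕ => ((j : ℝ)) ^ (2 * K) * (((2 : ℝ) ^ δ)⁻¹) ^ j) Filter.atTop (nhds 0) := by
    apply tendsto_pow_const_mul_const_pow_of_lt_one _ (by positivity)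
    apply inv_lt_one_of_one_lt₀
    exact Real.one_lt_rpow (by norm_num) hδ
  have h2 := (Filter.tendsto_add_atTop_iff_nat 1).mpr h1
  have h3 : ∀ᶠ j : ℕ in Filter.atTop, (((j + 1 : ℕ) : ℝ)) ^ (2 * K) * (((2 : ℝ) ^ δ)⁻¹) ^ (j + 1) <
      ((2 : ℝ) ^ δ)⁻¹ * ((K + 1) * (c⁻¹) ^ K)⁻¹ := by
    apply h2.eventually_lt_const
    positivity
  obtain ⟨j0, hj0⟩ := Filter.eventually_atTop.mp h3
  refine ⟨j0, fun j hj => ?_⟩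
  have h4 := hj0 j hj
  push_cast at h4
  have hj1 : (0 : ℝ) ≤ j := Nat.cast_nonneg _
  have h5 : 1 ≤ ((j : ℝ) + 1) ^ 2 / c := by
    rw [le_div_iff₀ hc]; nlinarith
  refine lt_of_le_of_lt (hK _ h5).2 ?_
  have e1 : ((2 : ℝ) ^ j) ^ δ = ((2 : ℝ) ^ δ) ^ j := by
    rw [← Real.rpow_natCast, ← Real.rpow_natCast, ← Real.rpow_mul (by norm_num), ← Real.rpow_mul (by norm_num), mul_comm]
  rw [e1]
  set q := (2 : ℝ) ^ δ with hq
  have hq0 : 0 < q := by positivity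
  rw [pow_succ, ← mul_assoc, mul_comm q⁻¹, mul_lt_mul_iff_left₀ (by positivity), inv_pow,
    ← div_eq_mul_inv, div_lt_iff₀ (by positivity), ← div_eq_inv_mul, lt_div_iff₀ (by positivity)] at h4
  calc (K : ℝ) * (((j : ℝ) + 1) ^ 2 / c) ^ K ≤ (K + 1) * (((j : ℝ) + 1) ^ 2 / c) ^ K := by
        gcongr; linarith
    _ = ((j : ℝ) + 1) ^ (2 * K) * ((K + 1) * c⁻¹ ^ K) := by
        rw [div_pow, ← pow_mul, div_eq_mul_inv, inv_pow]; ring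
    _ < _ := h4

theorem stepA_arith {n : ℕ} {α β s σ lam Q Y N g : ℝ} (hα : 1 ≤ α) (hβ : 0 ≤ β) (hβ1 : β ≤ 1)
    (h0 : 0 < lam) (h1 : lam ≤ 1) (hQ : 1 ≤ Q) (hY : lam * Q ^ σ ≤ Y) (hY0 : 0 < Y)
    (hN0 : 0 ≤ N) (hN : N ≤ Q ^ s) (hg : 0 ≤ g)
    (h : lam * Q ^ n * Y ≤ g * (3 ^ n * N * Q⁻¹) ^ α * Y ^ β) :
    Q ^ (n + σ * (1 - β) - (s - 1) * α) ≤ g * (3 ^ n) ^ α * lam⁻¹ ^ 2 := by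
  have hQ0 : 0 < Q := by linarith
  have e1 : Y = Y ^ (1 - β) * Y ^ β := by rw [← Real.rpow_add hY0]; simp
  have h2 : lam * Q ^ n * Y ^ (1 - β) ≤ g * (3 ^ n * N * Q⁻¹) ^ α := by
    rw [e1, ← mul_assoc] at h
    have hp : 0 < Y ^ β := by positivity
    rw [← e1] at h
    exact le_of_mul_le_mul_right h hp
  have h3 : lam * Q ^ (σ * (1 - β)) ≤ Y ^ (1 - β) := by
    calc lam * Q ^ (σ * (1 - β)) ≤ lam ^ (1 - β) * Q ^ (σ * (1 - β)) := by
          gcongr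
          calc lam = lam ^ (1 : ℝ) := by simp
            _ ≤ _ := Real.rpow_le_rpow_of_exponent_ge h0 h1 (by linarith)
      _ = (lam * Q ^ σ) ^ (1 - β) := by
          rw [Real.mul_rpow h0.le (by positivity), ← Real.rpow_mul hQ0.le]
      _ ≤ _ := by
          apply Real.rpow_le_rpow (by positivity) hY (by linarith)
  have h4 : (3 ^ n * N * Q⁻¹) ^ α ≤ (3 ^ n) ^ α * Q ^ ((s - 1) * α) := by
    calc (3 ^ n * N * Q⁻¹) ^ α ≤ (3 ^ n * Q ^ (s - 1)) ^ α := by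
          apply Real.rpow_le_rpow (by positivity) _ (by linarith)
          rw [Real.rpow_sub hQ0, Real.rpow_one, div_eq_mul_inv, mul_assoc]
          gcongr
      _ = _ := by rw [Real.mul_rpow (by positivity) (by positivity), ← Real.rpow_mul hQ0.le]
  have h5 : lam ^ 2 * Q ^ (n + σ * (1 - β)) ≤ g * (3 ^ n) ^ α * Q ^ ((s - 1) * α) := by
    calc lam ^ 2 * Q ^ (n + σ * (1 - β)) = lam * Q ^ n * (lam * Q ^ (σ * (1 - β))) := by
          rw [Real.rpow_add hQ0, Real.rpow_natCast]; ring
      _ ≤ lam * Q ^ n * Y ^ (1 - β) := by gcongr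
      _ ≤ _ := h2
      _ ≤ g * ((3 ^ n) ^ α * Q ^ ((s - 1) * α)) := by gcongr
      _ = _ := by ring
  rw [Real.rpow_sub hQ0, div_le_iff₀ (by positivity), inv_pow, mul_right_comm, ← div_eq_mul_inv,
    le_div_iff₀ (by positivity), mul_comm]
  exact h5

theorem exists_weights : ∃ κ : ℝ, 0 < κ ∧ κ ≤ 1 ∧ ∑' j : ℕ, ENNReal.ofReal (κ / ((j : ℝ) + 1) ^ 2) < 1 := by
  have hs : Summable (fun j : ℕ => 1 / ((j : ℝ) + 1) ^ 2) := by
    have := (summable_nat_add_iff 1).mpr (Real.summable_one_div_nat_pow.mpr (one_lt_two))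
    refine this.congr fun j => ?_
    push_cast; rfl
  set T := ∑' j : ℕ, 1 / ((j : ℝ) + 1) ^ 2 with hT
  have hT0 : 0 ≤ T := tsum_nonneg fun j => by positivity
  refine ⟨1 / (T + 1), by positivity, by rw [div_le_one (by positivity)]; linarith, ?_⟩
  have h2 : ∀ j : ℕ, 1 / (T + 1) / ((j : ℝ) + 1) ^ 2 = 1 / (T + 1) * (1 / ((j : ℝ) + 1) ^ 2) := by
    intro j; ring
  simp only [h2]
  rw [← ENNReal.ofReal_tsum_of_nonneg (fun j => by positivity) (hs.mul_left _), tsum_mul_left, ← hT,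
    ← ENNReal.ofReal_one, ENNReal.ofReal_lt_ofReal_iff one_pos, one_div, ← div_eq_inv_mul,
    div_lt_one (by positivity)]
  linarith

theorem stepA {n : ℕ} (A : Set (Fin (n + 1) → ℝ)) (σ s : ℝ) (hf : ∀ v, cont σ (Yf A v) ≠ 0)
    (hs : s < n + 1 - (n - σ) / (1 + Real.sqrt 2)) : cont s A ≠ 0 := by
  have hne : A.Nonempty := by
    have : (Yf A 0).Nonempty := by
      rw [Set.nonempty_iff_ne_empty]
      intro h
      exact hf 0 (by rw [h, measure_empty])
    obtain ⟨y, hy⟩ := this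
    exact ⟨_, hy 0 (by simp)⟩
  rcases le_or_gt s 0 with hs0 | hs0
  · exact cont_nonneg_exp hs0 hne
  intro hzero
  -- parameters
  set a := Real.sqrt 2 with ha
  have ha2 : a * a = 2 := Real.mul_self_sqrt (by norm_num)
  have ha0 : 0 ≤ a := Real.sqrt_nonneg 2
  have ha1 : 1 < a := by nlinarith
  have ha15 : a < 3 / 2 := by nlinarith
  set δ0 := n + σ * (a / 2) - (s - 1) * (1 + a / 2) with hδ0
  have hδ0pos : 0 < δ0 := by
    have h1 : (s - (n + 1)) * (1 + a) < -(n - σ) := by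
      have : s - (n + 1) < -((n - σ) / (1 + a)) := by linarith
      calc (s - (n + 1)) * (1 + a) < -((n - σ) / (1 + a)) * (1 + a) := by gcongr
        _ = _ := by field_simp
    have h2 : δ0 = a / 2 * (-(n - σ) - (s - (n + 1)) * (1 + a)) := by
      rw [hδ0]; linear_combination -((n : ℝ) + 1 - s) / 2 * ha2
    rw [h2]
    apply _root_.mul_pos <;> linarith
  set ε := min (1 / 10) (δ0 / (2 * (|σ| + |s - 1| + 1))) with hε
  have hε0 : 0 < ε := by positivity
  obtain ⟨α, β, hα, hβ, ⟨G, hGP, hG⟩, hα', hβ'⟩ := KTE_lim n ε hε0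
  have hβ1 : β ≤ 1 := by
    have := (abs_le.mp hβ').2
    have : ε ≤ 1 / 10 := min_le_left _ _
    linarith
  have hδ : 0 < n + σ * (1 - β) - (s - 1) * α := by
    have h1 : n + σ * (1 - β) - (s - 1) * α = δ0 - σ * (β - (1 - a / 2)) - (s - 1) * (α - (1 + a / 2)) := by
      rw [hδ0]; ring
    have h2 : σ * (β - (1 - a / 2)) ≤ |σ| * ε := by
      refine (le_abs_self _).trans ?_
      rw [abs_mul]; gcongr
    have h3 : (s - 1) * (α - (1 + a / 2)) ≤ |s - 1| * ε := by
      refine (le_abs_self _).trans ?_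
      rw [abs_mul]; gcongr
    have h4 : (|σ| + |s - 1| + 1) * ε ≤ δ0 / 2 := by
      calc (|σ| + |s - 1| + 1) * ε ≤ (|σ| + |s - 1| + 1) * (δ0 / (2 * (|σ| + |s - 1| + 1))) := by
            gcongr; exact min_le_right _ _
        _ = δ0 / 2 := by
            have : |σ| + |s - 1| + 1 ≠ 0 := by positivity
            field_simp
    rw [h1]; nlinarith
  obtain ⟨b, c, hc0, hc1, hPG⟩ := PG A σ hf
  obtain ⟨κ, hκ0, hκ1, hκs⟩ := exists_weights
  have hH : PB (fun x => G x * (3 ^ n) ^ α * x ^ 2) := (hGP.mul (PB.const (by positivity))).mul (PB.id.pow 2)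
  obtain ⟨j0, hj0⟩ := growth hH hδ (_root_.mul_pos hc0 hκ0) (by nlinarith)
  have hη : (0 : ℝ) < (((2 : ℝ) ^ j0) ^ s)⁻¹ := by positivity
  obtain ⟨P, hP, hPs⟩ := cont_exists (s := s) (A := A) (ε := ENNReal.ofReal (((2 : ℝ) ^ j0) ^ s)⁻¹)
    (by rw [hzero]; simpa using hη)
  choose F hF1 hF2 using level_fin s P _ hη.le hPs.le
  obtain ⟨j, Θ, hΘ, hΘv, hY⟩ := hPG (fun j => ⋃ p ∈ F j, cub (j, p)) (fun j => κ / ((j : ℝ) + 1) ^ 2) (by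
    intro x hx
    obtain ⟨⟨j, p⟩, hp, hxp⟩ := Set.mem_iUnion₂.mp (hP hx)
    exact Set.mem_iUnion.mpr ⟨j, Set.mem_iUnion₂.mpr ⟨p, (hF1 j p).mpr hp, hxp⟩⟩) hκs
  set lam := c * (κ / ((j : ℝ) + 1) ^ 2) with hlam
  have hj1 : (0 : ℝ) ≤ j := Nat.cast_nonneg _
  have hw1 : κ / ((j : ℝ) + 1) ^ 2 ≤ 1 := by
    rw [div_le_one (by positivity)]; nlinarith
  have hw0 : 0 < κ / ((j : ℝ) + 1) ^ 2 := by positivity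
  have hl0 : 0 < lam := by positivity
  have hl1 : lam ≤ 1 := by nlinarith
  have hlw : lam ≤ κ / ((j : ℝ) + 1) ^ 2 := by nlinarith
  obtain ⟨Y, hY1, hY0, hmain⟩ := stepA_core α β G hG j (F j) lam σ hl0 hl1 b Θ hΘ hΘv (by
    intro v hv
    obtain ⟨Y', hY'1, hY'2, hY'3⟩ := hY v hv
    exact ⟨Y', hY'1, hY'2, fun y hy => (ENNReal.ofReal_le_ofReal hlw).trans (hY'3 y hy)⟩)
  -- the scale is large
  have hFne : (F j).Nonempty := by
    by_contra hcon
    rw [Finset.not_nonempty_iff_eq_empty] at hcon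
    have h1 : lam * ((2 : ℝ) ^ j) ^ n * Y ≤ 0 := by
      refine hmain.trans ?_
      rw [hcon]; simp
      rw [Real.zero_rpow (by linarith)]; simp
    have : 0 < lam * ((2 : ℝ) ^ j) ^ n * Y := by positivity
    linarith
  have hj : j0 ≤ j := by
    have h1 : (1 : ℝ) ≤ (F j).card := by exact_mod_cast hFne.card_pos
    have h2 := h1.trans (hF2 j)
    rw [← div_eq_inv_mul, one_le_div (by positivity), Real.rpow_le_rpow_iff (by positivity) (by positivity) hs0] at h2
    exact (pow_le_pow_iff_right₀ (by norm_num : (1 : ℝ) < 2)).mp h2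
  have hNQ : ((F j).card : ℝ) ≤ ((2 : ℝ) ^ j) ^ s := by
    refine (hF2 j).trans ?_
    have : (((2 : ℝ) ^ j0) ^ s)⁻¹ ≤ 1 := by
      apply inv_le_one_of_one_le₀
      exact Real.one_le_rpow (one_le_pow₀ (by norm_num)) hs0.le
    calc _ ≤ 1 * ((2 : ℝ) ^ j) ^ s := by gcongr
      _ = _ := one_mul _
  have hlinv : lam⁻¹ = ((j : ℝ) + 1) ^ 2 / (c * κ) := by rw [hlam]; field_simp
  have hg : 0 ≤ G lam⁻¹ := hGP.nonneg ((one_le_inv₀ hl0).mpr hl1)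
  have hfin := stepA_arith hα hβ hβ1 hl0 hl1 (one_le_pow₀ (by norm_num)) hY1 hY0 (Nat.cast_nonneg _) hNQ hg hmain
  have hcon := hj0 j hj
  rw [hlinv] at hfin
  exact absurd hfin (not_le.mpr hcon)

/-! ### Plane sets and induction on the plane dimension -/

def PlaneSet (m k : ℕ) (A : Set (Fin m → ℝ)) : Prop :=
  ∀ M : Submodule ℝ (Fin m → ℝ), Module.finrank ℝ M = k → ∃ x, ∀ y ∈ M, y + x ∈ A

def liftMap {n : ℕ} (v : Fin n → ℝ) : (Fin n → ℝ) × ℝ →ₗ[ℝ] (Fin (n + 1) → ℝ) where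
  toFun p := Fin.cons p.2 (p.1 + p.2 • v)
  map_add' p q := by
    ext i
    refine Fin.cases ?_ (fun i => ?_) i
    · simp
    · simp; ring
  map_smul' r p := by
    ext i
    refine Fin.cases ?_ (fun i => ?_) i
    · simp
    · simp; ring

theorem liftMap_apply {n : ℕ} (v : Fin n → ℝ) (w : Fin n → ℝ) (t : ℝ) :
    liftMap v (w, t) = Fin.cons t (w + t • v) := rfl

theorem PlaneSet.fiber {n k : ℕ} {A : Set (Fin (n + 1) → ℝ)} (h : PlaneSet (n + 1) (k + 1) A)
    (v : Fin n → ℝ) : PlaneSet n k (Yf A v) := by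
  intro W hW
  let φ : W × ℝ →ₗ[ℝ] (Fin (n + 1) → ℝ) := (liftMap v).comp (W.subtype.prodMap LinearMap.id)
  have hφ : ∀ (w : W) (t : ℝ), φ (w, t) = Fin.cons t ((w : Fin n → ℝ) + t • v) := fun w t => rfl
  have hinj : Function.Injective φ := by
    rintro ⟨w, t⟩ ⟨w', t'⟩ h
    rw [hφ, hφ, Fin.cons_inj] at h
    obtain ⟨rfl, h⟩ := h
    have := add_right_cancel h
    rw [Subtype.ext this]
  have hr : Module.finrank ℝ (LinearMap.range φ) = k + 1 := by
    rw [LinearMap.finrank_range_of_inj hinj, Module.finrank_prod, hW, Module.finrank_self]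
  obtain ⟨x, hx⟩ := h _ hr
  refine ⟨Fin.tail x - x 0 • v, fun w hw t _ => ?_⟩
  have h1 := hx (φ (⟨w, hw⟩, t - x 0)) (LinearMap.mem_range_self _ _)
  convert h1 using 1
  rw [hφ]
  ext i
  refine Fin.cases ?_ (fun i => ?_) i
  · simp
  · simp [Fin.tail]; ring

theorem plane_cont (k c : ℕ) (A : Set (Fin (c + k) → ℝ)) (s : ℝ) (hA : PlaneSet (c + k) k A)
    (hs : s < c + k - c / (1 + Real.sqrt 2) ^ k) : cont s A ≠ 0 := by
  induction k generalizing s with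
  | zero =>
    simp at hs
    apply cont_nonneg_exp hs.le
    obtain ⟨x, hx⟩ := hA ⊥ (by simp)
    exact ⟨_, hx 0 (by simp)⟩
  | succ k ih =>
    set a := 1 + Real.sqrt 2 with ha
    have ha1 : 1 ≤ a := by linarith [Real.sqrt_nonneg 2]
    have ha0 : 0 < a := by linarith
    set X := (c : ℝ) / a ^ k with hX
    have h1 : (c : ℝ) / a ^ (k + 1) = X / a := by rw [hX, pow_succ, div_div]
    rw [h1] at hs
    push_cast at hs
    have h2 : X / a < (c + k + 1) - s := by linarith
    rw [div_lt_iff₀ ha0] at h2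
    obtain ⟨Z, hZ1, hZ2⟩ := exists_between h2
    have := stepA (n := c + k) A (c + k - Z) s (fun v => ih (Yf A v) _ (PlaneSet.fiber hA v) (by linarith)) (by
      push_cast
      have : (c + k - (c + k - Z)) / a < c + k + 1 - s := by
        rw [div_lt_iff₀ ha0]; linarith
      linarith)
    exact this

/-! ### Discrete Frostman lemma -/

theorem cell_anc {n : ℕ} {i j : ℕ} (hij : i ≤ j) {x y : Fin n → ℝ} (h : cell j x = cell j y) :
    cell i x = cell i y := by
  obtain ⟨k, rfl⟩ := Nat.exists_eq_add_of_le hij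
  have h1 := (mem_box i k (cell i x) x).mpr (mem_cub_cell i x)
  rw [h, mem_box, mem_cub_iff] at h1
  exact h1.symm

theorem frostman_aux {n : ℕ} (σ : ℝ) (Y : Set (Fin n → ℝ)) (J : ℕ) (P : Finset (Fin n → ℝ))
    (hP1 : ∀ y ∈ Y, ∃ p ∈ P, cell J p = cell J y) (hP2 : ∀ p ∈ P, ∀ p' ∈ P, cell J p = cell J p' → p = p')
    (m : ℕ) (hm : m ≤ J) : ∃ μ : (Fin n → ℝ) → ℝ, (∀ y, 0 ≤ μ y) ∧
      (∀ i, J - m ≤ i → i ≤ J → ∀ c, ∑ y ∈ P.filter (fun y => cell i y = c), μ y ≤ (2 : ℝ) ^ (-(i : ℝ) * σ)) ∧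
      ∀ c, cont σ (Y ∩ cub (J - m, c)) ≤
        ENNReal.ofReal (∑ y ∈ P.filter (fun y => cell (J - m) y = c), μ y) := by
  classical
  induction m with
  | zero =>
    refine ⟨fun _ => (2 : ℝ) ^ (-(J : ℝ) * σ), fun _ => by positivity, ?_, ?_⟩
    · intro i hi1 hi2 c
      have : i = J := by lia
      subst this
      rw [Finset.sum_const, nsmul_eq_mul]
      have : (P.filter (fun y => cell i y = c)).card ≤ 1 := by
        rw [Finset.card_le_one]
        intro a ha b hb
        rw [Finset.mem_filter] at ha hb
        exact hP2 a ha.1 b hb.1 (ha.2.trans hb.2.symm)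
      have h2 : ((P.filter (fun y => cell i y = c)).card : ℝ) ≤ 1 := by exact_mod_cast this
      calc _ ≤ 1 * (2 : ℝ) ^ (-(i : ℝ) * σ) := by gcongr
        _ = _ := one_mul _
    · intro c
      rw [Nat.sub_zero]
      rcases (P.filter (fun y => cell J y = c)).eq_empty_or_nonempty with he | ⟨p, hp⟩
      · have : Y ∩ cub (J, c) = ∅ := by
          rw [Set.eq_empty_iff_forall_notMem]
          rintro y ⟨hy, hyc⟩
          obtain ⟨p, hp, hpy⟩ := hP1 y hy
          have : p ∈ P.filter (fun y => cell J y = c) := by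
            rw [Finset.mem_filter]; exact ⟨hp, hpy.trans ((mem_cub_iff _ _ _).mp hyc)⟩
          rw [he] at this; simp at this
        rw [this, measure_empty]; exact bot_le
      · refine ((cont σ).mono Set.inter_subset_right).trans ((cont_cub σ (J, c)).trans ?_)
        apply ENNReal.ofReal_le_ofReal
        exact Finset.single_le_sum (f := fun _ : Fin n → ℝ => (2 : ℝ) ^ (-(J : ℝ) * σ))
          (fun _ _ => by positivity) hp
  | succ m ih =>
    obtain ⟨μ, hμ0, hμ1, hμ2⟩ := ih (by lia)
    set i := J - (m + 1) with hi
    have hi1 : J - m = i + 1 := by lia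
    rw [hi1] at hμ1 hμ2
    set M : (Fin n → ℤ) → ℝ := fun c => ∑ y ∈ P.filter (fun y => cell i y = c), μ y with hM
    have hM0 : ∀ c, 0 ≤ M c := fun c => Finset.sum_nonneg fun y _ => hμ0 y
    set w : ℝ := (2 : ℝ) ^ (-(i : ℝ) * σ) with hw
    have hw0 : 0 < w := by positivity
    set g : (Fin n → ℤ) → ℝ := fun c => min 1 (w / M c) with hg
    have hg0 : ∀ c, 0 ≤ g c := fun c => le_min zero_le_one (div_nonneg hw0.le (hM0 c))
    have hg1 : ∀ c, g c ≤ 1 := fun c => min_le_left _ _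
    have hsum : ∀ c, ∑ y ∈ P.filter (fun y => cell i y = c), μ y * g (cell i y) = M c * g c := by
      intro c
      rw [hM, Finset.sum_mul]
      refine Finset.sum_congr rfl fun y hy => ?_
      rw [(Finset.mem_filter.mp hy).2]
    have hcont : ∀ c, cont σ (Y ∩ cub (i, c)) ≤ ENNReal.ofReal (M c) := by
      intro c
      set T := (P.filter (fun y => cell i y = c)).image (cell (i + 1)) with hT
      have hsub : Y ∩ cub (i, c) ⊆ ⋃ c' ∈ T, Y ∩ cub (i + 1, c') := by
        rintro y ⟨hy, hyc⟩
        obtain ⟨p, hp, hpy⟩ := hP1 y hy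
        refine Set.mem_iUnion₂.mpr ⟨cell (i + 1) p, ?_, hy, ?_⟩
        · rw [hT]
          apply Finset.mem_image_of_mem
          rw [Finset.mem_filter]
          exact ⟨hp, (cell_anc (by lia) hpy).trans ((mem_cub_iff _ _ _).mp hyc)⟩
        · rw [mem_cub_iff]; exact (cell_anc (by lia) hpy).symm
      calc cont σ (Y ∩ cub (i, c)) ≤ cont σ (⋃ c' ∈ T, Y ∩ cub (i + 1, c')) := (cont σ).mono hsub
        _ ≤ ∑ c' ∈ T, cont σ (Y ∩ cub (i + 1, c')) := measure_biUnion_finset_le _ _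
        _ ≤ ∑ c' ∈ T, ENNReal.ofReal (∑ y ∈ P.filter (fun y => cell (i + 1) y = c'), μ y) :=
          Finset.sum_le_sum fun c' _ => hμ2 c'
        _ = ENNReal.ofReal (∑ c' ∈ T, ∑ y ∈ P.filter (fun y => cell (i + 1) y = c'), μ y) :=
          (ENNReal.ofReal_sum_of_nonneg fun c' _ => Finset.sum_nonneg fun y _ => hμ0 y).symm
        _ = ENNReal.ofReal (M c) := by
          congr 1
          show _ = ∑ y ∈ P.filter (fun y => cell i y = c), μ y
          rw [← Finset.sum_fiberwise_of_maps_to (s := P.filter (fun y => cell i y = c)) (t := T)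
            (g := cell (i + 1)) (fun y hy => Finset.mem_image_of_mem _ hy)]
          refine Finset.sum_congr rfl fun c' hc' => ?_
          refine Finset.sum_congr ?_ fun _ _ => rfl
          ext y
          simp only [Finset.mem_filter]
          constructor
          · rintro ⟨hy, hyc⟩
            refine ⟨⟨hy, ?_⟩, hyc⟩
            obtain ⟨y', hy', hy'c⟩ := Finset.mem_image.mp hc'
            rw [← (Finset.mem_filter.mp hy').2]
            exact cell_anc (Nat.le_succ i) (hyc.trans hy'c.symm)
          · rintro ⟨⟨hy, _⟩, h⟩; exact ⟨hy, h⟩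
    refine ⟨fun y => μ y * g (cell i y), fun y => mul_nonneg (hμ0 y) (hg0 _), ?_, ?_⟩
    · intro i' hi' hi'J c
      rcases eq_or_lt_of_le hi' with rfl | hlt
      · rw [hsum, ← hw]
        rcases eq_or_lt_of_le (hM0 c) with h0 | h0
        · rw [← h0, zero_mul]; exact hw0.le
        · calc M c * g c ≤ M c * (w / M c) := by gcongr; exact min_le_right _ _
            _ = w := by field_simp
      · refine le_trans ?_ (hμ1 i' hlt hi'J c)
        refine Finset.sum_le_sum fun y _ => ?_
        exact mul_le_of_le_one_right (hμ0 y) (hg1 _)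
    · intro c
      rw [hsum]
      rcases le_total 1 (w / M c) with h | h
      · have : g c = 1 := min_eq_left h
        rw [this, mul_one]; exact hcont c
      · rcases eq_or_lt_of_le (hM0 c) with h0 | h0
        · refine (hcont c).trans ?_
          rw [← h0]; simp
        · have : g c = w / M c := min_eq_right h
          rw [this, mul_div_cancel₀ _ h0.ne']
          exact ((cont σ).mono Set.inter_subset_right).trans (cont_cub σ (i, c))

theorem frostman {n : ℕ} (σ : ℝ) (b : Fin n → ℤ) (Y : Set (Fin n → ℝ)) (hY : Y ⊆ cub (0, b)) (J : ℕ) :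
    ∃ P : Finset (Fin n → ℝ), (∀ y ∈ P, y ∈ Y) ∧ ∃ μ : (Fin n → ℝ) → ℝ, (∀ y, 0 ≤ μ y) ∧
      cont σ Y ≤ ENNReal.ofReal (∑ y ∈ P, μ y) ∧ ∑ y ∈ P, μ y ≤ 1 ∧
      ∀ i ≤ J, ∀ c, ∑ y ∈ P.filter (fun y => cell i y = c), μ y ≤ (2 : ℝ) ^ (-(i : ℝ) * σ) := by
  classical
  obtain ⟨X, hX1, hX2⟩ := cells_sel J b Y hY
  choose! r hr1 hr2 using hX2
  set P := X.image r with hP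
  have hPY : ∀ y ∈ P, y ∈ Y := by
    intro y hy
    obtain ⟨c, hc, rfl⟩ := Finset.mem_image.mp hy
    exact hr1 c hc
  obtain ⟨μ, h0, h1, h2⟩ := frostman_aux σ Y J P
    (fun y hy => ⟨r (cell J y), Finset.mem_image_of_mem _ (hX1 y hy), hr2 _ (hX1 y hy)⟩)
    (by
      intro p hp p' hp' h
      obtain ⟨c, hc, rfl⟩ := Finset.mem_image.mp hp
      obtain ⟨c', hc', rfl⟩ := Finset.mem_image.mp hp'
      rw [hr2 c hc, hr2 c' hc'] at h
      rw [h]) J le_rfl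
  rw [Nat.sub_self] at h1 h2
  have hall : P.filter (fun y => cell 0 y = b) = P := by
    rw [Finset.filter_eq_self]
    intro y hy
    exact (mem_cub_iff 0 b y).mp (hY (hPY y hy))
  refine ⟨P, hPY, μ, h0, ?_, ?_, fun i hi c => h1 i (Nat.zero_le _) hi c⟩
  · have := h2 b
    rwa [hall, Set.inter_eq_left.mpr hY] at this
  · have := h1 0 le_rfl (Nat.zero_le _) b
    rw [hall] at this
    simpa using this

/-- ball condition -/
theorem frostman_ball {n : ℕ} {σ : ℝ} (hσ : 0 < σ) (J : ℕ) (P : Finset (Fin n → ℝ)) (μ : (Fin n → ℝ) → ℝ)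
    (h0 : ∀ y, 0 ≤ μ y) (h1 : ∑ y ∈ P, μ y ≤ 1)
    (h2 : ∀ i ≤ J, ∀ c, ∑ y ∈ P.filter (fun y => cell i y = c), μ y ≤ (2 : ℝ) ^ (-(i : ℝ) * σ))
    (x : Fin n → ℝ) (ρ : ℝ) (hρ : ((2 : ℝ) ^ J)⁻¹ ≤ ρ) (T : Finset (Fin n → ℝ)) (hTP : T ⊆ P)
    (hT : ∀ y ∈ T, ∀ i, |x i - y i| ≤ ρ) :
    ∑ y ∈ T, μ y ≤ 3 ^ n * 2 ^ σ * ρ ^ σ := by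
  classical
  have hρ0 : 0 < ρ := lt_of_lt_of_le (by positivity) hρ
  rcases le_total 1 ρ with h | h
  · calc ∑ y ∈ T, μ y ≤ ∑ y ∈ P, μ y := Finset.sum_le_sum_of_subset_of_nonneg hTP fun y _ _ => h0 y
      _ ≤ 1 := h1
      _ = 1 * 1 * 1 := by norm_num
      _ ≤ 3 ^ n * 2 ^ σ * ρ ^ σ := by
        gcongr
        · exact one_le_pow₀ (by norm_num)
        · exact Real.one_le_rpow (by norm_num) hσ.le
        · exact Real.one_le_rpow h hσ.le
  · obtain ⟨i, hi1, hi2⟩ := exists_nat_pow_near_of_lt_one hρ0 h (show (0 : ℝ) < 1 / 2 by norm_num) (by norm_num)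
    rw [one_div, inv_pow] at hi1 hi2
    have hiJ : i ≤ J := by
      have : ((2 : ℝ) ^ J)⁻¹ ≤ ((2 : ℝ) ^ i)⁻¹ := hρ.trans hi2
      rw [inv_le_inv₀ (by positivity) (by positivity)] at this
      exact (pow_le_pow_iff_right₀ (by norm_num : (1 : ℝ) < 2)).mp this
    calc ∑ y ∈ T, μ y = ∑ c ∈ nbr (cell i x), ∑ y ∈ T.filter (fun y => cell i y = c), μ y :=
          (Finset.sum_fiberwise_of_maps_to (fun y hy =>
            cell_nbr i x y (fun k => (hT y hy k).trans hi2)) _).symm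
      _ ≤ ∑ c ∈ nbr (cell i x), (2 : ℝ) ^ (-(i : ℝ) * σ) := by
          refine Finset.sum_le_sum fun c _ => le_trans ?_ (h2 i hiJ c)
          exact Finset.sum_le_sum_of_subset_of_nonneg (Finset.filter_subset_filter _ hTP) fun y _ _ => h0 y
      _ = 3 ^ n * (2 : ℝ) ^ (-(i : ℝ) * σ) := by
          rw [Finset.sum_const, nbr_card, nsmul_eq_mul]; push_cast; rfl
      _ ≤ 3 ^ n * 2 ^ σ * ρ ^ σ := by
          rw [mul_assoc]
          gcongr
          rw [← Real.mul_rpow (by norm_num) hρ0.le, Real.rpow_mul (by norm_num)]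
          gcongr
          rw [Real.rpow_neg (by norm_num), Real.rpow_natCast]
          rw [pow_succ, mul_inv] at hi1
          linarith

/-! ### Bilinear to quadratic -/

open Classical in
/-- real-valued indicator of a proposition -/
def ind (p : Prop) : ℝ := if p then 1 else 0

theorem ind_nonneg (p : Prop) : 0 ≤ ind p := by unfold ind; split_ifs <;> norm_num
theorem ind_le_one (p : Prop) : ind p ≤ 1 := by unfold ind; split_ifs <;> norm_num
theorem ind_mono {p q : Prop} (h : p → q) : ind p ≤ ind q := by
  by_cases hp : p
  · have hq := h hp
    rw [ind, ind, if_pos hp, if_pos hq]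
  · rw [ind, if_neg hp]
    exact ind_nonneg q
theorem ind_true {p : Prop} (h : p) : ind p = 1 := if_pos h
theorem ind_false {p : Prop} (h : ¬ p) : ind p = 0 := if_neg h
theorem ind_congr {p q : Prop} (h : p ↔ q) : ind p = ind q := by rw [propext h]

theorem cell_split {ι ι' γ : Type*} (A : Finset ι) (B : Finset ι') (a : ι → ℝ) (b : ι' → ℝ)
    (κ : ι → γ) (κ' : ι' → γ) (T : Finset γ) (hT : ∀ x ∈ A, κ x ∈ T) :
    ∑ x ∈ A, ∑ x' ∈ B, a x * b x' * ind (κ x = κ' x') =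
      ∑ c ∈ T, (∑ x ∈ A, a x * ind (κ x = c)) * (∑ x' ∈ B, b x' * ind (κ' x' = c)) := by
  classical
  simp_rw [Finset.sum_mul_sum]
  rw [Finset.sum_comm (s := T)]
  refine Finset.sum_congr rfl fun x hx => ?_
  rw [Finset.sum_comm (s := T)]
  refine Finset.sum_congr rfl fun x' _ => ?_
  rw [Finset.sum_eq_single (κ x)]
  · rw [ind_true (rfl : κ x = κ x), mul_one, mul_assoc]
    congr 2
    exact ind_congr eq_comm
  · intro c _ hc
    rw [ind_false (fun h => hc h.symm)]; ring
  · intro h; exact absurd (hT x hx) h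

theorem same_pair {ι ι' γ : Type*} (A : Finset ι) (B : Finset ι') (a : ι → ℝ) (b : ι' → ℝ)
    (κ : ι → γ) (κ' : ι' → γ) :
    ∑ x ∈ A, ∑ x' ∈ B, a x * b x' * ind (κ x = κ' x') ≤
      1 / 2 * (∑ x ∈ A, ∑ x' ∈ A, a x * a x' * ind (κ x = κ x') +
        ∑ x ∈ B, ∑ x' ∈ B, b x * b x' * ind (κ' x = κ' x')) := by
  classical
  set T := A.image κ ∪ B.image κ' with hT
  have hA : ∀ x ∈ A, κ x ∈ T := fun x hx => Finset.mem_union_left _ (Finset.mem_image_of_mem _ hx)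
  have hB : ∀ x ∈ B, κ' x ∈ T := fun x hx => Finset.mem_union_right _ (Finset.mem_image_of_mem _ hx)
  rw [cell_split A B a b κ κ' T hA, cell_split A A a a κ κ T hA, cell_split B B b b κ' κ' T hB,
    ← Finset.sum_add_distrib, Finset.mul_sum]
  refine Finset.sum_le_sum fun c _ => ?_
  nlinarith [sq_nonneg ((∑ x ∈ A, a x * ind (κ x = c)) - (∑ x' ∈ B, b x' * ind (κ' x' = c)))]

theorem nbr_pair {n : ℕ} {ι ι' : Type*} (A : Finset ι) (B : Finset ι') (a : ι → ℝ) (b : ι' → ℝ)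
    (ha : ∀ x, 0 ≤ a x) (hb : ∀ x, 0 ≤ b x)
    (κ : ι → (Fin n → ℤ)) (κ' : ι' → (Fin n → ℤ)) :
    ∑ x ∈ A, ∑ x' ∈ B, a x * b x' * ind (κ' x' ∈ nbr (κ x)) ≤
      3 ^ n / 2 * (∑ x ∈ A, ∑ x' ∈ A, a x * a x' * ind (κ x = κ x') +
        ∑ x ∈ B, ∑ x' ∈ B, b x * b x' * ind (κ' x = κ' x')) := by
  classical
  have h1 : ∀ (c c' : Fin n → ℤ), ind (c' ∈ nbr c) ≤ ∑ e ∈ nbr (0 : Fin n → ℤ), ind (c + e = c') := by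
    intro c c'
    by_cases h : c' ∈ nbr c
    · rw [ind_true h]
      have he : c' - c ∈ nbr (0 : Fin n → ℤ) := by
        rw [mem_nbr] at h ⊢
        intro i
        have := h i
        simp only [Pi.zero_apply, Pi.sub_apply]
        lia
      refine le_trans (le_of_eq ?_) (Finset.single_le_sum (fun e _ => ind_nonneg (c + e = c')) he)
      rw [ind_true]; simp
    · rw [ind_false h]
      exact Finset.sum_nonneg fun e _ => ind_nonneg _
  calc ∑ x ∈ A, ∑ x' ∈ B, a x * b x' * ind (κ' x' ∈ nbr (κ x))
      ≤ ∑ x ∈ A, ∑ x' ∈ B, a x * b x' * ∑ e ∈ nbr (0 : Fin n → ℤ), ind (κ x + e = κ' x') := by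
        refine Finset.sum_le_sum fun x _ => Finset.sum_le_sum fun x' _ => ?_
        exact mul_le_mul_of_nonneg_left (h1 _ _) (mul_nonneg (ha x) (hb x'))
    _ = ∑ e ∈ nbr (0 : Fin n → ℤ), ∑ x ∈ A, ∑ x' ∈ B, a x * b x' * ind (κ x + e = κ' x') := by
        simp_rw [Finset.mul_sum]
        rw [Finset.sum_comm (s := nbr 0)]
        refine Finset.sum_congr rfl fun x _ => ?_
        rw [Finset.sum_comm (s := nbr 0)]
    _ ≤ ∑ e ∈ nbr (0 : Fin n → ℤ), 1 / 2 * (∑ x ∈ A, ∑ x' ∈ A, a x * a x' * ind (κ x = κ x') +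
        ∑ x ∈ B, ∑ x' ∈ B, b x * b x' * ind (κ' x = κ' x')) := by
        refine Finset.sum_le_sum fun e _ => ?_
        refine (same_pair A B a b (fun x => κ x + e) κ').trans (le_of_eq ?_)
        have : ∀ x x', ind (κ x + e = κ x' + e) = ind (κ x = κ x') := fun _ _ => ind_congr (by simp)
        simp only [this]
    _ = _ := by
        rw [Finset.sum_const, nbr_card, nsmul_eq_mul]; push_cast; ring

/-- closeness relation between two (rescaled) lines at integer time `k` -/
def near {n : ℕ} (Q : ℝ) (k : ℤ) (y y' u : Fin n → ℝ) : Prop :=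
  ∀ i, |Q * (y i - y' i) + k * u i| ≤ 2

theorem near_swap {n : ℕ} (Q : ℝ) (k : ℤ) (y y' u : Fin n → ℝ) :
    near Q k y y' u ↔ near Q k y' y (-u) := by
  unfold near
  refine forall_congr' fun i => ?_
  rw [← abs_neg]
  have : -(Q * (y i - y' i) + k * u i) = Q * (y' i - y i) + k * (-u) i := by
    simp only [Pi.neg_apply]; ring
  rw [this]

/-- the number of pairs with given difference -/
theorem diff_sum (N : ℕ) (g : ℤ → ℝ) (hg : ∀ k, 0 ≤ g k) :
    ∑ l ∈ Finset.range (N + 1), ∑ l' ∈ Finset.range (N + 1), g ((l : ℤ) - l') ≤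
      (N + 1) * ∑ k ∈ Finset.Icc (-(N : ℤ)) N, g k := by
  calc ∑ l ∈ Finset.range (N + 1), ∑ l' ∈ Finset.range (N + 1), g ((l : ℤ) - l')
      ≤ ∑ l ∈ Finset.range (N + 1), ∑ k ∈ Finset.Icc (-(N : ℤ)) N, g k := by
        refine Finset.sum_le_sum fun l hl => ?_
        rw [Finset.mem_range] at hl
        have hinj : Set.InjOn (fun l' : ℕ => (l : ℤ) - l') (Finset.range (N + 1) : Set ℕ) := by
          intro a _ b _ h
          simp only at h
          lia
        rw [← Finset.sum_image (f := g) (g := fun l' : ℕ => (l : ℤ) - l') hinj]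
        apply Finset.sum_le_sum_of_subset_of_nonneg
        · intro k hk
          obtain ⟨l', hl', rfl⟩ := Finset.mem_image.mp hk
          rw [Finset.mem_range] at hl'
          rw [Finset.mem_Icc]; lia
        · intro k _ _; exact hg k
    _ = _ := by rw [Finset.sum_const, Finset.card_range, nsmul_eq_mul]; push_cast; rfl

theorem bil_quad {n : ℕ} (q : ℕ) (hq : 1 ≤ q) (P P' : Finset (Fin n → ℝ)) (μ μ' : (Fin n → ℝ) → ℝ)
    (h0 : ∀ y, 0 ≤ μ y) (h0' : ∀ y, 0 ≤ μ' y) (u : Fin n → ℝ) :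
    ∑ k ∈ Finset.range (q + 1), ∑ y ∈ P, ∑ y' ∈ P', μ y * μ' y' * ind (near q k y y' u) ≤
      2 * 3 ^ n * (∑ k ∈ Finset.Icc (-(2 * q : ℕ) : ℤ) (2 * q : ℕ), ∑ y ∈ P, ∑ y' ∈ P, μ y * μ y' * ind (near q k y y' u) +
        ∑ k ∈ Finset.Icc (-(2 * q : ℕ) : ℤ) (2 * q : ℕ), ∑ y ∈ P', ∑ y' ∈ P', μ' y * μ' y' * ind (near q k y y' (-u))) := by
  classical
  set κ : (Fin n → ℝ) × ℕ → (Fin n → ℤ) := fun p i => ⌊((q : ℝ) * p.1 i + p.2 * u i) / 2⌋ with hκ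
  set R := Finset.range (2 * q + 1) with hR
  -- quadratic part
  have hquad : ∀ (P : Finset (Fin n → ℝ)) (μ : (Fin n → ℝ) → ℝ), (∀ y, 0 ≤ μ y) →
      ∑ p ∈ P ×ˢ R, ∑ p' ∈ P ×ˢ R, μ p.1 * μ p'.1 * ind (κ p = κ p') ≤
        (2 * q + 1) * ∑ k ∈ Finset.Icc (-(2 * q : ℕ) : ℤ) (2 * q : ℕ), ∑ y ∈ P, ∑ y' ∈ P, μ y * μ y' * ind (near q k y y' u) := by
    intro P μ h0
    set g : ℤ → ℝ := fun k => ∑ y ∈ P, ∑ y' ∈ P, μ y * μ y' * ind (near q k y y' u) with hg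
    have hg0 : ∀ k, 0 ≤ g k := fun k => Finset.sum_nonneg fun y _ => Finset.sum_nonneg fun y' _ =>
      mul_nonneg (mul_nonneg (h0 y) (h0 y')) (ind_nonneg _)
    have := diff_sum (2 * q) g hg0
    refine le_trans ?_ (this.trans (le_of_eq (by push_cast; rfl)))
    rw [Finset.sum_product_right]
    refine Finset.sum_le_sum fun l _ => ?_
    simp_rw [Finset.sum_product_right]
    rw [Finset.sum_comm]
    refine Finset.sum_le_sum fun l' _ => ?_
    refine Finset.sum_le_sum fun y _ => Finset.sum_le_sum fun y' _ => ?_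
    apply mul_le_mul_of_nonneg_left _ (mul_nonneg (h0 y) (h0 y'))
    apply ind_mono
    intro h i
    have h1 := Int.abs_sub_lt_one_of_floor_eq_floor (congrFun h i)
    simp only at h1
    rw [← sub_div, abs_div, abs_of_pos (by norm_num : (0 : ℝ) < 2), div_lt_one (by norm_num)] at h1
    refine le_trans (le_of_eq ?_) h1.le
    congr 1
    push_cast; ring
  have hb := nbr_pair (P ×ˢ R) (P' ×ˢ R) (fun p => μ p.1) (fun p => μ' p.1) (fun p => h0 _) (fun p => h0' _) κ κ
  have hlow : (q : ℝ) * ∑ k ∈ Finset.range (q + 1), ∑ y ∈ P, ∑ y' ∈ P', μ y * μ' y' * ind (near q k y y' u) ≤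
      ∑ p ∈ P ×ˢ R, ∑ p' ∈ P' ×ˢ R, μ p.1 * μ' p'.1 * ind (κ p' ∈ nbr (κ p)) := by
    have e1 : ∑ p ∈ P ×ˢ R, ∑ p' ∈ P' ×ˢ R, μ p.1 * μ' p'.1 * ind (κ p' ∈ nbr (κ p)) =
        ∑ l ∈ R, ∑ l' ∈ R, ∑ y ∈ P, ∑ y' ∈ P', μ y * μ' y' * ind (κ (y', l) ∈ nbr (κ (y, l'))) := by
      rw [Finset.sum_product_right]
      rw [Finset.sum_comm (s := R) (t := R)]
      refine Finset.sum_congr rfl fun l' _ => ?_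
      rw [Finset.sum_comm (s := R)]
      refine Finset.sum_congr rfl fun y _ => ?_
      rw [Finset.sum_product_right]
    rw [e1]
    have hpos : ∀ l l' : ℕ, 0 ≤ ∑ y ∈ P, ∑ y' ∈ P', μ y * μ' y' * ind (κ (y', l) ∈ nbr (κ (y, l'))) :=
      fun l l' => Finset.sum_nonneg fun y _ => Finset.sum_nonneg fun y' _ =>
        mul_nonneg (mul_nonneg (h0 y) (h0' y')) (ind_nonneg _)
    calc (q : ℝ) * ∑ k ∈ Finset.range (q + 1), ∑ y ∈ P, ∑ y' ∈ P', μ y * μ' y' * ind (near q k y y' u)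
        = ∑ l ∈ Finset.range q, ∑ k ∈ Finset.range (q + 1), ∑ y ∈ P, ∑ y' ∈ P', μ y * μ' y' * ind (near q k y y' u) := by
          rw [Finset.sum_const, Finset.card_range, nsmul_eq_mul]
      _ ≤ ∑ l ∈ Finset.range q, ∑ l' ∈ R, ∑ y ∈ P, ∑ y' ∈ P', μ y * μ' y' * ind (κ (y', l) ∈ nbr (κ (y, l'))) := by
          refine Finset.sum_le_sum fun l hl => ?_
          rw [Finset.mem_range] at hl
          calc ∑ k ∈ Finset.range (q + 1), ∑ y ∈ P, ∑ y' ∈ P', μ y * μ' y' * ind (near q k y y' u)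
              ≤ ∑ k ∈ Finset.range (q + 1), ∑ y ∈ P, ∑ y' ∈ P', μ y * μ' y' * ind (κ (y', l) ∈ nbr (κ (y, k + l))) := by
                refine Finset.sum_le_sum fun k _ => Finset.sum_le_sum fun y _ => Finset.sum_le_sum fun y' _ => ?_
                apply mul_le_mul_of_nonneg_left _ (mul_nonneg (h0 y) (h0' y'))
                apply ind_mono
                intro h
                rw [mem_nbr]
                intro i
                apply floor_near
                rw [← sub_div, abs_div, abs_of_pos (by norm_num : (0 : ℝ) < 2), div_le_one (by norm_num)]
                refine le_trans (le_of_eq ?_) (h i)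
                congr 1
                push_cast; ring
            _ = ∑ l' ∈ (Finset.range (q + 1)).image (fun k => k + l), ∑ y ∈ P, ∑ y' ∈ P', μ y * μ' y' * ind (κ (y', l) ∈ nbr (κ (y, l'))) := by
                rw [Finset.sum_image (fun a _ b _ h => by simpa using h)]
            _ ≤ _ := by
                apply Finset.sum_le_sum_of_subset_of_nonneg
                · intro k hk
                  obtain ⟨k', hk', rfl⟩ := Finset.mem_image.mp hk
                  rw [Finset.mem_range] at hk'
                  rw [hR, Finset.mem_range]; lia
                · intro l' _ _; exact hpos l l'
      _ ≤ _ := by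
          apply Finset.sum_le_sum_of_subset_of_nonneg
          · intro k hk
            rw [Finset.mem_range] at hk
            rw [hR, Finset.mem_range]; lia
          · intro l _ _; exact Finset.sum_nonneg fun l' _ => hpos l l'
  have h2 := hquad P μ h0
  have h3 := hquad P' μ' h0'
  have e3 : ∑ k ∈ Finset.Icc (-(2 * q : ℕ) : ℤ) (2 * q : ℕ), ∑ y ∈ P', ∑ y' ∈ P', μ' y * μ' y' * ind (near q k y y' u) =
      ∑ k ∈ Finset.Icc (-(2 * q : ℕ) : ℤ) (2 * q : ℕ), ∑ y ∈ P', ∑ y' ∈ P', μ' y * μ' y' * ind (near q k y y' (-u)) := by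
    refine Finset.sum_congr rfl fun k _ => ?_
    rw [Finset.sum_comm]
    refine Finset.sum_congr rfl fun y _ => Finset.sum_congr rfl fun y' _ => ?_
    rw [mul_comm (μ' y'), ind_congr (near_swap _ _ _ _ _)]
  rw [e3] at h3
  set K1 := ∑ k ∈ Finset.Icc (-(2 * q : ℕ) : ℤ) (2 * q : ℕ), ∑ y ∈ P, ∑ y' ∈ P, μ y * μ y' * ind (near q k y y' u) with hK1
  set K2 := ∑ k ∈ Finset.Icc (-(2 * q : ℕ) : ℤ) (2 * q : ℕ), ∑ y ∈ P', ∑ y' ∈ P', μ' y * μ' y' * ind (near q k y y' (-u)) with hK2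
  have hK10 : 0 ≤ K1 := Finset.sum_nonneg fun k _ => Finset.sum_nonneg fun y _ => Finset.sum_nonneg fun y' _ =>
    mul_nonneg (mul_nonneg (h0 y) (h0 y')) (ind_nonneg _)
  have hK20 : 0 ≤ K2 := Finset.sum_nonneg fun k _ => Finset.sum_nonneg fun y _ => Finset.sum_nonneg fun y' _ =>
    mul_nonneg (mul_nonneg (h0' y) (h0' y')) (ind_nonneg _)
  have hqr : (1 : ℝ) ≤ q := by exact_mod_cast hq
  have hq0 : (0 : ℝ) < q := by linarith
  refine le_of_mul_le_mul_left ?_ hq0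
  calc _ ≤ _ := hlow
    _ ≤ _ := hb
    _ ≤ 3 ^ n / 2 * ((2 * q + 1) * K1 + (2 * q + 1) * K2) := by gcongr
    _ ≤ 3 ^ n / 2 * ((4 * q) * K1 + (4 * q) * K2) := by gcongr <;> linarith
    _ = _ := by ring

/-! ### The kernel estimate -/

theorem kern_count {n : ℕ} (J : ℕ) (V : Finset (Fin n → ℤ)) (w : (Fin n → ℤ) → (Fin n → ℝ))
    (hw : ∀ d ∈ V, cell J (w d) = d ∧ ∀ i, w d i ∈ Set.Ico (0 : ℝ) 1) (v : Fin n → ℝ)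
    (k : ℤ) (κ : ℝ) (hκ : κ = max |(k : ℝ)| 1) (hκ2 : κ ≤ 2 * 2 ^ J) (y y' : Fin n → ℝ) :
    ∑ d ∈ V, ind (near (2 ^ J) k y y' (v - w d)) ≤ (8 * 2 ^ J / κ) ^ n := by
  classical
  have hκ1 : 1 ≤ κ := hκ ▸ le_max_right _ _
  have hκ0 : 0 < κ := by linarith
  have hQ : (0 : ℝ) < 2 ^ J := by positivity
  set W := V.filter (fun d => near (2 ^ J) k y y' (v - w d)) with hW
  have e1 : ∑ d ∈ V, ind (near (2 ^ J) k y y' (v - w d)) = W.card := by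
    rw [hW, Finset.card_filter]; push_cast
    refine Finset.sum_congr rfl fun d _ => ?_
    unfold ind; congr
  rw [e1]
  set D : ℝ := 4 * 2 ^ J / κ + 1 with hD
  have hclose : ∀ d ∈ W, ∀ d' ∈ W, ∀ i, w d i - w d' i ≤ 4 / κ := by
    intro d hd d' hd' i
    rw [hW, Finset.mem_filter] at hd hd'
    have a1 := (hw d hd.1).2 i
    have a2 := (hw d' hd'.1).2 i
    rw [le_div_iff₀ hκ0]
    rcases le_total |(k : ℝ)| 1 with hk | hk
    · rw [hκ, max_eq_right hk]
      linarith [a1.2, a2.1]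
    · rw [hκ, max_eq_left hk]
      have b1 := hd.2 i
      have b2 := hd'.2 i
      simp only [Pi.sub_apply] at b1 b2
      calc (w d i - w d' i) * |(k : ℝ)| ≤ |w d i - w d' i| * |(k : ℝ)| := by
            gcongr; exact le_abs_self _
        _ = |((2 : ℝ) ^ J * (y i - y' i) + k * (v i - w d' i)) - (2 ^ J * (y i - y' i) + k * (v i - w d i))| := by
            rw [← abs_mul]; congr 1; ring
        _ ≤ 2 + 2 := (abs_sub _ _).trans (add_le_add b2 b1)
        _ = 4 := by norm_num
  have hlc := line_count (n := n) (W.image (fun d => ((0 : Fin n → ℤ), d))) D 0 (by positivity) le_rfl ?_ ?_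
  · rw [Finset.card_image_of_injective _ (fun a b h => congrArg Prod.snd h)] at hlc
    refine hlc.trans ?_
    simp only [zero_add, one_pow, mul_one]
    have : 2 ≤ 4 * 2 ^ J / κ := by rw [le_div_iff₀ hκ0]; linarith
    have h8 : 8 * (2 : ℝ) ^ J / κ = 4 * 2 ^ J / κ + 4 * 2 ^ J / κ := by ring
    rw [h8]
    apply pow_le_pow_left₀ (by positivity)
    rw [hD]; linarith
  · intro a ha b hb i
    obtain ⟨d, hd, rfl⟩ := Finset.mem_image.mp ha
    obtain ⟨d', hd', rfl⟩ := Finset.mem_image.mp hb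
    have h1 := hclose d hd d' hd' i
    have h2 := congrFun (hw d (Finset.mem_filter.mp hd).1).1 i
    have h3 := congrFun (hw d' (Finset.mem_filter.mp hd').1).1 i
    simp only [cell] at h2 h3
    rw [Int.floor_eq_iff] at h2 h3
    simp only
    have : (2 : ℝ) ^ J * (w d i - w d' i) ≤ 2 ^ J * (4 / κ) := by gcongr
    have e : (2 : ℝ) ^ J * (4 / κ) = 4 * 2 ^ J / κ := by ring
    rw [hD, ← e]
    linarith
  · intro a ha b hb i
    obtain ⟨d, hd, rfl⟩ := Finset.mem_image.mp ha
    obtain ⟨d', hd', rfl⟩ := Finset.mem_image.mp hb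
    simp

theorem kern {n : ℕ} (J : ℕ) (σ : ℝ) (hσ : 0 < σ) (P : Finset (Fin n → ℝ)) (μ : (Fin n → ℝ) → ℝ)
    (h0 : ∀ y, 0 ≤ μ y) (h1 : ∑ y ∈ P, μ y ≤ 1)
    (h2 : ∀ i ≤ J, ∀ c : Fin n → ℤ, ∑ y ∈ P.filter (fun y => cell i y = c), μ y ≤ (2 : ℝ) ^ (-(i : ℝ) * σ))
    (V : Finset (Fin n → ℤ)) (w : (Fin n → ℤ) → (Fin n → ℝ))
    (hw : ∀ d ∈ V, cell J (w d) = d ∧ ∀ i, w d i ∈ Set.Ico (0 : ℝ) 1) (v : Fin n → ℝ)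
    (hv : ∀ i, v i ∈ Set.Ico (0 : ℝ) 1)
    (k : ℤ) (κ : ℝ) (hκ : κ = max |(k : ℝ)| 1) (hκ2 : κ ≤ 2 * 2 ^ J) :
    ∑ d ∈ V, ∑ y ∈ P, ∑ y' ∈ P, μ y * μ y' * ind (near (2 ^ J) k y y' (v - w d)) ≤
      (8 * 2 ^ J / κ) ^ n * (3 ^ n * 2 ^ σ * (3 * κ / 2 ^ J) ^ σ) := by
  classical
  have hκ1 : 1 ≤ κ := hκ ▸ le_max_right _ _
  have hκ0 : 0 < κ := by linarith
  have hQ : (0 : ℝ) < 2 ^ J := by positivity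
  set C : ℝ := (8 * 2 ^ J / κ) ^ n with hC
  have hC0 : 0 ≤ C := by positivity
  set ρ : ℝ := 3 * κ / 2 ^ J with hρ
  have hcount : ∀ y y' : Fin n → ℝ, ∑ d ∈ V, ind (near (2 ^ J) k y y' (v - w d)) ≤
      C * ind (∀ i, |y i - y' i| ≤ ρ) := by
    intro y y'
    by_cases h : ∀ i, |y i - y' i| ≤ ρ
    · rw [ind_true h, mul_one]
      exact kern_count J V w hw v k κ hκ hκ2 y y'
    · rw [ind_false h, mul_zero]
      apply le_of_eq
      apply Finset.sum_eq_zero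
      intro d hd
      apply ind_false
      intro hn
      apply h
      intro i
      have a1 := hn i
      have a2 := (hw d hd).2 i
      have a3 := hv i
      simp only [Pi.sub_apply] at a1
      have a4 : |v i - w d i| ≤ 1 := by rw [abs_le]; constructor <;> linarith [a2.1, a2.2, a3.1, a3.2]
      rw [hρ, le_div_iff₀ hQ]
      have a5 : |(k : ℝ) * (v i - w d i)| ≤ κ := by
        rw [abs_mul]
        calc |(k : ℝ)| * |v i - w d i| ≤ κ * 1 := by
              gcongr; rw [hκ]; exact le_max_left _ _
          _ = κ := mul_one _
      calc |y i - y' i| * 2 ^ J = |(2 ^ J * (y i - y' i) + k * (v i - w d i)) - k * (v i - w d i)| := by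
            rw [add_sub_cancel_right, abs_mul, abs_of_pos hQ, mul_comm]
        _ ≤ 2 + κ := (abs_sub _ _).trans (add_le_add a1 a5)
        _ ≤ 3 * κ := by linarith
  calc ∑ d ∈ V, ∑ y ∈ P, ∑ y' ∈ P, μ y * μ y' * ind (near (2 ^ J) k y y' (v - w d))
      = ∑ y ∈ P, ∑ y' ∈ P, μ y * μ y' * ∑ d ∈ V, ind (near (2 ^ J) k y y' (v - w d)) := by
        simp_rw [Finset.mul_sum]
        rw [Finset.sum_comm (s := V)]
        refine Finset.sum_congr rfl fun y _ => ?_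
        rw [Finset.sum_comm (s := V)]
    _ ≤ ∑ y ∈ P, ∑ y' ∈ P, μ y * μ y' * (C * ind (∀ i, |y i - y' i| ≤ ρ)) := by
        refine Finset.sum_le_sum fun y _ => Finset.sum_le_sum fun y' _ => ?_
        exact mul_le_mul_of_nonneg_left (hcount y y') (mul_nonneg (h0 y) (h0 y'))
    _ = ∑ y ∈ P, (μ y * C) * ∑ y' ∈ P.filter (fun y' => ∀ i, |y i - y' i| ≤ ρ), μ y' := by
        refine Finset.sum_congr rfl fun y _ => ?_
        rw [Finset.mul_sum, Finset.sum_filter]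
        refine Finset.sum_congr rfl fun y' _ => ?_
        unfold ind
        split_ifs <;> ring
    _ ≤ ∑ y ∈ P, (μ y * C) * (3 ^ n * 2 ^ σ * ρ ^ σ) := by
        refine Finset.sum_le_sum fun y _ => ?_
        apply mul_le_mul_of_nonneg_left _ (mul_nonneg (h0 y) hC0)
        apply frostman_ball hσ J P μ h0 h1 h2 y ρ
        · rw [hρ, inv_eq_one_div]; gcongr; linarith
        · exact Finset.filter_subset _ _
        · intro y' hy' i
          exact (Finset.mem_filter.mp hy').2 i
    _ = (∑ y ∈ P, μ y) * (C * (3 ^ n * 2 ^ σ * ρ ^ σ)) := by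
        rw [Finset.sum_mul]; refine Finset.sum_congr rfl fun y _ => by ring
    _ ≤ 1 * (C * (3 ^ n * 2 ^ σ * ρ ^ σ)) := by
        gcongr
    _ = _ := one_mul _

/-- `∑_{κ=1}^N κ^{-γ} ≤ N^{1-γ}/(1-γ)` -/
theorem pow_sum (γ : ℝ) (h0 : 0 ≤ γ) (h1 : γ < 1) (N : ℕ) :
    ∑ j ∈ Finset.range N, ((j : ℝ) + 1) ^ (-γ) ≤ (N : ℝ) ^ (1 - γ) / (1 - γ) := by
  have hg : 0 < 1 - γ := by linarith
  induction N with
  | zero => simp [Real.zero_rpow hg.ne']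
  | succ N ih =>
    rw [Finset.sum_range_succ, le_div_iff₀ hg, add_mul]
    rw [le_div_iff₀ hg] at ih
    have hx : (0 : ℝ) < (N : ℝ) + 1 := by positivity
    -- N^{1-γ} ≤ (N+1)^{1-γ} (1 - (1-γ)/(N+1))
    have hb := rpow_one_add_le_one_add_mul_self (s := -1 / ((N : ℝ) + 1)) (p := 1 - γ) ?_ hg.le (by linarith)
    · have e1 : 1 + -1 / ((N : ℝ) + 1) = N / (N + 1) := by field_simp; ring
      rw [e1, Real.div_rpow (by positivity) hx.le, div_le_iff₀ (by positivity)] at hb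
      have e2 : ((N : ℝ) + 1) ^ (-γ) = ((N : ℝ) + 1) ^ (1 - γ) / (N + 1) := by
        rw [sub_eq_add_neg, Real.rpow_add hx, Real.rpow_one]; field_simp
      push_cast
      rw [e2]
      have e3 : (1 + (1 - γ) * (-1 / ((N : ℝ) + 1))) * ((N : ℝ) + 1) ^ (1 - γ) =
        ((N : ℝ) + 1) ^ (1 - γ) - ((N : ℝ) + 1) ^ (1 - γ) / (N + 1) * (1 - γ) := by ring
      rw [e3] at hb
      linarith
    · rw [le_div_iff₀ hx]; linarith

theorem kap_sum (γ : ℝ) (h0 : 0 ≤ γ) (h1 : γ < 1) (q : ℕ) (hq : 1 ≤ q) :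
    ∑ k ∈ Finset.Icc (-(2 * q : ℕ) : ℤ) (2 * q : ℕ), ((q : ℝ) / max |(k : ℝ)| 1) ^ γ ≤
      (1 + 4 / (1 - γ)) * q := by
  have hg : 0 < 1 - γ := by linarith
  have hq1 : (1 : ℝ) ≤ q := by exact_mod_cast hq
  have hq0 : (0 : ℝ) < q := by linarith
  set f : ℤ → ℝ := fun k => ((q : ℝ) / max |(k : ℝ)| 1) ^ γ with hf
  have hf0 : ∀ k, 0 ≤ f k := fun k => by rw [hf]; positivity
  have hfj : ∀ j : ℕ, f ((j : ℤ) + 1) = (q : ℝ) ^ γ * ((j : ℝ) + 1) ^ (-γ) := by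
    intro j
    simp only [hf]
    push_cast
    have hj : (0 : ℝ) ≤ j := Nat.cast_nonneg _
    rw [abs_of_nonneg (by positivity), max_eq_left (by linarith), Real.div_rpow hq0.le (by positivity),
      Real.rpow_neg (by positivity)]
    rfl
  have hfn : ∀ k, f (-k) = f k := fun k => by simp only [hf]; push_cast; rw [abs_neg]
  have hsub : Finset.Icc (-(2 * q : ℕ) : ℤ) (2 * q : ℕ) ⊆
      {0} ∪ ((Finset.range (2 * q)).image (fun j : ℕ => (j : ℤ) + 1) ∪
        (Finset.range (2 * q)).image (fun j : ℕ => -((j : ℤ) + 1))) := by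
    intro k hk
    rw [Finset.mem_Icc] at hk
    simp only [Finset.mem_union, Finset.mem_singleton, Finset.mem_image, Finset.mem_range]
    rcases lt_trichotomy k 0 with h | h | h
    · right; right; exact ⟨(-k - 1).toNat, by lia, by lia⟩
    · left; exact h
    · right; left; exact ⟨(k - 1).toNat, by lia, by lia⟩
  have hun : ∀ A B : Finset ℤ, ∑ k ∈ A ∪ B, f k ≤ ∑ k ∈ A, f k + ∑ k ∈ B, f k := by
    intro A B
    rw [← Finset.sum_union_inter]
    exact le_add_of_nonneg_right (Finset.sum_nonneg fun k _ => hf0 k)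
  have hS : (q : ℝ) ^ γ * ∑ j ∈ Finset.range (2 * q), ((j : ℝ) + 1) ^ (-γ) ≤ 2 / (1 - γ) * q := by
    have := pow_sum γ h0 h1 (2 * q)
    calc (q : ℝ) ^ γ * ∑ j ∈ Finset.range (2 * q), ((j : ℝ) + 1) ^ (-γ)
        ≤ (q : ℝ) ^ γ * (((2 * q : ℕ) : ℝ) ^ (1 - γ) / (1 - γ)) := by gcongr
      _ = (q : ℝ) ^ γ * (q : ℝ) ^ (1 - γ) * (2 : ℝ) ^ (1 - γ) / (1 - γ) := by
          push_cast; rw [Real.mul_rpow (by norm_num) hq0.le]; ring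
      _ = q * (2 : ℝ) ^ (1 - γ) / (1 - γ) := by
          rw [← Real.rpow_add hq0]; norm_num
      _ ≤ q * (2 : ℝ) ^ (1 : ℝ) / (1 - γ) := by
          gcongr
          · norm_num
          · linarith
      _ = _ := by rw [Real.rpow_one]; ring
  calc ∑ k ∈ Finset.Icc (-(2 * q : ℕ) : ℤ) (2 * q : ℕ), f k
      ≤ _ := Finset.sum_le_sum_of_subset_of_nonneg hsub fun k _ _ => hf0 k
    _ ≤ _ := (hun _ _).trans (add_le_add_right (hun _ _) _)
    _ = f 0 + ((q : ℝ) ^ γ * ∑ j ∈ Finset.range (2 * q), ((j : ℝ) + 1) ^ (-γ) +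
          (q : ℝ) ^ γ * ∑ j ∈ Finset.range (2 * q), ((j : ℝ) + 1) ^ (-γ)) := by
        rw [Finset.sum_singleton, Finset.sum_image (fun a _ b _ h => by simpa using h),
          Finset.sum_image (fun a _ b _ h => by simpa using h)]
        simp only [hfn, hfj, Finset.mul_sum]
    _ ≤ q + (2 / (1 - γ) * q + 2 / (1 - γ) * q) := by
        gcongr
        simp only [hf]
        simp only [Int.cast_zero, abs_zero, zero_le_one, max_eq_right, div_one]
        calc (q : ℝ) ^ γ ≤ (q : ℝ) ^ (1 : ℝ) := Real.rpow_le_rpow_of_exponent_le hq1 h1.le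
          _ = q := Real.rpow_one _
    _ = _ := by ring

/-- total kernel estimate -/
theorem kern_total {n : ℕ} (J : ℕ) (σ : ℝ) (hσ : 0 < σ) (hσ1 : (n : ℝ) - 1 < σ) (hσ2 : σ ≤ n)
    (P : Finset (Fin n → ℝ)) (μ : (Fin n → ℝ) → ℝ)
    (h0 : ∀ y, 0 ≤ μ y) (h1 : ∑ y ∈ P, μ y ≤ 1)
    (h2 : ∀ i ≤ J, ∀ c : Fin n → ℤ, ∑ y ∈ P.filter (fun y => cell i y = c), μ y ≤ (2 : ℝ) ^ (-(i : ℝ) * σ))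
    (V : Finset (Fin n → ℤ)) (w : (Fin n → ℤ) → (Fin n → ℝ))
    (hw : ∀ d ∈ V, cell J (w d) = d ∧ ∀ i, w d i ∈ Set.Ico (0 : ℝ) 1) (v : Fin n → ℝ)
    (hv : ∀ i, v i ∈ Set.Ico (0 : ℝ) 1) :
    ∑ k ∈ Finset.Icc (-(2 * 2 ^ J : ℕ) : ℤ) (2 * 2 ^ J : ℕ),
      ∑ d ∈ V, ∑ y ∈ P, ∑ y' ∈ P, μ y * μ y' * ind (near (2 ^ J) k y y' (v - w d)) ≤
      (8 ^ n * 3 ^ n * 2 ^ σ * 3 ^ σ * (1 + 4 / (1 - (n - σ)))) * 2 ^ J := by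
  have hq : 1 ≤ 2 ^ J := Nat.one_le_two_pow
  have hQ : (0 : ℝ) < 2 ^ J := by positivity
  have hks := kap_sum (n - σ) (by linarith) (by linarith) (2 ^ J) hq
  push_cast at hks
  calc _ ≤ ∑ k ∈ Finset.Icc (-(2 * 2 ^ J : ℕ) : ℤ) (2 * 2 ^ J : ℕ),
      (8 ^ n * 3 ^ n * 2 ^ σ * 3 ^ σ) * ((2 : ℝ) ^ J / max |(k : ℝ)| 1) ^ ((n : ℝ) - σ) := by
        refine Finset.sum_le_sum fun k hk => ?_
        rw [Finset.mem_Icc] at hk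
        have hk' : |(k : ℝ)| ≤ 2 * 2 ^ J := by
          rw [abs_le]; exact ⟨by exact_mod_cast hk.1, by exact_mod_cast hk.2⟩
        have hQ1 : (1 : ℝ) ≤ 2 ^ J := by exact_mod_cast hq
        refine (kern J σ hσ P μ h0 h1 h2 V w hw v hv k _ rfl (max_le hk' (by linarith))).trans (le_of_eq ?_)
        set κ := max |(k : ℝ)| 1 with hκ
        have hκ0 : 0 < κ := lt_of_lt_of_le one_pos (le_max_right _ _)
        have e1 : (8 * (2 : ℝ) ^ J / κ) ^ n = 8 ^ n * ((2 : ℝ) ^ J / κ) ^ (n : ℝ) := by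
          rw [Real.rpow_natCast, ← mul_pow]; congr 1; ring
        have e2 : (3 * κ / (2 : ℝ) ^ J) ^ σ = 3 ^ σ * ((2 : ℝ) ^ J / κ) ^ (-σ) := by
          rw [Real.rpow_neg (by positivity), ← Real.inv_rpow (by positivity), ← Real.mul_rpow (by norm_num) (by positivity)]
          congr 1
          field_simp
        rw [e1, e2, sub_eq_add_neg, Real.rpow_add (by positivity)]
        ring
    _ ≤ _ := by
        rw [← Finset.mul_sum]
        refine (mul_le_mul_of_nonneg_left (le_trans (le_of_eq ?_) hks) (by positivity)).trans (le_of_eq (by ring))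
        push_cast
        rfl

/-! ### The L² lower bound -/

theorem lb_point {n : ℕ} {ι : Type*} (L : Finset ι) (y v : ι → (Fin n → ℝ)) (μ : ι → ℝ)
    (h0 : ∀ x, 0 ≤ μ x) (hv : ∀ x ∈ L, ∀ i, v x i ∈ Set.Ico (0 : ℝ) 1) (J : ℕ)
    (F : Finset (Fin (n + 1) → ℤ)) (θ : ℝ) (hθ : 0 < θ) (t : ℝ) :
    ∑ x ∈ L, μ x * ind (t ∈ Set.Icc (0 : ℝ) 1 ∧ (Fin.cons t (y x + t • v x) : Fin (n + 1) → ℝ) ∈ ⋃ p ∈ F, cub (J, p)) ≤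
      1 / 2 * (θ * ((F.filter (fun p => p 0 = ⌊(2 : ℝ) ^ J * t⌋)).card : ℝ) +
        θ⁻¹ * ∑ x ∈ L, ∑ x' ∈ L, μ x * μ x' * ind (near (2 ^ J) ⌊(2 : ℝ) ^ J * t⌋ (y x) (y x') (v x - v x'))) := by
  classical
  set Q : ℝ := 2 ^ J with hQ
  set k : ℤ := ⌊Q * t⌋ with hk
  set S : ι → Prop := fun x => t ∈ Set.Icc (0 : ℝ) 1 ∧ (Fin.cons t (y x + t • v x) : Fin (n + 1) → ℝ) ∈ ⋃ p ∈ F, cub (J, p) with hS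
  set B := L.filter (fun x => S x) with hB
  set κ : ι → (Fin n → ℤ) := fun x => cell J (y x + t • v x) with hκ
  set T := (F.filter (fun p => p 0 = k)).image (fun p => Fin.tail p) with hT
  have hTc : (T.card : ℝ) ≤ ((F.filter (fun p => p 0 = k)).card : ℝ) := by exact_mod_cast Finset.card_image_le
  have hκT : ∀ x ∈ B, κ x ∈ T := by
    intro x hx
    obtain ⟨hxL, ht, hE⟩ := Finset.mem_filter.mp hx
    simp only [Set.mem_iUnion] at hE
    obtain ⟨p, hp, hpc⟩ := hE
    rw [hT, Finset.mem_image]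
    refine ⟨p, Finset.mem_filter.mpr ⟨hp, ?_⟩, ?_⟩
    · have := hpc 0
      simpa [hQ] using this.symm
    · funext i
      have := hpc (Fin.succ i)
      simp only [Fin.cons_succ] at this
      exact this.symm
  have e0 : ∑ x ∈ L, μ x * ind (S x) = ∑ x ∈ B, μ x := by
    rw [hB, Finset.sum_filter]
    refine Finset.sum_congr rfl fun x _ => ?_
    unfold ind; split_ifs <;> ring
  have e1 : ∑ x ∈ B, μ x = ∑ c ∈ T, ∑ x ∈ B, μ x * ind (κ x = c) := by
    rw [Finset.sum_comm]
    refine Finset.sum_congr rfl fun x hx => ?_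
    rw [Finset.sum_eq_single (κ x)]
    · rw [ind_true rfl, mul_one]
    · intro c _ hc; rw [ind_false (fun h => hc h.symm), mul_zero]
    · intro h; exact absurd (hκT x hx) h
  have e2 := cell_split B B μ μ κ κ T hκT
  have h3 : ∑ x ∈ B, ∑ x' ∈ B, μ x * μ x' * ind (κ x = κ x') ≤
      ∑ x ∈ L, ∑ x' ∈ L, μ x * μ x' * ind (near Q k (y x) (y x') (v x - v x')) := by
    have hnn : ∀ x x', 0 ≤ μ x * μ x' * ind (near Q k (y x) (y x') (v x - v x')) := fun x x' =>
      mul_nonneg (mul_nonneg (h0 x) (h0 x')) (ind_nonneg _)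
    calc ∑ x ∈ B, ∑ x' ∈ B, μ x * μ x' * ind (κ x = κ x')
        ≤ ∑ x ∈ B, ∑ x' ∈ B, μ x * μ x' * ind (near Q k (y x) (y x') (v x - v x')) := by
          refine Finset.sum_le_sum fun x hx => Finset.sum_le_sum fun x' hx' => ?_
          apply mul_le_mul_of_nonneg_left _ (mul_nonneg (h0 x) (h0 x'))
          apply ind_mono
          intro h i
          have h1 := Int.abs_sub_lt_one_of_floor_eq_floor (congrFun h i)
          simp only [Pi.add_apply, Pi.smul_apply, smul_eq_mul, ← hQ] at h1
          have a1 := hv x (Finset.mem_filter.mp hx).1 i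
          have a2 := hv x' (Finset.mem_filter.mp hx').1 i
          have a3 : |v x i - v x' i| ≤ 1 := by
            rw [abs_le]; constructor <;> linarith [a1.1, a1.2, a2.1, a2.2]
          have a4 : |Q * t - k| ≤ 1 := by
            rw [abs_of_nonneg (by linarith [Int.floor_le (Q * t)])]
            linarith [Int.lt_floor_add_one (Q * t)]
          have a5 : |(Q * t - k) * (v x i - v x' i)| ≤ 1 := by
            rw [abs_mul]; nlinarith [abs_nonneg (Q * t - k), abs_nonneg (v x i - v x' i)]
          simp only [Pi.sub_apply]
          calc |Q * (y x i - y x' i) + k * (v x i - v x' i)|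
              = |(Q * (y x i + t * v x i) - Q * (y x' i + t * v x' i)) - (Q * t - k) * (v x i - v x' i)| := by
                congr 1; ring
            _ ≤ 1 + 1 := (abs_sub _ _).trans (add_le_add h1.le a5)
            _ = 2 := by norm_num
      _ ≤ ∑ x ∈ B, ∑ x' ∈ L, μ x * μ x' * ind (near Q k (y x) (y x') (v x - v x')) := by
          refine Finset.sum_le_sum fun x _ => ?_
          exact Finset.sum_le_sum_of_subset_of_nonneg (Finset.filter_subset _ _) fun x' _ _ => hnn x x'
      _ ≤ _ := Finset.sum_le_sum_of_subset_of_nonneg (Finset.filter_subset _ _) fun x _ _ =>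
          Finset.sum_nonneg fun x' _ => hnn x x'
  rw [e2] at h3
  rw [e0, e1]
  calc ∑ c ∈ T, ∑ x ∈ B, μ x * ind (κ x = c)
      ≤ ∑ c ∈ T, 1 / 2 * (θ + θ⁻¹ * ((∑ x ∈ B, μ x * ind (κ x = c)) * ∑ x ∈ B, μ x * ind (κ x = c))) := by
        refine Finset.sum_le_sum fun c _ => ?_
        set g := ∑ x ∈ B, μ x * ind (κ x = c)
        have : 0 ≤ θ⁻¹ * (θ - g) ^ 2 := by positivity
        have e : θ⁻¹ * (θ - g) ^ 2 = θ - 2 * g + θ⁻¹ * (g * g) := by field_simp; ring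
        linarith
    _ = 1 / 2 * (θ * T.card + θ⁻¹ * ∑ c ∈ T, (∑ x ∈ B, μ x * ind (κ x = c)) * ∑ x ∈ B, μ x * ind (κ x = c)) := by
        rw [← Finset.mul_sum, Finset.sum_add_distrib, ← Finset.mul_sum, Finset.sum_const, nsmul_eq_mul]
        ring
    _ ≤ _ := by gcongr

theorem layer_int_real (J : ℕ) (g : ℤ → ℝ) (hg : ∀ k, 0 ≤ g k) :
    ∫⁻ t in Set.Icc (0 : ℝ) 1, ENNReal.ofReal (g ⌊(2 : ℝ) ^ J * t⌋) ≤
      ENNReal.ofReal ((∑ k ∈ Finset.range (2 ^ J + 1), g k) * ((2 : ℝ) ^ J)⁻¹) := by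
  have hm : ∀ k : ℕ, MeasurableSet {t : ℝ | ⌊(2 : ℝ) ^ J * t⌋ = k} := by
    intro p
    have : Measurable (fun t : ℝ => ⌊(2 : ℝ) ^ J * t⌋) := Int.measurable_floor.comp (by fun_prop)
    exact this (measurableSet_singleton _)
  calc _ ≤ ∫⁻ t in Set.Icc (0 : ℝ) 1, ∑ k ∈ Finset.range (2 ^ J + 1),
        Set.indicator {t : ℝ | ⌊(2 : ℝ) ^ J * t⌋ = k} (fun _ => ENNReal.ofReal (g k)) t := by
        apply setLIntegral_mono' measurableSet_Icc
        intro t ht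
        have hQ : (0 : ℝ) < 2 ^ J := by positivity
        have h0 : 0 ≤ ⌊(2 : ℝ) ^ J * t⌋ := Int.floor_nonneg.mpr (mul_nonneg hQ.le ht.1)
        have h1 : ⌊(2 : ℝ) ^ J * t⌋ ≤ 2 ^ J := by
          have : ((⌊(2 : ℝ) ^ J * t⌋ : ℤ) : ℝ) ≤ 2 ^ J := (Int.floor_le _).trans (by nlinarith [ht.2])
          exact_mod_cast this
        obtain ⟨m, hm⟩ := Int.eq_ofNat_of_zero_le h0
        have hmr : m ∈ Finset.range (2 ^ J + 1) := by
          rw [Finset.mem_range, Nat.lt_succ_iff]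
          rw [hm] at h1; exact_mod_cast h1
        refine le_trans (le_of_eq ?_) (Finset.single_le_sum (f := fun k : ℕ =>
          Set.indicator {t : ℝ | ⌊(2 : ℝ) ^ J * t⌋ = k} (fun _ => ENNReal.ofReal (g k)) t) (fun _ _ => zero_le) hmr)
        rw [Set.indicator_of_mem (by exact hm), hm]
    _ ≤ ∫⁻ t : ℝ, ∑ k ∈ Finset.range (2 ^ J + 1),
        Set.indicator {t : ℝ | ⌊(2 : ℝ) ^ J * t⌋ = k} (fun _ => ENNReal.ofReal (g k)) t := setLIntegral_le_lintegral _ _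
    _ = ∑ k ∈ Finset.range (2 ^ J + 1), ENNReal.ofReal (g k) * ENNReal.ofReal ((2 : ℝ) ^ J)⁻¹ := by
        rw [lintegral_finsetSum _ fun p _ => measurable_const.indicator (hm p)]
        refine Finset.sum_congr rfl fun k _ => ?_
        rw [lintegral_indicator_const (hm k)]
        congr 1
        exact floor_vol J k
    _ = _ := by
        rw [← Finset.sum_mul, ← ENNReal.ofReal_sum_of_nonneg (f := fun k : ℕ => g k) fun k _ => hg k]
        exact (ENNReal.ofReal_mul (Finset.sum_nonneg (f := fun k : ℕ => g k) fun k _ => hg k)).symm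

theorem lb_int {n : ℕ} {ι : Type*} (L : Finset ι) (y v : ι → (Fin n → ℝ)) (μ : ι → ℝ)
    (h0 : ∀ x, 0 ≤ μ x) (hv : ∀ x ∈ L, ∀ i, v x i ∈ Set.Ico (0 : ℝ) 1) (J : ℕ)
    (F : Finset (Fin (n + 1) → ℤ)) (θ : ℝ) (hθ : 0 < θ) (lam : ℝ) (hlam : 0 ≤ lam)
    (hS : ∀ x ∈ L, ENNReal.ofReal lam ≤
      volume {t : ℝ | t ∈ Set.Icc (0 : ℝ) 1 ∧ (Fin.cons t (y x + t • v x) : Fin (n + 1) → ℝ) ∈ ⋃ p ∈ F, cub (J, p)}) :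
    lam * ∑ x ∈ L, μ x ≤ 1 / 2 * (θ * F.card + θ⁻¹ * ∑ k ∈ Finset.range (2 ^ J + 1),
      ∑ x ∈ L, ∑ x' ∈ L, μ x * μ x' * ind (near (2 ^ J) k (y x) (y x') (v x - v x'))) * ((2 : ℝ) ^ J)⁻¹ := by
  classical
  have hEm : MeasurableSet (⋃ p ∈ F, cub (J, p) : Set (Fin (n + 1) → ℝ)) :=
    Finset.measurableSet_biUnion _ fun p _ => cub_meas _
  set E : Set (Fin (n + 1) → ℝ) := ⋃ p ∈ F, cub (J, p) with hE
  set f : ℤ → ℝ := fun k => ∑ x ∈ L, ∑ x' ∈ L, μ x * μ x' * ind (near (2 ^ J) k (y x) (y x') (v x - v x')) with hf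
  have hf0 : ∀ k, 0 ≤ f k := fun k => Finset.sum_nonneg fun x _ => Finset.sum_nonneg fun x' _ =>
    mul_nonneg (mul_nonneg (h0 x) (h0 x')) (ind_nonneg _)
  set g : ℤ → ℝ := fun k => 1 / 2 * (θ * ((F.filter (fun p => p 0 = k)).card : ℝ) + θ⁻¹ * f k) with hg
  have hg0 : ∀ k, 0 ≤ g k := by
    intro k
    have := hf0 k
    have h2 : (0 : ℝ) ≤ ((F.filter (fun p => p 0 = k)).card : ℝ) := Nat.cast_nonneg _
    show 0 ≤ 1 / 2 * (θ * ((F.filter (fun p => p 0 = k)).card : ℝ) + θ⁻¹ * f k)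
    have := hθ.le
    positivity
  set S : ι → Set ℝ := fun x => {t : ℝ | t ∈ Set.Icc (0 : ℝ) 1 ∧ (Fin.cons t (y x + t • v x) : Fin (n + 1) → ℝ) ∈ E} with hSd
  have hSm : ∀ x, MeasurableSet (S x) := fun x => shading_meas E hEm _ _
  have key : ENNReal.ofReal (lam * ∑ x ∈ L, μ x) ≤
      ENNReal.ofReal ((∑ k ∈ Finset.range (2 ^ J + 1), g k) * ((2 : ℝ) ^ J)⁻¹) := by
    calc ENNReal.ofReal (lam * ∑ x ∈ L, μ x)
        = ∑ x ∈ L, ENNReal.ofReal (μ x) * ENNReal.ofReal lam := by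
          rw [← Finset.sum_mul, ← ENNReal.ofReal_sum_of_nonneg fun x _ => h0 x, mul_comm lam,
            ENNReal.ofReal_mul (Finset.sum_nonneg fun x _ => h0 x)]
      _ ≤ ∑ x ∈ L, ENNReal.ofReal (μ x) * volume (S x) := by
          refine Finset.sum_le_sum fun x hx => ?_
          gcongr
          exact hS x hx
      _ = ∑ x ∈ L, ∫⁻ t in Set.Icc (0 : ℝ) 1, (S x).indicator (fun _ => ENNReal.ofReal (μ x)) t := by
          refine Finset.sum_congr rfl fun x _ => ?_
          rw [lintegral_indicator_const (hSm x), Measure.restrict_apply (hSm x)]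
          congr 2
          ext t; simp only [hSd, Set.mem_inter_iff, Set.mem_ofPred_eq]; tauto
      _ = ∫⁻ t in Set.Icc (0 : ℝ) 1, ∑ x ∈ L, (S x).indicator (fun _ => ENNReal.ofReal (μ x)) t := by
          rw [lintegral_finsetSum _ fun x _ => measurable_const.indicator (hSm x)]
      _ ≤ ∫⁻ t in Set.Icc (0 : ℝ) 1, ENNReal.ofReal (g ⌊(2 : ℝ) ^ J * t⌋) := by
          apply lintegral_mono
          intro t
          have h1 := lb_point L y v μ h0 hv J F θ hθ t
          have e : ∑ x ∈ L, (S x).indicator (fun _ => ENNReal.ofReal (μ x)) t =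
              ENNReal.ofReal (∑ x ∈ L, μ x * ind (t ∈ S x)) := by
            rw [ENNReal.ofReal_sum_of_nonneg fun x _ => mul_nonneg (h0 x) (ind_nonneg _)]
            refine Finset.sum_congr rfl fun x _ => ?_
            by_cases h : t ∈ S x
            · rw [Set.indicator_of_mem h, ind_true h, mul_one]
            · rw [Set.indicator_of_notMem h, ind_false h, mul_zero, ENNReal.ofReal_zero]
          simp only
          rw [e]
          exact ENNReal.ofReal_le_ofReal h1
      _ ≤ _ := layer_int_real J g hg0
  have h3 := (ENNReal.ofReal_le_ofReal_iff 
    (mul_nonneg (Finset.sum_nonneg (f := fun k : ℕ => g k) (fun k _ => hg0 k)) (by positivity))).mp key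
  refine h3.trans ?_
  apply mul_le_mul_of_nonneg_right _ (by positivity)
  have hF : ∑ k ∈ Finset.range (2 ^ J + 1), ((F.filter (fun p => p 0 = (k : ℤ))).card : ℝ) ≤ F.card := by
    have h4 : ∑ k ∈ Finset.range (2 ^ J + 1), (F.filter (fun p => p 0 = (k : ℤ))).card ≤ F.card := by
      rw [← Finset.card_biUnion]
      · exact Finset.card_le_card (Finset.biUnion_subset.mpr fun k _ => Finset.filter_subset _ _)
      · intro a _ b _ hab
        rw [Function.onFun, Finset.disjoint_left]
        intro p hp hp'
        rw [Finset.mem_filter] at hp hp'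
        apply hab
        have := hp.2.symm.trans hp'.2
        exact_mod_cast this
    exact_mod_cast h4
  calc ∑ k ∈ Finset.range (2 ^ J + 1), g k
      = 1 / 2 * (θ * ∑ k ∈ Finset.range (2 ^ J + 1), ((F.filter (fun p => p 0 = (k : ℤ))).card : ℝ) +
        θ⁻¹ * ∑ k ∈ Finset.range (2 ^ J + 1), f k) := by
        simp only [hg]
        rw [← Finset.mul_sum, Finset.sum_add_distrib, ← Finset.mul_sum, ← Finset.mul_sum]
    _ ≤ _ := by gcongr

theorem lb_core {n : ℕ} (σ : ℝ) (hσ : 0 < σ) (hσ1 : (n : ℝ) - 1 < σ) (hσ2 : σ ≤ n) :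
    ∃ C : ℝ, 0 < C ∧ ∀ (J : ℕ) (F : Finset (Fin (n + 1) → ℤ)) (lam : ℝ) (_ : 0 < lam) (b : Fin n → ℤ)
    (Θ : Set (Fin n → ℝ)) (_ : Θ ⊆ {v | ∀ i, v i ∈ Set.Ico (0 : ℝ) 1})
    (_ : ENNReal.ofReal lam ≤ volume Θ)
    (_ : ∀ v ∈ Θ, ∃ Y' ⊆ cub (0, b), ENNReal.ofReal lam ≤ cont σ Y' ∧ ∀ y ∈ Y', ENNReal.ofReal lam ≤
      volume {t : ℝ | t ∈ Set.Icc (0 : ℝ) 1 ∧ (Fin.cons t (y + t • v) : Fin (n + 1) → ℝ) ∈ ⋃ p ∈ F, cub (J, p)}),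
    lam ^ 5 ≤ C * (F.card * (((2 : ℝ) ^ J) ^ (n + 1))⁻¹) := by
  classical
  set C₁ : ℝ := 8 ^ n * 3 ^ n * 2 ^ σ * 3 ^ σ * (1 + 4 / (1 - (n - σ))) with hC₁
  have hg : 0 < 1 - ((n : ℝ) - σ) := by linarith
  have hC₁0 : 0 < C₁ := by positivity
  set C : ℝ := 4 * 3 ^ n * C₁ with hC
  have hC0 : 0 < C := by positivity
  refine ⟨C, hC0, ?_⟩
  intro J F lam h0 b Θ hΘ hΘv hY
  set Q : ℝ := 2 ^ J with hQ
  have hQ0 : 0 < Q := by positivity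
  obtain ⟨V, hV1, hV2⟩ := cells_sel J 0 Θ (hΘ.trans unit_cub)
  have hVc : lam * Q ^ n ≤ V.card := card_of_le (by positivity) (hΘv.trans (vol_le_cells Θ J V hV1))
  have hsel : ∀ d : Fin n → ℤ, ∃ v : Fin n → ℝ, ∃ P : Finset (Fin n → ℝ), ∃ μ : (Fin n → ℝ) → ℝ,
      (∀ y, 0 ≤ μ y) ∧ (d ∈ V → (cell J v = d ∧ (∀ i, v i ∈ Set.Ico (0 : ℝ) 1) ∧ lam ≤ ∑ y ∈ P, μ y ∧ ∑ y ∈ P, μ y ≤ 1 ∧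
      (∀ i ≤ J, ∀ c, ∑ y ∈ P.filter (fun y => cell i y = c), μ y ≤ (2 : ℝ) ^ (-(i : ℝ) * σ)) ∧
      ∀ y ∈ P, ENNReal.ofReal lam ≤
        volume {t : ℝ | t ∈ Set.Icc (0 : ℝ) 1 ∧ (Fin.cons t (y + t • v) : Fin (n + 1) → ℝ) ∈ ⋃ p ∈ F, cub (J, p)})) := by
    intro d
    by_cases hd : d ∈ V
    · obtain ⟨v, hv, hvd⟩ := hV2 d hd
      obtain ⟨Y', hY'b, hY'c, hY's⟩ := hY v hv
      obtain ⟨P, hP, μ, m0, m1, m2, m3⟩ := frostman σ b Y' hY'b J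
      refine ⟨v, P, μ, m0, fun _ => ⟨hvd, hΘ hv, ?_, m2, m3, fun y hy => hY's y (hP y hy)⟩⟩
      exact (ENNReal.ofReal_le_ofReal_iff (Finset.sum_nonneg fun y _ => m0 y)).mp (hY'c.trans m1)
    · exact ⟨0, ∅, 0, fun _ => le_rfl, fun h => absurd h hd⟩
  choose v P μ hμ0 hsel using hsel
  set L : Finset (Σ _ : (Fin n → ℤ), (Fin n → ℝ)) := V.sigma P with hL
  have hm0 : (0 : ℝ) < V.card := lt_of_lt_of_le (by positivity) hVc
  set m : ℝ := (V.card : ℝ) with hm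
  -- total kernel
  set K : ℤ → (Fin n → ℤ) → (Fin n → ℤ) → ℝ := fun k d d' =>
    ∑ y ∈ P d, ∑ y' ∈ P d, μ d y * μ d y' * ind (near Q k y y' (v d - v d')) with hK
  have hker : ∀ d ∈ V, ∑ k ∈ Finset.Icc (-(2 * 2 ^ J : ℕ) : ℤ) (2 * 2 ^ J : ℕ), ∑ d' ∈ V, K k d d' ≤ C₁ * Q := by
    intro d hd
    obtain ⟨s1, s2, s3, s4, s5, s6⟩ := hsel d hd
    exact kern_total J σ hσ hσ1 hσ2 (P d) (μ d) (hμ0 d) s4 s5 V v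
      (fun d' hd' => ⟨(hsel d' hd').1, (hsel d' hd').2.1⟩) (v d) s2
  have hbil : ∑ k ∈ Finset.range (2 ^ J + 1), ∑ x ∈ L, ∑ x' ∈ L,
      μ x.1 x.2 * μ x'.1 x'.2 * ind (near Q k x.2 x'.2 (v x.1 - v x'.1)) ≤ C * m * Q := by
    calc ∑ k ∈ Finset.range (2 ^ J + 1), ∑ x ∈ L, ∑ x' ∈ L,
          μ x.1 x.2 * μ x'.1 x'.2 * ind (near Q k x.2 x'.2 (v x.1 - v x'.1))
        = ∑ d ∈ V, ∑ d' ∈ V, ∑ k ∈ Finset.range (2 ^ J + 1), ∑ y ∈ P d, ∑ y' ∈ P d',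
          μ d y * μ d' y' * ind (near Q k y y' (v d - v d')) := by
          simp only [hL, Finset.sum_sigma]
          rw [Finset.sum_comm]
          refine Finset.sum_congr rfl fun d _ => ?_
          rw [Finset.sum_comm (s := V)]
          refine Finset.sum_congr rfl fun k _ => ?_
          rw [Finset.sum_comm]
      _ ≤ ∑ d ∈ V, ∑ d' ∈ V, 2 * 3 ^ n * (∑ k ∈ Finset.Icc (-(2 * 2 ^ J : ℕ) : ℤ) (2 * 2 ^ J : ℕ), K k d d' +
            ∑ k ∈ Finset.Icc (-(2 * 2 ^ J : ℕ) : ℤ) (2 * 2 ^ J : ℕ), K k d' d) := by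
          refine Finset.sum_le_sum fun d _ => Finset.sum_le_sum fun d' _ => ?_
          have := bil_quad (2 ^ J) Nat.one_le_two_pow (P d) (P d') (μ d) (μ d') (hμ0 d) (hμ0 d') (v d - v d')
          have hc : ((2 ^ J : ℕ) : ℝ) = Q := by push_cast; rfl
          rw [hc, neg_sub] at this
          exact this
      _ = 4 * 3 ^ n * ∑ d ∈ V, ∑ k ∈ Finset.Icc (-(2 * 2 ^ J : ℕ) : ℤ) (2 * 2 ^ J : ℕ), ∑ d' ∈ V, K k d d' := by
          simp_rw [← Finset.mul_sum, Finset.sum_add_distrib]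
          rw [Finset.sum_comm (s := V) (t := V) (f := fun d d' => ∑ k ∈ Finset.Icc (-(2 * 2 ^ J : ℕ) : ℤ) (2 * 2 ^ J : ℕ), K k d' d)]
          have : ∀ d, ∑ k ∈ Finset.Icc (-(2 * 2 ^ J : ℕ) : ℤ) (2 * 2 ^ J : ℕ), ∑ d' ∈ V, K k d d' =
            ∑ d' ∈ V, ∑ k ∈ Finset.Icc (-(2 * 2 ^ J : ℕ) : ℤ) (2 * 2 ^ J : ℕ), K k d d' := fun d => Finset.sum_comm
          simp_rw [this]
          ring
      _ ≤ 4 * 3 ^ n * ∑ d ∈ V, C₁ * Q := by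
          gcongr with d hd
          exact hker d hd
      _ = _ := by rw [Finset.sum_const, nsmul_eq_mul]; ring
  have hM : m * lam ≤ ∑ x ∈ L, μ x.1 x.2 := by
    rw [hL, Finset.sum_sigma]
    calc m * lam = ∑ d ∈ V, lam := by rw [Finset.sum_const, nsmul_eq_mul]
      _ ≤ _ := Finset.sum_le_sum fun d hd => (hsel d hd).2.2.1
  have hθ : 0 < C / lam ^ 2 := by positivity
  have h_intlb := lb_int L (fun x => x.2) (fun x => v x.1) (fun x => μ x.1 x.2) (fun x => hμ0 _ _)
    (fun x hx => (hsel x.1 (Finset.mem_sigma.mp hx).1).2.1) J F (C / lam ^ 2) hθ lam h0.le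
    (fun x hx => (hsel x.1 (Finset.mem_sigma.mp hx).1).2.2.2.2.2 x.2 (Finset.mem_sigma.mp hx).2)
  rw [← hQ] at h_intlb
  have h5 : lam * (m * lam) ≤ 1 / 2 * (C / lam ^ 2 * F.card + (C / lam ^ 2)⁻¹ * (C * m * Q)) * Q⁻¹ := by
    calc lam * (m * lam) ≤ lam * ∑ x ∈ L, μ x.1 x.2 := by gcongr
      _ ≤ _ := h_intlb
      _ ≤ _ := by gcongr
  have e6 : 1 / 2 * (C / lam ^ 2 * F.card + (C / lam ^ 2)⁻¹ * (C * m * Q)) * Q⁻¹ =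
      1 / 2 * (C * F.card * Q⁻¹ / lam ^ 2) + 1 / 2 * (lam * (m * lam)) := by
    field_simp
  rw [e6] at h5
  have h7 : lam * (m * lam) ≤ C * F.card * Q⁻¹ / lam ^ 2 := by linarith
  rw [le_div_iff₀ (by positivity)] at h7
  have h8 : lam ^ 5 * Q ^ n ≤ C * F.card * Q⁻¹ := by
    calc lam ^ 5 * Q ^ n = lam ^ 4 * (lam * Q ^ n) := by ring
      _ ≤ lam ^ 4 * m := by gcongr
      _ = lam * (m * lam) * lam ^ 2 := by ring
      _ ≤ _ := h7
  calc lam ^ 5 = lam ^ 5 * Q ^ n * (Q ^ n)⁻¹ := by field_simp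
    _ ≤ C * F.card * Q⁻¹ * (Q ^ n)⁻¹ := by gcongr
    _ = _ := by rw [pow_succ]; field_simp

/-! ### Grouping the cubes of a cover -/

theorem grouping {α : Type*} [Countable α] (f : α → ℝ≥0∞) (ε : ℕ → ℝ≥0∞) (hε : ∀ k, ε k ≠ 0)
    (hf : ∑' a, f a ≤ ε 0) (hfin : ∑' a, f a ≠ ∞) :
    ∃ G : ℕ → Finset α, (∀ a, ∃ k, a ∈ G k) ∧ ∀ k, ∑ a ∈ G k, f a ≤ ε k := by
  classical
  obtain ⟨enc, henc⟩ := Countable.exists_injective_nat α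
  have ht := ENNReal.tendsto_tsum_compl_atTop_zero hfin
  have hT : ∀ k, ∃ T : Finset α, ∀ T', T ⊆ T' → ∑' b : { x // x ∉ T' }, f b ≤ ε (k + 1) := by
    intro k
    have := (ENNReal.tendsto_nhds_zero.mp ht) (ε (k + 1)) (pos_iff_ne_zero.mpr (hε _))
    rw [Filter.eventually_atTop] at this
    exact this
  choose T hT using hT
  set U : ℕ → Finset α := fun k => T k ∪ (Finset.range k).preimage enc henc.injOn with hU
  set G : ℕ → Finset α := fun k => match k with
    | 0 => U 0
    | k + 1 => U (k + 1) \ U k with hG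
  refine ⟨G, ?_, ?_⟩
  · intro a
    have hex : ∃ k, a ∈ U k := ⟨enc a + 1, Finset.mem_union_right _ (by simp)⟩
    set k := Nat.find hex with hk
    have h1 : a ∈ U k := Nat.find_spec hex
    refine ⟨k, ?_⟩
    rcases hk' : k with _ | j
    · rw [hk'] at h1; exact h1
    · have h2 : a ∉ U j := Nat.find_min hex (by lia)
      rw [hk'] at h1
      exact Finset.mem_sdiff.mpr ⟨h1, h2⟩
  · intro k
    rcases k with _ | k
    · exact (ENNReal.sum_le_tsum _).trans hf
    · refine le_trans ?_ (hT k (U k) Finset.subset_union_left)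
      show ∑ a ∈ U (k + 1) \ U k, f a ≤ _
      refine le_trans ?_ (le_of_eq (tsum_subtype {x | x ∉ U k} f).symm)
      calc ∑ a ∈ U (k + 1) \ U k, f a = ∑ a ∈ U (k + 1) \ U k, Set.indicator {x | x ∉ U k} f a := by
            refine Finset.sum_congr rfl fun a ha => ?_
            rw [Set.indicator_of_mem]
            exact (Finset.mem_sdiff.mp ha).2
        _ ≤ _ := ENNReal.sum_le_tsum _

theorem subdivide {m : ℕ} {ι : Type*} (G : Finset ι) (r : ι → ℕ × (Fin m → ℤ)) (e : ℝ) (he : 0 ≤ e)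
    (h : ∑ a ∈ G, ccost (m : ℝ) (r a) ≤ ENNReal.ofReal e) :
    ∃ (J : ℕ) (F : Finset (Fin m → ℤ)), (∀ a ∈ G, cub (r a) ⊆ ⋃ q ∈ F, cub (J, q)) ∧
      (F.card : ℝ) * (((2 : ℝ) ^ J) ^ m)⁻¹ ≤ e := by
  classical
  set J := G.sup (fun a => (r a).1) with hJ
  have hle : ∀ a ∈ G, (r a).1 ≤ J := fun a ha => Finset.le_sup (f := fun a => (r a).1) ha
  refine ⟨J, G.biUnion fun a => box (J - (r a).1) (r a).2, ?_, ?_⟩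
  · intro a ha x hx
    have h1 := (mem_box (r a).1 (J - (r a).1) (r a).2 x).mpr hx
    rw [Nat.add_sub_cancel' (hle a ha)] at h1
    refine Set.mem_iUnion₂.mpr ⟨cell J x, Finset.mem_biUnion.mpr ⟨a, ha, h1⟩, mem_cub_cell J x⟩
  · have h2 : ∑ a ∈ G, ((2 : ℝ) ^ (r a).1) ^ (-(m : ℝ)) ≤ e := by
      rw [← ENNReal.ofReal_le_ofReal_iff he, ENNReal.ofReal_sum_of_nonneg fun a _ => by positivity]
      refine le_trans (le_of_eq ?_) h
      refine Finset.sum_congr rfl fun a _ => ?_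
      unfold ccost
      rw [← Real.rpow_natCast 2, ← Real.rpow_mul (by norm_num)]
      congr 2; ring
    have hc : (((G.biUnion fun a => box (J - (r a).1) (r a).2).card : ℕ) : ℝ) ≤
        ∑ a ∈ G, ((2 : ℝ) ^ (J - (r a).1)) ^ m := by
      have := Finset.card_biUnion_le (s := G) (t := fun a => box (J - (r a).1) (r a).2)
      simp only [box_card] at this
      exact_mod_cast this
    refine le_trans (mul_le_mul_of_nonneg_right hc (by positivity)) (le_trans (le_of_eq ?_) h2)
    rw [Finset.sum_mul]
    refine Finset.sum_congr rfl fun a ha => ?_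
    rw [Real.rpow_neg (by positivity), Real.rpow_natCast]
    have e1 : (2 : ℝ) ^ J = 2 ^ (J - (r a).1) * 2 ^ (r a).1 := by
      rw [← pow_add, Nat.sub_add_cancel (hle a ha)]
    rw [e1, mul_pow]; field_simp

theorem stepB {n : ℕ} (A : Set (Fin (n + 1) → ℝ)) (σ : ℝ) (hσ : 0 < σ) (hσ1 : (n : ℝ) - 1 < σ) (hσ2 : σ ≤ n)
    (hf : ∀ v, cont σ (Yf A v) ≠ 0) : cont (((n + 1 : ℕ) : ℝ)) A ≠ 0 := by
  intro hzero
  obtain ⟨b, c, hc0, hc1, hPG⟩ := PG A σ hf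
  obtain ⟨κ, hκ0, hκ1, hκs⟩ := exists_weights
  obtain ⟨C, hC0, hC⟩ := lb_core (n := n) σ hσ hσ1 hσ2
  set w : ℕ → ℝ := fun j => κ / ((j : ℝ) + 1) ^ 2 with hw
  have hw0 : ∀ j, 0 < w j := fun j => by simp only [hw]; positivity
  set e : ℕ → ℝ := fun j => (c * w j) ^ 5 / (2 * C) with he
  have he0 : ∀ j, 0 < e j := by
    intro j
    have := hw0 j
    simp only [he]; positivity
  obtain ⟨P, hP, hPs⟩ := cont_exists (s := ((n + 1 : ℕ) : ℝ)) (A := A) (ε := ENNReal.ofReal (e 0))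
    (by rw [hzero]; simpa using he0 0)
  obtain ⟨G, hG1, hG2⟩ := grouping (fun p : P => ccost ((n + 1 : ℕ) : ℝ) p.1) (fun k => ENNReal.ofReal (e k))
    (fun k => by simpa using he0 k) hPs.le (ne_top_of_lt hPs)
  choose J F hF1 hF2 using fun k => subdivide (G k) (fun p : P => p.1) (e k) (he0 k).le (hG2 k)
  obtain ⟨k, Θ, hΘ, hΘv, hY⟩ := hPG (fun k => ⋃ q ∈ F k, cub (J k, q)) w (by
    intro x hx
    obtain ⟨p, hp, hxp⟩ := Set.mem_iUnion₂.mp (hP hx)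
    obtain ⟨k, hk⟩ := hG1 ⟨p, hp⟩
    exact Set.mem_iUnion.mpr ⟨k, hF1 k ⟨p, hp⟩ hk hxp⟩) hκs
  have hl0 : 0 < c * w k := _root_.mul_pos hc0 (hw0 k)
  have hlw : c * w k ≤ w k := by nlinarith [hw0 k]
  have h1 := hC (J k) (F k) (c * w k) hl0 b Θ hΘ hΘv (by
    intro v hv
    obtain ⟨Y', hY'1, hY'2, hY'3⟩ := hY v hv
    exact ⟨Y', hY'1, hY'2, fun y hy => (ENNReal.ofReal_le_ofReal hlw).trans (hY'3 y hy)⟩)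
  have h2 := h1.trans (mul_le_mul_of_nonneg_left (hF2 k) hC0.le)
  have h3 : C * e k = (c * w k) ^ 5 / 2 := by simp only [he]; field_simp
  rw [h3] at h2
  have : 0 < (c * w k) ^ 5 := by positivity
  linarith

/-! ### Transfer to `Fin d → ℝ` -/

theorem planeSet_of_dk {d k : ℕ} {A : Set (Euc d)} (hA : IsDKSet d k A) :
    PlaneSet d k ((WithLp.ofLp : Euc d → (Fin d → ℝ)) '' A) := by
  intro M hM
  let e : (Fin d → ℝ) ≃ₗ[ℝ] Euc d := (WithLp.linearEquiv 2 ℝ (Fin d → ℝ)).symm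
  obtain ⟨x, hx⟩ := hA.2 (M.map (e : (Fin d → ℝ) →ₗ[ℝ] Euc d)) (by
    rw [LinearEquiv.finrank_map_eq e M, hM])
  refine ⟨WithLp.ofLp x, fun y hy => ?_⟩
  exact ⟨e y + x, hx (e y) (Submodule.mem_map_of_mem hy), rfl⟩

theorem part_one {c k : ℕ} (A : Set (Euc (c + k))) (hA : IsDKSet (c + k) k A) :
    ENNReal.ofReal ((c : ℝ) + k - c / (1 + Real.sqrt 2) ^ k) ≤ dimH A := by
  by_contra hcon
  rw [not_le] at hcon
  obtain ⟨r, hr1, hr2⟩ := ENNReal.lt_iff_exists_nnreal_btwn.mp hcon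
  set A' := (WithLp.ofLp : Euc (c + k) → (Fin (c + k) → ℝ)) '' A with hA'
  have h1 : dimH A' < r := lt_of_le_of_lt ((PiLp.lipschitzWith_ofLp 2 _).dimH_image_le A) hr1
  have h2 := hausdorffMeasure_of_dimH_lt h1
  have hr0 : (0 : ℝ) < r := by
    have : (0 : ℝ≥0∞) < r := lt_of_le_of_lt zero_le hr1
    exact_mod_cast this
  have h3 := cont_zero_of_hausdorff hr0 A' h2
  refine plane_cont k c A' r (planeSet_of_dk hA) ?_ h3
  have h4 : ENNReal.ofReal (r : ℝ) < ENNReal.ofReal ((c : ℝ) + k - c / (1 + Real.sqrt 2) ^ k) := by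
    rwa [ENNReal.ofReal_coe_nnreal]
  exact (ENNReal.ofReal_lt_ofReal_iff_of_nonneg hr0.le).mp h4

theorem part_two {c k : ℕ} (hc : 1 ≤ c) (hk : 1 ≤ k) (A : Set (Euc (c + k + 1))) (hA : IsDKSet (c + k + 1) (k + 1) A)
    (h : (c : ℝ) < (1 + Real.sqrt 2) ^ k) : 0 < volume A := by
  rw [pos_iff_ne_zero]
  intro h0
  set A' := (WithLp.ofLp : Euc (c + k + 1) → (Fin (c + k + 1) → ℝ)) '' A with hA'
  have hv : volume A' = 0 := by
    have e : A' = (WithLp.toLp 2 : (Fin (c + k + 1) → ℝ) → Euc (c + k + 1)) ⁻¹' A := by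
      ext x
      constructor
      · rintro ⟨y, hy, rfl⟩; exact hy
      · intro hx; exact ⟨_, hx, rfl⟩
    rw [e]
    exact (PiLp.volume_preserving_toLp (Fin (c + k + 1))).quasiMeasurePreserving.preimage_null h0
  have hz := cont_zero_of_volume (Nat.succ_pos _) A' hv
  have hpl : PlaneSet (c + k + 1) (k + 1) A' := planeSet_of_dk hA
  have hpow : (0 : ℝ) < (1 + Real.sqrt 2) ^ k := by positivity
  set X : ℝ := c / (1 + Real.sqrt 2) ^ k with hX
  have hX1 : X < 1 := by rw [hX, div_lt_one hpow]; exact h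
  have hc' : (1 : ℝ) ≤ c := by exact_mod_cast hc
  have hk' : (1 : ℝ) ≤ k := by exact_mod_cast hk
  have hX0 : 0 < X := by positivity
  refine stepB (n := c + k) A' ((c : ℝ) + k - (1 + X) / 2) (by linarith) (by push_cast; linarith)
    (by push_cast; linarith) (fun v => ?_) hz
  exact plane_cont k c _ _ (PlaneSet.fiber hpl v) (by rw [← hX]; linarith)

/-- Corollary: every `(d,k)` set has Hausdorff dimension at least
`d - (d-k)/(1+√2)^k`; moreover, if `(1+√2)^{k-1} + k > d`, every `(d,k)` set has
positive `d`-dimensional Lebesgue measure. -/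
theorem statement4 (d k : ℕ) (hk : 2 ≤ k) (hkd : k < d)
    (A : Set (Euc d)) (hA : IsDKSet d k A) :
    ENNReal.ofReal ((d:ℝ) - ((d:ℝ) - (k:ℝ)) / (1 + Real.sqrt 2) ^ k) ≤ dimH A ∧
      ((1 + Real.sqrt 2) ^ (k - 1) + (k:ℝ) > (d:ℝ) → 0 < volume A) := by
  obtain ⟨c, rfl⟩ : ∃ c, d = c + k := ⟨d - k, by lia⟩
  constructor
  · have := part_one A hA
    push_cast
    rwa [add_sub_cancel_right]
  · intro h
    obtain ⟨k, rfl⟩ : ∃ k', k = k' + 1 := ⟨k - 1, by lia⟩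
    refine part_two (c := c) (k := k) (by lia) (by lia) A hA ?_
    rw [Nat.add_sub_cancel] at h
    push_cast at h
    linarith

end
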